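/- arXiv:1203.1030 — 4 statements merged into one kernel-verified Lean document; each statement's English description precedes it below -/
import Mathlib

section
/- Let g be a real-valued additive function on the squarefree natural numbers (i.e. g(nm) = g(n) + g(m) whenever n and m are coprime squarefree numbers) with |g(p)| ≤ 1 for every prime p. Set A(x) = ∑_{p ≤ x} g(p)/p and B(x) = (∑_{p ≤ x} g(p)²/p)^{1/2}, the sums taken over primes p ≤ x. If B(x)/log log log x → ∞ as x → ∞, then for every real z, the proportion |{n ≤ x : n squarefree and g(n) − A(x) ≤ z·B(x)}| / |{n ≤ x : n squarefree}| converges, as x → ∞, to G(z) = (1/√(2π)) ∫_{−∞}^{z} e^{−w²/2} dw. -/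
open Filter Real
open scoped Classical

/-- The number of squarefree `n ≤ N` divisible by every element of `D`. -/
noncomputable def squarefreeCount (D : Finset ℕ) (N : ℕ) : ℕ :=
  ((Finset.range (N + 1)).filter (fun n => Squarefree n ∧ ∀ p ∈ D, p ∣ n)).card

theorem squarefreeCount_insert {D : Finset ℕ} {p : ℕ} (hp : p.Prime) (hD : ∀ q ∈ D, q.Prime)
    (hpD : p ∉ D) (N : ℕ) :
    squarefreeCount (insert p D) N + squarefreeCount (insert p D) (N / p) =
      squarefreeCount D (N / p) := by
  unfold squarefreeCount
  have hsplit := Finset.card_filter_add_card_filter_not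
    (s := (Finset.range (N / p + 1)).filter (fun n => Squarefree n ∧ ∀ q ∈ D, q ∣ n))
    (fun n => p ∣ n)
  rw [← hsplit, add_comm]
  congr 1
  · congr 1
    ext n
    simp only [Finset.mem_filter, Finset.mem_insert, forall_eq_or_imp]
    tauto
  · symm
    apply Finset.card_bij (fun m _ => p * m)
    · intro m hm
      simp only [Finset.mem_filter, Finset.mem_range, Finset.mem_insert, forall_eq_or_imp] at hm ⊢
      obtain ⟨⟨hmN, hsq, hdvd⟩, hpm⟩ := hm
      refine ⟨?_, ?_, dvd_mul_right _ _, fun q hq => (hdvd q hq).mul_left _⟩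
      · have := (Nat.le_div_iff_mul_le hp.pos).1 (Nat.lt_succ_iff.1 hmN)
        rw [mul_comm] at this
        omega
      · rw [Nat.squarefree_mul ((Nat.Prime.coprime_iff_not_dvd hp).2 hpm)]
        exact ⟨hp.prime.squarefree, hsq⟩
    · intro a _ b _ h
      exact Nat.eq_of_mul_eq_mul_left hp.pos h
    · intro n hn
      simp only [Finset.mem_filter, Finset.mem_range, Finset.mem_insert, forall_eq_or_imp] at hn
      obtain ⟨hnN, hsq, ⟨m, rfl⟩, hdvd⟩ := hn
      have hcop := Nat.coprime_of_squarefree_mul hsq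
      refine ⟨m, ?_, rfl⟩
      simp only [Finset.mem_filter, Finset.mem_range]
      refine ⟨⟨?_, hsq.of_mul_right, fun q hq => ?_⟩, (Nat.Prime.coprime_iff_not_dvd hp).1 hcop⟩
      · rw [Nat.lt_succ_iff, Nat.le_div_iff_mul_le hp.pos, mul_comm]
        omega
      · rcases (Nat.Prime.dvd_mul (hD q hq)).1 (hdvd q hq) with h | h
        · exact absurd ((Nat.prime_dvd_prime_iff_eq (hD q hq) hp).1 h ▸ hq) hpD
        · exact h

theorem sum_moebius_sq_dvd {n : ℕ} (hn : n ≠ 0) {M : ℕ} (hM : n ≤ M) :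
    ∑ d ∈ (Finset.Ioc 0 M).filter (fun d => d ^ 2 ∣ n), ArithmeticFunction.moebius d =
      if Squarefree n then 1 else 0 := by
  obtain ⟨a, b, hab, ha⟩ := Nat.sq_mul_squarefree n
  have hb : b ≠ 0 := by rintro rfl; simp at hab; exact hn hab.symm
  have ha0 : a ≠ 0 := by rintro rfl; simp at hab; exact hn hab.symm
  have hset : (Finset.Ioc 0 M).filter (fun d => d ^ 2 ∣ n) = b.divisors := by
    ext d
    simp only [Finset.mem_filter, Finset.mem_Ioc, Nat.mem_divisors]
    constructor
    · rintro ⟨⟨hd, _⟩, hdn⟩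
      refine ⟨?_, hb⟩
      rw [← hab] at hdn
      by_contra hcon
      obtain ⟨p, k, hp, h1, h2⟩ : ∃ p k : ℕ, p.Prime ∧ p ^ k ∣ d ∧ ¬ p ^ k ∣ b := by
        by_contra hc
        push Not at hc
        exact hcon ((Nat.dvd_iff_prime_pow_dvd_dvd b d).2 hc)
      have h3 : p ^ (k * 2) ∣ b ^ 2 * a := by
        rw [pow_mul]; exact (pow_dvd_pow_of_dvd h1 2).trans hdn
      rw [hp.pow_dvd_iff_le_factorization (by positivity), Nat.factorization_mul (by positivity) ha0,
        Nat.factorization_pow] at h3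
      rw [hp.pow_dvd_iff_le_factorization hb] at h2
      have := ha.natFactorization_le_one p
      simp at h3
      omega
    · rintro ⟨hd, _⟩
      have hdn : d ^ 2 ∣ n := hab ▸ (pow_dvd_pow_of_dvd hd 2).mul_right a
      refine ⟨⟨Nat.pos_of_dvd_of_pos hd (Nat.pos_of_ne_zero hb), ?_⟩, hdn⟩
      exact ((Nat.le_self_pow two_ne_zero d).trans (Nat.le_of_dvd (Nat.pos_of_ne_zero hn) hdn)).trans
        hM
  rw [hset, ← ArithmeticFunction.coe_mul_zeta_apply, ArithmeticFunction.moebius_mul_coe_zeta,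
    ArithmeticFunction.one_apply]
  congr 1
  refine propext ⟨?_, fun h => ?_⟩
  · rintro rfl
    simpa [← hab] using ha
  · have := h b ⟨a, by rw [← hab]; ring⟩
    simpa using this

theorem exists_moebius_density :
    ∃ c : ℝ, 0 < c ∧ ∀ M : ℕ,
      |c - ∑ d ∈ Finset.Ioc 0 M, (ArithmeticFunction.moebius d : ℝ) / (d : ℝ) ^ 2| ≤
        2 / ((M : ℝ) + 1) := by
  set f : ℕ → ℝ := fun d => (ArithmeticFunction.moebius d : ℝ) / (d : ℝ) ^ 2 with hf
  have hbd : ∀ d, |f d| ≤ ((d : ℝ) ^ 2)⁻¹ := by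
    intro d
    rw [hf]
    change |(ArithmeticFunction.moebius d : ℝ) / (d : ℝ) ^ 2| ≤ _
    rw [abs_div, abs_of_nonneg (by positivity : (0 : ℝ) ≤ (d : ℝ) ^ 2), div_eq_mul_inv]
    have h1 : |(ArithmeticFunction.moebius d : ℝ)| ≤ 1 := by
      exact_mod_cast ArithmeticFunction.abs_moebius_le_one (n := d)
    exact mul_le_of_le_one_left (by positivity) h1
  have hsum : Summable f :=
    Summable.of_norm_bounded (Real.summable_nat_pow_inv.2 one_lt_two) hbd
  have hlim : Tendsto (fun K : ℕ => ∑ d ∈ Finset.Ioc 0 K, f d) atTop (nhds (∑' d, f d)) := by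
    have := hsum.hasSum.tendsto_sum_nat.comp (tendsto_add_atTop_nat 1)
    refine this.congr fun K => ?_
    rw [Function.comp_apply, Finset.sum_range_eq_add_Ico _ (Nat.succ_pos K)]
    have h0 : f 0 = 0 := by simp [hf]
    rw [h0, zero_add]
    rfl
  have hmain : ∀ M : ℕ, |∑' d, f d - ∑ d ∈ Finset.Ioc 0 M, f d| ≤ 2 / ((M : ℝ) + 1) := by
    intro M
    refine le_of_tendsto (hlim.sub_const _).abs ?_
    filter_upwards [eventually_ge_atTop M] with K hK
    rw [← Finset.sum_Ioc_consecutive f (Nat.zero_le M) hK, add_sub_cancel_left]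
    calc |∑ d ∈ Finset.Ioc M K, f d| ≤ ∑ d ∈ Finset.Ioc M K, |f d| :=
          Finset.abs_sum_le_sum_abs _ _
      _ ≤ ∑ d ∈ Finset.Ioc M K, ((d : ℝ) ^ 2)⁻¹ := Finset.sum_le_sum fun d _ => hbd d
      _ = ∑ d ∈ Finset.Ioo M (K + 1), ((d : ℝ) ^ 2)⁻¹ := by
          congr 1
          ext d
          simp only [Finset.mem_Ioc, Finset.mem_Ioo]
          omega
      _ ≤ 2 / ((M : ℝ) + 1) := sum_Ioo_inv_sq_le (α := ℝ) M (K + 1)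
  refine ⟨∑' d, f d, ?_, hmain⟩
  have h2 := (abs_le.1 (hmain 2)).1
  have h3 : ∑ d ∈ Finset.Ioc 0 2, f d = 3 / 4 := by
    have : Finset.Ioc 0 2 = {1, 2} := rfl
    rw [this, Finset.sum_pair (by norm_num)]
    simp only [hf]
    rw [ArithmeticFunction.moebius_apply_prime Nat.prime_two]
    norm_num
  rw [h3] at h2
  norm_num at h2
  linarith

theorem squarefreeCount_empty (N : ℕ) :
    (squarefreeCount ∅ N : ℤ) =
      ∑ d ∈ Finset.Ioc 0 (Nat.sqrt N), ArithmeticFunction.moebius d * ((N / d ^ 2 : ℕ) : ℤ) := by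
  have h1 : (squarefreeCount ∅ N : ℤ) =
      ∑ n ∈ Finset.Ioc 0 N, if Squarefree n then (1 : ℤ) else 0 := by
    rw [← Finset.sum_filter, Finset.sum_const, squarefreeCount]
    simp only [nsmul_eq_mul, mul_one]
    congr 2
    ext n
    simp only [Finset.mem_filter, Finset.mem_range, Finset.mem_Ioc, Finset.notMem_empty,
      false_implies, implies_true, and_true]
    constructor
    · rintro ⟨h, hs⟩
      exact ⟨⟨Nat.pos_of_ne_zero hs.ne_zero, by omega⟩, hs⟩
    · rintro ⟨h, hs⟩
      exact ⟨by omega, hs⟩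
  have h2 : ∀ n ∈ Finset.Ioc 0 N, (if Squarefree n then (1 : ℤ) else 0) =
      ∑ d ∈ Finset.Ioc 0 N, if d ^ 2 ∣ n then ArithmeticFunction.moebius d else 0 := by
    intro n hn
    rw [Finset.mem_Ioc] at hn
    rw [← sum_moebius_sq_dvd hn.1.ne' hn.2, Finset.sum_filter]
  rw [h1, Finset.sum_congr rfl h2, Finset.sum_comm]
  have h3 : ∀ d ∈ Finset.Ioc 0 N,
      (∑ n ∈ Finset.Ioc 0 N, if d ^ 2 ∣ n then ArithmeticFunction.moebius d else 0) =
        ArithmeticFunction.moebius d * ((N / d ^ 2 : ℕ) : ℤ) := by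
    intro d _
    rw [← Finset.sum_filter, Finset.sum_const, Nat.Ioc_filter_dvd_card_eq_div, nsmul_eq_mul,
      mul_comm]
  rw [Finset.sum_congr rfl h3]
  symm
  apply Finset.sum_subset (Finset.Ioc_subset_Ioc_right (Nat.sqrt_le_self N))
  intro d hd hd'
  rw [Finset.mem_Ioc] at hd hd'
  have : N < d ^ 2 := by
    rw [pow_two]
    exact Nat.sqrt_lt.1 (by omega)
  rw [Nat.div_eq_of_lt this]
  simp

theorem exists_squarefreeCount_empty_bound :
    ∃ c : ℝ, 0 < c ∧ ∀ N : ℕ, |(squarefreeCount ∅ N : ℝ) - c * N| ≤ 3 * √(N : ℝ) := by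
  obtain ⟨c, hc, hM⟩ := exists_moebius_density
  refine ⟨c, hc, fun N => ?_⟩
  set s := Nat.sqrt N with hs
  have hQ : (squarefreeCount ∅ N : ℝ) =
      ∑ d ∈ Finset.Ioc 0 s, (ArithmeticFunction.moebius d : ℝ) * ((N / d ^ 2 : ℕ) : ℝ) := by
    have h := congrArg (Int.cast : ℤ → ℝ) (squarefreeCount_empty N)
    push_cast at h
    exact h
  have h1 : |(squarefreeCount ∅ N : ℝ) -
      N * ∑ d ∈ Finset.Ioc 0 s, (ArithmeticFunction.moebius d : ℝ) / (d : ℝ) ^ 2| ≤ s := by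
    rw [hQ, Finset.mul_sum, ← Finset.sum_sub_distrib]
    calc _ ≤ ∑ d ∈ Finset.Ioc 0 s, |(ArithmeticFunction.moebius d : ℝ) * ((N / d ^ 2 : ℕ) : ℝ) -
          N * ((ArithmeticFunction.moebius d : ℝ) / (d : ℝ) ^ 2)| :=
          Finset.abs_sum_le_sum_abs _ _
      _ ≤ ∑ d ∈ Finset.Ioc 0 s, (1 : ℝ) := by
          refine Finset.sum_le_sum fun d hd => ?_
          have hd0 : (0 : ℝ) < (d : ℝ) ^ 2 := by
            have := (Finset.mem_Ioc.1 hd).1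
            positivity
          have h2 : |(ArithmeticFunction.moebius d : ℝ)| ≤ 1 := by
            exact_mod_cast ArithmeticFunction.abs_moebius_le_one (n := d)
          have h3 : ((N / d ^ 2 : ℕ) : ℝ) ≤ (N : ℝ) / (d : ℝ) ^ 2 := by
            exact_mod_cast Nat.cast_div_le (α := ℝ) (m := N) (n := d ^ 2)
          have h4 : (N : ℝ) / (d : ℝ) ^ 2 ≤ ((N / d ^ 2 : ℕ) : ℝ) + 1 := by
            rw [div_le_iff₀ hd0]
            have hpos : 0 < d ^ 2 := by exact_mod_cast hd0
            have := (Nat.lt_mul_div_succ N hpos).le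
            have h5 : (N : ℝ) ≤ ((d ^ 2 * (N / d ^ 2 + 1) : ℕ) : ℝ) := by exact_mod_cast this
            push_cast at h5 ⊢
            linarith
          have h5 : (ArithmeticFunction.moebius d : ℝ) * ((N / d ^ 2 : ℕ) : ℝ) -
              N * ((ArithmeticFunction.moebius d : ℝ) / (d : ℝ) ^ 2) =
              (ArithmeticFunction.moebius d : ℝ) * (((N / d ^ 2 : ℕ) : ℝ) - N / (d : ℝ) ^ 2) := by
            ring
          rw [h5, abs_mul]
          refine mul_le_one₀ h2 (abs_nonneg _) ?_
          rw [abs_le]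
          constructor <;> linarith
      _ = s := by simp
  have h2 : |N * (c - ∑ d ∈ Finset.Ioc 0 s, (ArithmeticFunction.moebius d : ℝ) / (d : ℝ) ^ 2)| ≤
      2 * √(N : ℝ) := by
    rw [abs_mul, Nat.abs_cast]
    have h3 : √(N : ℝ) ≤ s + 1 := by
      rw [Real.sqrt_le_left (by positivity)]
      have := (Nat.lt_succ_sqrt' N).le
      exact_mod_cast this
    have h4 : (N : ℝ) = √(N : ℝ) * √(N : ℝ) := (Real.mul_self_sqrt (by positivity)).symm
    calc (N : ℝ) * _ ≤ N * (2 / ((s : ℝ) + 1)) := by gcongr; exact hM s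
      _ ≤ 2 * √(N : ℝ) := by
        rw [← mul_div_assoc, div_le_iff₀ (by positivity)]
        nlinarith [Real.sqrt_nonneg (N : ℝ)]
  have h3 : (s : ℝ) ≤ √(N : ℝ) := by
    apply Real.le_sqrt_of_sq_le
    exact_mod_cast Nat.sqrt_le' N
  rw [abs_le] at *
  constructor <;> nlinarith

/-- Squarefree numbers divisible by a given finite set of primes `D` have relative density
`∏ p ∈ D, 1 / (p + 1)`, with an error term of square-root size. -/
theorem exists_squarefreeCount_bound :
    ∃ c : ℝ, 0 < c ∧ ∃ E : ℝ, 0 < E ∧ ∀ D : Finset ℕ, (∀ p ∈ D, p.Prime) → ∀ x : ℝ, 0 ≤ x →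
      |(squarefreeCount D ⌊x⌋₊ : ℝ) - c * (∏ p ∈ D, ((p : ℝ) + 1)⁻¹) * x| ≤
        E * 3 ^ D.card * √x := by
  obtain ⟨c, hc, hQ⟩ := exists_squarefreeCount_empty_bound
  refine ⟨c, hc, 3 + c, by positivity, fun D => ?_⟩
  have hsmall : ∀ (D : Finset ℕ) (x : ℝ), 0 ≤ x → x < 1 →
      |(squarefreeCount D ⌊x⌋₊ : ℝ) - c * (∏ p ∈ D, ((p : ℝ) + 1)⁻¹) * x| ≤
        (3 + c) * 3 ^ D.card * √x := by
    intro D x hx hx1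
    have h0 : squarefreeCount D ⌊x⌋₊ = 0 := by
      rw [Nat.floor_eq_zero.2 hx1, squarefreeCount, Finset.card_eq_zero,
        Finset.filter_eq_empty_iff]
      intro n hn h
      have : n = 0 := by simpa using hn
      exact h.1.ne_zero this
    have hprod : ∏ p ∈ D, ((p : ℝ) + 1)⁻¹ ≤ 1 :=
      Finset.prod_le_one (fun p _ => by positivity)
        fun p _ => inv_le_one_of_one_le₀ (by linarith [Nat.cast_nonneg (α := ℝ) p])
    have hprod0 : 0 ≤ ∏ p ∈ D, ((p : ℝ) + 1)⁻¹ := Finset.prod_nonneg fun p _ => by positivity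
    have h3 : (1 : ℝ) ≤ 3 ^ D.card := one_le_pow₀ (by norm_num)
    have hxs : x ≤ √x := by
      apply Real.le_sqrt_of_sq_le
      nlinarith
    rw [h0, Nat.cast_zero, zero_sub, abs_neg, abs_of_nonneg (by positivity)]
    gcongr ?_ * ?_ * ?_ <;> linarith
  induction D using Finset.induction_on with
  | empty =>
    intro _ x hx
    rcases lt_or_ge x 1 with h | h
    · exact hsmall _ x hx h
    · have h1 := hQ ⌊x⌋₊
      have h2 : √((⌊x⌋₊ : ℕ) : ℝ) ≤ √x := Real.sqrt_le_sqrt (Nat.floor_le hx)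
      have h3 : 1 ≤ √x := by rw [Real.one_le_sqrt]; exact h
      have h4 := Nat.floor_le hx
      have h5 := Nat.lt_floor_add_one x
      simp only [Finset.prod_empty, Finset.card_empty, pow_zero, mul_one]
      rw [abs_le] at *
      constructor <;> nlinarith
  | insert p D hpD ih =>
    intro hprime
    have hp : p.Prime := hprime p (Finset.mem_insert_self _ _)
    have hD : ∀ q ∈ D, q.Prime := fun q hq => hprime q (Finset.mem_insert_of_mem hq)
    have hp2 : (2 : ℝ) ≤ p := by exact_mod_cast hp.two_le
    suffices H : ∀ (n : ℕ) (x : ℝ), 0 ≤ x → ⌊x⌋₊ = n →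
        |(squarefreeCount (insert p D) ⌊x⌋₊ : ℝ) -
          c * (∏ q ∈ insert p D, ((q : ℝ) + 1)⁻¹) * x| ≤
        (3 + c) * 3 ^ (insert p D).card * √x from fun x hx => H _ x hx rfl
    intro n
    induction n using Nat.strong_induction_on with
    | _ n IH =>
      intro x hx hxn
      rcases lt_or_ge x 1 with h | h
      · exact hsmall _ x hx h
      · have hfl : ⌊x / p⌋₊ = ⌊x⌋₊ / p := Nat.floor_div_natCast x p
        have hlt : ⌊x / p⌋₊ < n := by
          rw [hfl, ← hxn]
          exact Nat.div_lt_self (Nat.floor_pos.2 h) hp.one_lt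
        have h1 := IH _ hlt (x / p) (by positivity) rfl
        have h2 := ih hD (x / p) (by positivity)
        have h3 := squarefreeCount_insert hp hD hpD ⌊x⌋₊
        rw [← hfl] at h3
        have h3' : (squarefreeCount (insert p D) ⌊x⌋₊ : ℝ) =
          squarefreeCount D ⌊x / p⌋₊ - squarefreeCount (insert p D) ⌊x / p⌋₊ := by
          rw [← h3]; push_cast; ring
        have hs : √(x / p) ≤ 3 / 4 * √x := by
          rw [Real.sqrt_le_left (by positivity), mul_pow, Real.sq_sqrt hx,
            div_le_iff₀ (by positivity)]
          nlinarith
        rw [Finset.prod_insert hpD, Finset.card_insert_of_notMem hpD, pow_succ] at *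
        rw [h3']
        set h := ∏ q ∈ D, ((q : ℝ) + 1)⁻¹
        have hid : c * (((p : ℝ) + 1)⁻¹ * h) * x =
            c * h * (x / p) - c * (((p : ℝ) + 1)⁻¹ * h) * (x / p) := by
          field_simp
          ring
        have hK : 0 ≤ (3 + c) * 3 ^ D.card := by positivity
        have hs' := mul_le_mul_of_nonneg_left hs hK
        rw [hid]
        rw [abs_le] at *
        constructor <;> linarith

/-- If a linear functional is small on the indicators of `D ⊆ ·` for small `D`, then it is small
on low powers of any affine function of the indicators of `p ∈ ·`. -/
theorem abs_apply_indicator_mul_pow_le (L : (Finset ℕ → ℝ) →ₗ[ℝ] ℝ) (P : Finset ℕ) (c : ℕ → ℝ)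
    (a : ℝ) {ε : ℝ} {K : ℕ}
    (h : ∀ D ⊆ P, D.card ≤ K → |L (fun S => if D ⊆ S then 1 else 0)| ≤ ε) (k : ℕ) :
    ∀ D ⊆ P, D.card + k ≤ K →
      |L (fun S => (if D ⊆ S then 1 else 0) * ((∑ p ∈ P, c p * if p ∈ S then 1 else 0) - a) ^ k)| ≤
        ε * ((∑ p ∈ P, |c p|) + |a|) ^ k := by
  induction k with
  | zero => simpa using h
  | succ k ih =>
    intro D hD hk
    set T : Finset ℕ → ℝ := fun S => (∑ p ∈ P, c p * if p ∈ S then 1 else 0) - a with hT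
    set F : Finset ℕ → Finset ℕ → ℝ := fun D S => (if D ⊆ S then 1 else 0) * T S ^ k with hF
    have hexp : (fun S => (if D ⊆ S then (1 : ℝ) else 0) * T S ^ (k + 1)) =
        ∑ p ∈ P, c p • F (insert p D) - a • F D := by
      ext S
      simp only [Pi.sub_apply, Finset.sum_apply, Pi.smul_apply, smul_eq_mul, hF]
      have hTS : T S ^ (k + 1) = ((∑ p ∈ P, c p * if p ∈ S then 1 else 0) - a) * T S ^ k :=
        pow_succ' _ _
      rw [hTS]
      generalize T S ^ k = y
      rw [sub_mul, mul_sub, Finset.sum_mul, Finset.mul_sum]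
      congr 1
      · refine Finset.sum_congr rfl fun p _ => ?_
        by_cases h1 : p ∈ S <;> by_cases h2 : D ⊆ S <;> simp [Finset.insert_subset_iff, h1, h2]
      · ring
    change |L (fun S => (if D ⊆ S then (1 : ℝ) else 0) * T S ^ (k + 1))| ≤ _
    have hε : 0 ≤ ε := (abs_nonneg _).trans (h ∅ (Finset.empty_subset _) (by simp))
    set M := (∑ p ∈ P, |c p|) + |a| with hM
    rw [hexp, map_sub, map_sum, map_smul]
    have hI : ∀ p ∈ P, |L (F (insert p D))| ≤ ε * M ^ k := fun p hp =>
      ih (insert p D) (Finset.insert_subset hp hD)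
        (by have := Finset.card_insert_le p D; omega)
    have h0 : |L (F D)| ≤ ε * M ^ k := ih D hD (by omega)
    calc |∑ p ∈ P, L (c p • F (insert p D)) - a • L (F D)|
        ≤ |∑ p ∈ P, L (c p • F (insert p D))| + |a • L (F D)| := abs_sub _ _
      _ ≤ ∑ p ∈ P, |L (c p • F (insert p D))| + |a • L (F D)| := by
          gcongr
          exact Finset.abs_sum_le_sum_abs _ _
      _ ≤ ∑ p ∈ P, |c p| * (ε * M ^ k) + |a| * (ε * M ^ k) := by
          simp only [map_smul, smul_eq_mul, abs_mul]
          gcongr with p hp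
          exact hI p hp
      _ = ε * M ^ (k + 1) := by
          rw [← Finset.sum_mul, hM]
          ring

theorem norm_exp_mul_I_sub_sum_le (n : ℕ) (v : ℝ) :
    ‖Complex.exp (v * Complex.I) - ∑ k ∈ Finset.range n, (v * Complex.I) ^ k / (k.factorial : ℂ)‖ ≤
      |v| ^ n / n.factorial := by
  suffices H : ∀ (n : ℕ) (σ : ℝ), |σ| = 1 → ∀ v : ℝ, 0 ≤ v →
      ‖Complex.exp (v * (σ * Complex.I)) -
        ∑ k ∈ Finset.range n, (v * (σ * Complex.I)) ^ k / (k.factorial : ℂ)‖ ≤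
      v ^ n / n.factorial by
    rcases le_total 0 v with hv | hv
    · have := H n 1 (by simp) v hv
      simpa [abs_of_nonneg hv] using this
    · have := H n (-1) (by simp) (-v) (by linarith)
      simpa [abs_of_nonpos hv] using this
  intro n σ hσ
  induction n with
  | zero =>
    intro v _
    have : (v : ℂ) * (σ * Complex.I) = ((v * σ : ℝ) : ℂ) * Complex.I := by push_cast; ring
    rw [this]
    simp [-Complex.ofReal_mul, Complex.norm_exp_ofReal_mul_I]
  | succ n ih =>
    intro v hv
    have hd : ∀ x : ℝ, HasDerivAt (fun v : ℝ => Complex.exp (v * (σ * Complex.I)) -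
        ∑ k ∈ Finset.range (n + 1), ((v : ℂ) * (σ * Complex.I)) ^ k / (k.factorial : ℂ))
        ((σ * Complex.I) * (Complex.exp (x * (σ * Complex.I)) -
          ∑ k ∈ Finset.range n, ((x : ℂ) * (σ * Complex.I)) ^ k / (k.factorial : ℂ))) x := by
      intro x
      have h0 : HasDerivAt (fun v : ℝ => (v : ℂ) * (σ * Complex.I)) (σ * Complex.I) x := by
        simpa using (Complex.ofRealCLM.hasDerivAt (x := x)).mul_const (σ * Complex.I)
      have h1 := h0.cexp
      have h2 : HasDerivAt (fun v : ℝ => ∑ k ∈ Finset.range (n + 1),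
          ((v : ℂ) * (σ * Complex.I)) ^ k / (k.factorial : ℂ))
          (∑ k ∈ Finset.range (n + 1),
            (k * ((x : ℂ) * (σ * Complex.I)) ^ (k - 1) * (σ * Complex.I)) / (k.factorial : ℂ)) x :=
        HasDerivAt.fun_sum fun k _ => (h0.fun_pow k).div_const _
      refine (h1.sub h2).congr_deriv ?_
      rw [Finset.sum_range_succ', mul_sub, mul_comm, Finset.mul_sum]
      simp only [CharP.cast_eq_zero, zero_mul, zero_div, add_zero]
      congr 1
      refine Finset.sum_congr rfl fun k _ => ?_
      rw [Nat.factorial_succ]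
      have : ((k.factorial : ℕ) : ℂ) ≠ 0 := by exact_mod_cast k.factorial_ne_zero
      have : ((k : ℂ) + 1) ≠ 0 := by exact_mod_cast k.succ_ne_zero
      push_cast
      field_simp
    have hB : ∀ x : ℝ, HasDerivAt (fun v : ℝ => v ^ (n + 1) / ((n + 1).factorial : ℝ))
        (x ^ n / n.factorial) x := by
      intro x
      refine ((hasDerivAt_pow (n + 1) x).div_const _).congr_deriv ?_
      rw [Nat.factorial_succ]
      have : ((n.factorial : ℕ) : ℝ) ≠ 0 := by exact_mod_cast n.factorial_ne_zero
      push_cast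
      field_simp
    refine image_norm_le_of_norm_deriv_right_le_deriv_boundary (a := 0) (b := v)
      (fun x _ => (hd x).continuousAt.continuousWithinAt)
      (fun x _ => (hd x).hasDerivWithinAt) ?_ (fun x => hB x) ?_ (Set.right_mem_Icc.2 hv)
    · simp [Finset.sum_range_succ']
    · intro x hx
      rw [norm_mul]
      have : ‖(σ : ℂ) * Complex.I‖ = 1 := by simp [hσ]
      rw [this, one_mul]
      exact ih x hx.1

theorem norm_sum_exp_sub_moments_le {α : Type*} (A : Finset α) (u Z : α → ℝ)
    (hu : ∀ i ∈ A, 0 ≤ u i) {K : ℕ} (hK : Even K) (t : ℝ) :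
    ‖∑ i ∈ A, (u i : ℂ) * Complex.exp (((t * Z i : ℝ) : ℂ) * Complex.I) -
        ∑ k ∈ Finset.range K, ((t : ℂ) * Complex.I) ^ k / k.factorial *
          ((∑ i ∈ A, u i * Z i ^ k : ℝ) : ℂ)‖ ≤
      ∑ i ∈ A, u i * ((t * Z i) ^ K / K.factorial) := by
  have h1 : ∑ k ∈ Finset.range K, ((t : ℂ) * Complex.I) ^ k / k.factorial *
        ((∑ i ∈ A, u i * Z i ^ k : ℝ) : ℂ) =
      ∑ i ∈ A, (u i : ℂ) * ∑ k ∈ Finset.range K,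
        (((t * Z i : ℝ) : ℂ) * Complex.I) ^ k / (k.factorial : ℂ) := by
    push_cast
    simp only [Finset.mul_sum]
    rw [Finset.sum_comm]
    refine Finset.sum_congr rfl fun i _ => Finset.sum_congr rfl fun k _ => ?_
    rw [mul_right_comm, mul_pow _ (Z i : ℂ)]
    ring
  rw [h1, ← Finset.sum_sub_distrib]
  refine (norm_sum_le _ _).trans (Finset.sum_le_sum fun i hi => ?_)
  rw [← mul_sub, norm_mul, Complex.norm_real, Real.norm_of_nonneg (hu i hi)]
  refine mul_le_mul_of_nonneg_left ?_ (hu i hi)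
  have := norm_exp_mul_I_sub_sum_le K (t * Z i)
  rwa [hK.pow_abs] at this

theorem sum_mul_pow_div_factorial {α : Type*} (A : Finset α) (u Z : α → ℝ) {K : ℕ}
    (hK : Even K) (t : ℝ) :
    ∑ i ∈ A, u i * ((t * Z i) ^ K / K.factorial) =
      |t| ^ K / K.factorial * ∑ i ∈ A, u i * Z i ^ K := by
  rw [Finset.mul_sum, hK.pow_abs]
  refine Finset.sum_congr rfl fun i _ => ?_
  rw [mul_pow]
  ring

/-- Comparison of the characteristic functions of two finitely supported distributions through
their moments up to an even order. -/
theorem norm_sum_exp_sub_sum_exp_le {ι κ : Type*} (I : Finset ι) (J : Finset κ) (w X : ι → ℝ)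
    (v Y : κ → ℝ) (hw : ∀ i ∈ I, 0 ≤ w i) (hv : ∀ j ∈ J, 0 ≤ v j) {K : ℕ} (hK : Even K) (t : ℝ) :
    ‖∑ i ∈ I, (w i : ℂ) * Complex.exp (((t * X i : ℝ) : ℂ) * Complex.I) -
        ∑ j ∈ J, (v j : ℂ) * Complex.exp (((t * Y j : ℝ) : ℂ) * Complex.I)‖ ≤
      ∑ k ∈ Finset.range (K + 1), |t| ^ k / k.factorial *
        |∑ i ∈ I, w i * X i ^ k - ∑ j ∈ J, v j * Y j ^ k| +
      2 * ∑ j ∈ J, v j * ((t * Y j) ^ K / K.factorial) := by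
  have h1 := norm_sum_exp_sub_moments_le I w X hw hK t
  have h2 := norm_sum_exp_sub_moments_le J v Y hv hK t
  set a := ∑ i ∈ I, (w i : ℂ) * Complex.exp (((t * X i : ℝ) : ℂ) * Complex.I)
  set b := ∑ j ∈ J, (v j : ℂ) * Complex.exp (((t * Y j : ℝ) : ℂ) * Complex.I)
  set mX : ℕ → ℝ := fun k => ∑ i ∈ I, w i * X i ^ k with hmX
  set mY : ℕ → ℝ := fun k => ∑ j ∈ J, v j * Y j ^ k with hmY
  have h3 : ‖∑ k ∈ Finset.range K, ((t : ℂ) * Complex.I) ^ k / k.factorial * ((mX k : ℝ) : ℂ) -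
      ∑ k ∈ Finset.range K, ((t : ℂ) * Complex.I) ^ k / k.factorial * ((mY k : ℝ) : ℂ)‖ ≤
      ∑ k ∈ Finset.range K, |t| ^ k / k.factorial * |mX k - mY k| := by
    rw [← Finset.sum_sub_distrib]
    refine (norm_sum_le _ _).trans (Finset.sum_le_sum fun k _ => ?_)
    rw [← mul_sub, ← Complex.ofReal_sub, norm_mul, Complex.norm_real, norm_div, norm_pow, norm_mul]
    simp
  have h4 : ∑ i ∈ I, w i * ((t * X i) ^ K / K.factorial) ≤
      |t| ^ K / K.factorial * |mX K - mY K| + ∑ j ∈ J, v j * ((t * Y j) ^ K / K.factorial) := by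
    rw [sum_mul_pow_div_factorial _ _ _ hK, sum_mul_pow_div_factorial _ _ _ hK, ← mul_add]
    refine mul_le_mul_of_nonneg_left ?_ (by positivity)
    have := le_abs_self (mX K - mY K)
    simp only [hmX, hmY] at this ⊢
    linarith
  rw [Finset.sum_range_succ]
  set sX := ∑ k ∈ Finset.range K, ((t : ℂ) * Complex.I) ^ k / k.factorial * ((mX k : ℝ) : ℂ)
  set sY := ∑ k ∈ Finset.range K, ((t : ℂ) * Complex.I) ^ k / k.factorial * ((mY k : ℝ) : ℂ)
  have h5 : a - b = (a - sX) + (sX - sY) - (b - sY) := by ring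
  have h6 : ‖a - b‖ ≤ ‖a - sX‖ + ‖sX - sY‖ + ‖b - sY‖ := by
    rw [h5]
    exact (norm_sub_le _ _).trans (add_le_add_left (norm_add_le _ _) _)
  change ‖a - b‖ ≤ _ + |t| ^ K / K.factorial * |mX K - mY K| + _
  linarith

theorem norm_prod_sub_prod_le {ι : Type*} (P : Finset ι) (a b : ι → ℂ) (ha : ∀ i ∈ P, ‖a i‖ ≤ 1)
    (hb : ∀ i ∈ P, ‖b i‖ ≤ 1) : ‖∏ i ∈ P, a i - ∏ i ∈ P, b i‖ ≤ ∑ i ∈ P, ‖a i - b i‖ := by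
  induction P using Finset.induction_on with
  | empty => simp
  | insert p P hp ih =>
    rw [Finset.prod_insert hp, Finset.prod_insert hp, Finset.sum_insert hp]
    have h1 := ih (fun i hi => ha i (Finset.mem_insert_of_mem hi))
      (fun i hi => hb i (Finset.mem_insert_of_mem hi))
    have h2 := ha p (Finset.mem_insert_self _ _)
    have h3 : ‖∏ i ∈ P, b i‖ ≤ 1 := by
      rw [norm_prod]
      exact Finset.prod_le_one (fun _ _ => norm_nonneg _)
        fun i hi => hb i (Finset.mem_insert_of_mem hi)
    calc ‖a p * ∏ i ∈ P, a i - b p * ∏ i ∈ P, b i‖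
        = ‖a p * (∏ i ∈ P, a i - ∏ i ∈ P, b i) + (a p - b p) * ∏ i ∈ P, b i‖ := by ring_nf
      _ ≤ ‖a p‖ * ‖∏ i ∈ P, a i - ∏ i ∈ P, b i‖ + ‖a p - b p‖ * ‖∏ i ∈ P, b i‖ := by
          rw [← norm_mul, ← norm_mul]; exact norm_add_le _ _
      _ ≤ 1 * ‖∏ i ∈ P, a i - ∏ i ∈ P, b i‖ + ‖a p - b p‖ * 1 := by gcongr
      _ ≤ _ := by linarith

/-- The probability that a random subset of `P`, containing each `p` independently with
probability `q p`, equals `D`. -/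
noncomputable def bernoulliWeight (P : Finset ℕ) (q : ℕ → ℝ) (D : Finset ℕ) : ℝ :=
  (∏ p ∈ D, q p) * ∏ p ∈ P \ D, (1 - q p)

theorem bernoulliWeight_nonneg {P : Finset ℕ} {q : ℕ → ℝ} (h0 : ∀ p, 0 ≤ q p) (h1 : ∀ p, q p ≤ 1)
    (D : Finset ℕ) : 0 ≤ bernoulliWeight P q D :=
  mul_nonneg (Finset.prod_nonneg fun p _ => h0 p)
    (Finset.prod_nonneg fun p _ => sub_nonneg.2 (h1 p))

theorem sum_bernoulliWeight_mul_prod {R : Type*} [CommRing R] (φ : ℝ →+* R) (P : Finset ℕ)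
    (q : ℕ → ℝ) (a b : ℕ → R) :
    ∑ D ∈ P.powerset, φ (bernoulliWeight P q D) * ∏ p ∈ P, (if p ∈ D then a p else b p) =
      ∏ p ∈ P, (φ (q p) * a p + φ (1 - q p) * b p) := by
  rw [Finset.prod_add]
  refine Finset.sum_congr rfl fun D hD => ?_
  have hD := Finset.mem_powerset.1 hD
  rw [Finset.prod_ite, Finset.filter_mem_eq_inter, Finset.inter_eq_right.2 hD,
    ← Finset.sdiff_eq_filter, Finset.prod_mul_distrib, Finset.prod_mul_distrib, bernoulliWeight,
    map_mul, map_prod, map_prod]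
  ring

theorem sum_bernoulliWeight_superset {P D₀ : Finset ℕ} (q : ℕ → ℝ) (h : D₀ ⊆ P) :
    ∑ D ∈ P.powerset, bernoulliWeight P q D * (if D₀ ⊆ D then 1 else 0) = ∏ p ∈ D₀, q p := by
  have := sum_bernoulliWeight_mul_prod (RingHom.id ℝ) P q (fun _ => 1)
    (fun p => if p ∈ D₀ then 0 else 1)
  simp only [RingHom.id_apply, mul_one] at this
  have h1 : ∀ D : Finset ℕ, (∏ p ∈ P, if p ∈ D then (1 : ℝ) else if p ∈ D₀ then 0 else 1) =
      if D₀ ⊆ D then 1 else 0 := by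
    intro D
    split_ifs with hD
    · refine Finset.prod_eq_one fun p _ => ?_
      split_ifs with h2 h3
      · rfl
      · exact absurd (hD h3) h2
      · rfl
    · obtain ⟨p, hp, hpD⟩ := Finset.not_subset.1 hD
      exact Finset.prod_eq_zero (h hp) (by simp [hp, hpD])
  simp only [h1] at this
  rw [this, ← Finset.prod_subset h]
  · refine Finset.prod_congr rfl fun p hp => ?_
    simp [hp]
  · intro p _ hp
    simp [hp]

/-- The centered sum `∑ p, c p * (1 - q p)` over `p ∈ D` plus `∑ p, c p * (0 - q p)` over `p ∉ D`. -/
noncomputable def centeredSum (P : Finset ℕ) (c q : ℕ → ℝ) (D : Finset ℕ) : ℝ :=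
  (∑ p ∈ P, c p * if p ∈ D then 1 else 0) - ∑ p ∈ P, c p * q p

theorem mul_centeredSum (P : Finset ℕ) (c q : ℕ → ℝ) (D : Finset ℕ) (s : ℝ) :
    s * centeredSum P c q D =
      ∑ p ∈ P, (if p ∈ D then s * c p * (1 - q p) else -(s * c p * q p)) := by
  rw [centeredSum, ← Finset.sum_sub_distrib, Finset.mul_sum]
  refine Finset.sum_congr rfl fun p _ => ?_
  split_ifs <;> ring

theorem sum_bernoulliWeight_mul_exp_le {P : Finset ℕ} {c q : ℕ → ℝ} (h0 : ∀ p, 0 ≤ q p)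
    (h1 : ∀ p, q p ≤ 1) {s : ℝ} (hs : ∀ p ∈ P, |s * c p| ≤ 1) :
    ∑ D ∈ P.powerset, bernoulliWeight P q D * Real.exp (s * centeredSum P c q D) ≤
      Real.exp (s ^ 2 * ∑ p ∈ P, c p ^ 2 * q p) := by
  have h2 : ∀ D, Real.exp (s * centeredSum P c q D) =
      ∏ p ∈ P, (if p ∈ D then Real.exp (s * c p * (1 - q p)) else Real.exp (-(s * c p * q p))) := by
    intro D
    rw [mul_centeredSum, Real.exp_sum]
    refine Finset.prod_congr rfl fun p _ => ?_
    split_ifs <;> rfl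
  have h3 := sum_bernoulliWeight_mul_prod (RingHom.id ℝ) P q
    (fun p => Real.exp (s * c p * (1 - q p))) (fun p => Real.exp (-(s * c p * q p)))
  simp only [RingHom.id_apply] at h3
  simp only [h2]
  rw [h3, Finset.mul_sum, Real.exp_sum]
  refine Finset.prod_le_prod (fun p _ => ?_) fun p hp => ?_
  · have := h0 p
    have := sub_nonneg.2 (h1 p)
    positivity
  · have hq0 := h0 p
    have hq1 := h1 p
    have hp := hs p hp
    rw [← mul_assoc, ← mul_pow]
    set v := s * c p
    have e1 := (abs_le.1 (Real.abs_exp_sub_one_sub_id_le (x := v * (1 - q p)) (by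
      rw [abs_mul]
      exact mul_le_one₀ hp (abs_nonneg _) (by rw [abs_le]; constructor <;> linarith)))).2
    have e2 := (abs_le.1 (Real.abs_exp_sub_one_sub_id_le (x := -(v * q p)) (by
      rw [abs_neg, abs_mul]
      exact mul_le_one₀ hp (abs_nonneg _) (by rw [abs_le]; constructor <;> linarith)))).2
    have e3 := Real.add_one_le_exp (v ^ 2 * q p)
    have e4 := mul_le_mul_of_nonneg_left e1 hq0
    have e5 := mul_le_mul_of_nonneg_left e2 (sub_nonneg.2 hq1)
    have e6 : 0 ≤ v ^ 2 * q p ^ 2 := by positivity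
    nlinarith

theorem sum_bernoulliWeight_mul_pow_le {P : Finset ℕ} {c q : ℕ → ℝ} (h0 : ∀ p, 0 ≤ q p)
    (h1 : ∀ p, q p ≤ 1) {t : ℝ} (ht : ∀ p ∈ P, |2 * t * c p| ≤ 1) {K : ℕ} (hK : Even K) :
    ∑ D ∈ P.powerset, bernoulliWeight P q D * ((t * centeredSum P c q D) ^ K / K.factorial) ≤
      (1 / 2) ^ K * (2 * Real.exp ((2 * t) ^ 2 * ∑ p ∈ P, c p ^ 2 * q p)) := by
  have e1 := sum_bernoulliWeight_mul_exp_le h0 h1 ht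
  have e2 := sum_bernoulliWeight_mul_exp_le (s := -(2 * t)) (c := c) (P := P) h0 h1 (fun p hp => by
    rw [neg_mul, abs_neg]; exact ht p hp)
  rw [neg_sq] at e2
  have e3 : ∀ D ∈ P.powerset,
      bernoulliWeight P q D * ((t * centeredSum P c q D) ^ K / K.factorial) ≤
      (1 / 2) ^ K * (bernoulliWeight P q D * Real.exp (2 * t * centeredSum P c q D) +
        bernoulliWeight P q D * Real.exp (-(2 * t) * centeredSum P c q D)) := by
    intro D _
    set y := centeredSum P c q D
    have hw : 0 ≤ bernoulliWeight P q D := bernoulliWeight_nonneg h0 h1 D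
    have e4 : (t * y) ^ K / K.factorial = (1 / 2) ^ K * (|2 * t * y| ^ K / K.factorial) := by
      rw [hK.pow_abs, mul_assoc, mul_pow 2, ← mul_div_assoc, ← mul_assoc, ← mul_pow]
      norm_num
    have e5 : |2 * t * y| ^ K / K.factorial ≤ Real.exp |2 * t * y| :=
      Real.pow_div_factorial_le_exp _ (abs_nonneg _) K
    have e6 : Real.exp |2 * t * y| ≤ Real.exp (2 * t * y) + Real.exp (-(2 * t) * y) := by
      rw [neg_mul]
      rcases abs_cases (2 * t * y) with h | h <;> rw [h.1] <;>
        linarith [Real.exp_pos (2 * t * y), Real.exp_pos (-(2 * t * y))]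
    rw [e4, ← mul_add, mul_left_comm]
    gcongr
    exact e5.trans e6
  refine (Finset.sum_le_sum e3).trans ?_
  rw [← Finset.mul_sum, Finset.sum_add_distrib]
  gcongr
  linarith

theorem norm_bernoulli_charFun_sub_exp_le {q a : ℝ} (h0 : 0 ≤ q) (h1 : q ≤ 1) (ha : |a| ≤ 1) :
    ‖(q : ℂ) * Complex.exp (((a * (1 - q) : ℝ) : ℂ) * Complex.I) +
      ((1 - q : ℝ) : ℂ) * Complex.exp (((-(a * q) : ℝ) : ℂ) * Complex.I) -
      ((Real.exp (-(a ^ 2 * q * (1 - q) / 2)) : ℝ) : ℂ)‖ ≤ 3 * |a| ^ 3 * q := by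
  have hT : ∀ v : ℝ, ‖Complex.exp (v * Complex.I) - (1 + v * Complex.I - (v : ℂ) ^ 2 / 2)‖ ≤
      |v| ^ 3 := by
    intro v
    have := norm_exp_mul_I_sub_sum_le 3 v
    have h2 : ∑ k ∈ Finset.range 3, ((v : ℂ) * Complex.I) ^ k / (k.factorial : ℂ) =
        1 + v * Complex.I - (v : ℂ) ^ 2 / 2 := by
      simp [Finset.sum_range_succ, mul_pow, Complex.I_sq, Nat.factorial]
      ring
    rw [h2] at this
    refine this.trans (div_le_self (by positivity) ?_)
    norm_num [Nat.factorial]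
  have e1 := hT (a * (1 - q))
  have e2 := hT (-(a * q))
  set A := Complex.exp (((a * (1 - q) : ℝ) : ℂ) * Complex.I)
  set B := Complex.exp (((-(a * q) : ℝ) : ℂ) * Complex.I)
  set u := a ^ 2 * q * (1 - q) / 2 with hu
  have ha2 : a ^ 2 ≤ 1 := by rw [sq_le_one_iff_abs_le_one]; exact ha
  have hq' : 0 ≤ 1 - q := sub_nonneg.2 h1
  have hu0 : 0 ≤ u := by positivity
  have hua : u ≤ a ^ 2 * q := by
    have : a ^ 2 * q * (1 - q) ≤ a ^ 2 * q * 1 := by gcongr; linarith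
    have : 0 ≤ a ^ 2 * q := by positivity
    linarith
  have hu1 : u ≤ 1 := hua.trans (mul_le_one₀ ha2 h0 h1)
  have e3 : |Real.exp (-u) - (1 - u)| ≤ |a| ^ 3 * q := by
    have := Real.abs_exp_sub_one_sub_id_le (x := -u) (by rw [abs_neg, abs_of_nonneg hu0]; exact hu1)
    have h2 : Real.exp (-u) - 1 - -u = Real.exp (-u) - (1 - u) := by ring
    rw [h2, neg_sq] at this
    refine this.trans ?_
    calc u ^ 2 ≤ (a ^ 2 * q) ^ 2 := by gcongr
      _ = |a| ^ 3 * q * (|a| * q) := by rw [← sq_abs a]; ring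
      _ ≤ |a| ^ 3 * q * 1 := by
          gcongr
          exact mul_le_one₀ ha h0 h1
      _ = _ := mul_one _
  have hid : (q : ℂ) * A + ((1 - q : ℝ) : ℂ) * B - ((Real.exp (-u) : ℝ) : ℂ) =
      (q : ℂ) * (A - (1 + ((a * (1 - q) : ℝ) : ℂ) * Complex.I - ((a * (1 - q) : ℝ) : ℂ) ^ 2 / 2)) +
      ((1 - q : ℝ) : ℂ) *
        (B - (1 + ((-(a * q) : ℝ) : ℂ) * Complex.I - ((-(a * q) : ℝ) : ℂ) ^ 2 / 2)) -
      ((Real.exp (-u) - (1 - u) : ℝ) : ℂ) := by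
    rw [hu]
    push_cast
    ring
  rw [hid]
  refine (norm_sub_le _ _).trans ?_
  rw [Complex.norm_real, Real.norm_eq_abs]
  refine (add_le_add_left (norm_add_le _ _) _).trans ?_
  rw [norm_mul, norm_mul, Complex.norm_real, Complex.norm_real, Real.norm_of_nonneg h0,
    Real.norm_of_nonneg hq']
  have e4 : |a * (1 - q)| ^ 3 ≤ |a| ^ 3 := by
    rw [abs_mul, abs_of_nonneg hq']
    gcongr
    exact mul_le_of_le_one_right (abs_nonneg _) (by linarith)
  have e5 : |-(a * q)| ^ 3 ≤ |a| ^ 3 * q := by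
    rw [abs_neg, abs_mul, abs_of_nonneg h0, mul_pow]
    gcongr
    exact pow_le_of_le_one h0 h1 (by norm_num)
  have e6 := mul_le_mul_of_nonneg_left (e1.trans e4) h0
  have e7 : (1 - q) * ‖B - (1 + ((-(a * q) : ℝ) : ℂ) * Complex.I -
      ((-(a * q) : ℝ) : ℂ) ^ 2 / 2)‖ ≤ |a| ^ 3 * q :=
    (mul_le_of_le_one_left (norm_nonneg _) (by linarith)).trans (e2.trans e5)
  linarith

theorem norm_sum_bernoulliWeight_mul_exp_sub_le {P : Finset ℕ} {c q : ℕ → ℝ} (h0 : ∀ p, 0 ≤ q p)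
    (h1 : ∀ p, q p ≤ 1) {t δ : ℝ} (hδ : δ ≤ 1) (ht : ∀ p ∈ P, |t * c p| ≤ δ) :
    ‖∑ D ∈ P.powerset, (bernoulliWeight P q D : ℂ) *
        Complex.exp (((t * centeredSum P c q D : ℝ) : ℂ) * Complex.I) -
      ((Real.exp (-(t ^ 2 / 2 * ∑ p ∈ P, c p ^ 2 * q p * (1 - q p))) : ℝ) : ℂ)‖ ≤
      3 * δ * t ^ 2 * ∑ p ∈ P, c p ^ 2 * q p := by
  have h2 : ∀ D, Complex.exp (((t * centeredSum P c q D : ℝ) : ℂ) * Complex.I) =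
      ∏ p ∈ P, (if p ∈ D then Complex.exp (((t * c p * (1 - q p) : ℝ) : ℂ) * Complex.I)
        else Complex.exp (((-(t * c p * q p) : ℝ) : ℂ) * Complex.I)) := by
    intro D
    rw [mul_centeredSum, Complex.ofReal_sum, Finset.sum_mul, Complex.exp_sum]
    refine Finset.prod_congr rfl fun p _ => ?_
    split_ifs <;> rfl
  have h3 := sum_bernoulliWeight_mul_prod Complex.ofRealHom P q
    (fun p => Complex.exp (((t * c p * (1 - q p) : ℝ) : ℂ) * Complex.I))
    (fun p => Complex.exp (((-(t * c p * q p) : ℝ) : ℂ) * Complex.I))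
  simp only [Complex.ofRealHom_eq_coe] at h3
  simp only [h2]
  have h4 : -(t ^ 2 / 2 * ∑ p ∈ P, c p ^ 2 * q p * (1 - q p)) =
      ∑ p ∈ P, -((t * c p) ^ 2 * q p * (1 - q p) / 2) := by
    rw [Finset.mul_sum, ← Finset.sum_neg_distrib]
    refine Finset.sum_congr rfl fun p _ => ?_
    ring
  rw [h3, h4, Real.exp_sum, Complex.ofReal_prod]
  refine (norm_prod_sub_prod_le _ _ _ (fun p _ => ?_) fun p _ => ?_).trans ?_
  · refine (norm_add_le _ _).trans ?_
    rw [norm_mul, norm_mul, Complex.norm_exp_ofReal_mul_I, Complex.norm_exp_ofReal_mul_I,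
      Complex.norm_real, Complex.norm_real, Real.norm_of_nonneg (h0 p),
      Real.norm_of_nonneg (sub_nonneg.2 (h1 p))]
    linarith
  · rw [Complex.norm_real, Real.norm_of_nonneg (Real.exp_pos _).le, Real.exp_le_one_iff]
    have := h0 p
    have := sub_nonneg.2 (h1 p)
    rw [neg_nonpos]
    positivity
  · rw [Finset.mul_sum]
    refine Finset.sum_le_sum fun p hp => ?_
    have h5 := ht p hp
    refine (norm_bernoulli_charFun_sub_exp_le (h0 p) (h1 p) (h5.trans hδ)).trans ?_
    have hq := h0 p
    calc 3 * |t * c p| ^ 3 * q p = 3 * |t * c p| * (|t * c p| ^ 2 * q p) := by ring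
      _ ≤ 3 * δ * (|t * c p| ^ 2 * q p) := by gcongr
      _ = 3 * δ * t ^ 2 * (c p ^ 2 * q p) := by rw [sq_abs]; ring

theorem sum_log_primeFactors_le {n : ℕ} (hn : n ≠ 0) :
    ∑ p ∈ n.primeFactors, Real.log p ≤ Real.log n := by
  rw [← Real.log_prod fun p hp => by exact_mod_cast (Nat.prime_of_mem_primeFactors hp).ne_zero]
  have h := Nat.le_of_dvd (Nat.pos_of_ne_zero hn) (Nat.prod_primeFactors_dvd n)
  apply Real.log_le_log
  · exact Finset.prod_pos fun p hp => by exact_mod_cast (Nat.prime_of_mem_primeFactors hp).pos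
  · simpa using (Nat.cast_le (α := ℝ)).2 h

theorem card_mul_le_log {n : ℕ} (hn : n ≠ 0) {S : Finset ℕ} (hS : S ⊆ n.primeFactors) {l : ℝ}
    (hl : ∀ p ∈ S, l ≤ Real.log p) : S.card * l ≤ Real.log n := by
  calc (S.card : ℝ) * l = ∑ p ∈ S, l := by simp
    _ ≤ ∑ p ∈ S, Real.log p := Finset.sum_le_sum hl
    _ ≤ ∑ p ∈ n.primeFactors, Real.log p :=
        Finset.sum_le_sum_of_subset_of_nonneg hS fun p _ _ => Real.log_natCast_nonneg p
    _ ≤ Real.log n := sum_log_primeFactors_le hn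

theorem sum_log_div_primesBelow_le (N : ℕ) :
    ∑ p ∈ Nat.primesBelow (N + 1), Real.log p / p ≤ 2 * Real.log N := by
  rcases Nat.eq_zero_or_pos N with rfl | hN
  · simp [Nat.primesBelow, Finset.filter_singleton, Nat.not_prime_zero]
  have hN' : (0 : ℝ) < N := by exact_mod_cast hN
  have h1 : ∑ n ∈ Finset.Ioc 0 N, ∑ p ∈ n.primeFactors, Real.log p ≤ N * Real.log N := by
    calc _ ≤ ∑ n ∈ Finset.Ioc 0 N, Real.log N := by
          refine Finset.sum_le_sum fun n hn => ?_
          rw [Finset.mem_Ioc] at hn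
          refine (sum_log_primeFactors_le hn.1.ne').trans (Real.log_le_log ?_ ?_)
          · exact_mod_cast hn.1
          · exact_mod_cast hn.2
      _ = N * Real.log N := by simp
  have h2 : ∑ n ∈ Finset.Ioc 0 N, ∑ p ∈ n.primeFactors, Real.log p =
      ∑ p ∈ Nat.primesBelow (N + 1), ((N / p : ℕ) : ℝ) * Real.log p := by
    have h3 : ∀ n ∈ Finset.Ioc 0 N, ∑ p ∈ n.primeFactors, Real.log p =
        ∑ p ∈ Nat.primesBelow (N + 1), if p ∣ n then Real.log p else 0 := by
      intro n hn
      rw [Finset.mem_Ioc] at hn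
      rw [← Finset.sum_filter]
      congr 1
      ext p
      simp only [Nat.mem_primeFactors, Finset.mem_filter, Nat.mem_primesBelow]
      constructor
      · rintro ⟨hp, hd, _⟩
        have := Nat.le_of_dvd hn.1 hd
        exact ⟨⟨by omega, hp⟩, hd⟩
      · rintro ⟨⟨_, hp⟩, hd⟩
        exact ⟨hp, hd, hn.1.ne'⟩
    rw [Finset.sum_congr rfl h3, Finset.sum_comm]
    refine Finset.sum_congr rfl fun p _ => ?_
    rw [← Finset.sum_filter, Finset.sum_const, Nat.Ioc_filter_dvd_card_eq_div, nsmul_eq_mul]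
  rw [h2] at h1
  have h4 : N / 2 * ∑ p ∈ Nat.primesBelow (N + 1), Real.log p / p ≤
      ∑ p ∈ Nat.primesBelow (N + 1), ((N / p : ℕ) : ℝ) * Real.log p := by
    rw [Finset.mul_sum]
    refine Finset.sum_le_sum fun p hp => ?_
    rw [Nat.mem_primesBelow] at hp
    have hp0 : (0 : ℝ) < p := by exact_mod_cast hp.2.pos
    have h5 : (N : ℝ) / (2 * p) ≤ ((N / p : ℕ) : ℝ) := by
      rw [div_le_iff₀ (by positivity)]
      have h6 : 1 ≤ N / p := (Nat.one_le_div_iff hp.2.pos).2 (by omega)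
      have h7 : N ≤ p * (N / p + 1) := (Nat.lt_mul_div_succ N hp.2.pos).le
      have h8 : N ≤ N / p * (2 * p) := by nlinarith
      exact_mod_cast h8
    calc N / 2 * (Real.log p / p) = N / (2 * p) * Real.log p := by field_simp
      _ ≤ _ := mul_le_mul_of_nonneg_right h5 (Real.log_natCast_nonneg p)
  have h5 := h4.trans h1
  have h6 : (N : ℝ) / 2 * ∑ p ∈ Nat.primesBelow (N + 1), Real.log p / p ≤
      N / 2 * (2 * Real.log N) := by linarith
  exact le_of_mul_le_mul_left h6 (by positivity)

theorem sum_inv_sq_primesBelow_le (N : ℕ) :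
    ∑ p ∈ Nat.primesBelow (N + 1), ((p : ℝ) ^ 2)⁻¹ ≤ 2 := by
  calc _ ≤ ∑ p ∈ Finset.Ioo 0 (N + 1), ((p : ℝ) ^ 2)⁻¹ := by
        refine Finset.sum_le_sum_of_subset_of_nonneg (fun p hp => ?_) fun p _ _ => by positivity
        rw [Nat.mem_primesBelow] at hp
        exact Finset.mem_Ioo.2 ⟨hp.2.pos, hp.1⟩
    _ ≤ 2 := by simpa using sum_Ioo_inv_sq_le (α := ℝ) 0 (N + 1)

/-- The primes `p ≤ N ^ (1 / r)`. -/
noncomputable def smallPrimes (r : ℝ) (N : ℕ) : Finset ℕ :=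
  (Nat.primesBelow (N + 1)).filter (fun p => Real.log p ≤ Real.log N / r)

theorem prime_of_mem_smallPrimes {r : ℝ} {N p : ℕ} (hp : p ∈ smallPrimes r N) : p.Prime :=
  (Nat.mem_primesBelow.1 (Finset.mem_filter.1 hp).1).2

theorem smallPrimes_subset (r : ℝ) (N : ℕ) : smallPrimes r N ⊆ Nat.primesBelow (N + 1) :=
  Finset.filter_subset _ _

theorem card_smallPrimes_le (r : ℝ) (N : ℕ) :
    ((smallPrimes r N).card : ℝ) ≤ Real.exp (Real.log N / r) := by
  have h : smallPrimes r N ⊆ Finset.Ioc 0 ⌊Real.exp (Real.log N / r)⌋₊ := by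
    intro p hp
    have hp0 := (prime_of_mem_smallPrimes hp).pos
    rw [Finset.mem_Ioc]
    refine ⟨hp0, Nat.le_floor ?_⟩
    rw [← Real.log_le_iff_le_exp (by exact_mod_cast hp0)]
    exact (Finset.mem_filter.1 hp).2
  have h2 := Finset.card_le_card h
  rw [Nat.card_Ioc, Nat.sub_zero] at h2
  exact (Nat.cast_le.2 h2).trans (Nat.floor_le (Real.exp_pos _).le)

theorem log_lt_of_notMem_smallPrimes {r : ℝ} {N p : ℕ} (hp : p ∈ Nat.primesBelow (N + 1))
    (hp' : p ∉ smallPrimes r N) : Real.log N / r < Real.log p := by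
  by_contra h
  exact hp' (Finset.mem_filter.2 ⟨hp, not_lt.1 h⟩)

theorem sum_inv_sdiff_smallPrimes_le {r : ℝ} (hr : 0 < r) {N : ℕ} (hN : 2 ≤ N) :
    ∑ p ∈ Nat.primesBelow (N + 1) \ smallPrimes r N, (p : ℝ)⁻¹ ≤ 2 * r := by
  have hlog : 0 < Real.log N := Real.log_pos (by exact_mod_cast hN)
  have h1 : Real.log N / r * ∑ p ∈ Nat.primesBelow (N + 1) \ smallPrimes r N, (p : ℝ)⁻¹ ≤
      2 * Real.log N := by
    rw [Finset.mul_sum]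
    calc _ ≤ ∑ p ∈ Nat.primesBelow (N + 1) \ smallPrimes r N, Real.log p / p := by
          refine Finset.sum_le_sum fun p hp => ?_
          rw [Finset.mem_sdiff] at hp
          rw [div_eq_mul_inv (Real.log p)]
          exact mul_le_mul_of_nonneg_right (log_lt_of_notMem_smallPrimes hp.1 hp.2).le
            (by positivity)
      _ ≤ ∑ p ∈ Nat.primesBelow (N + 1), Real.log p / p :=
          Finset.sum_le_sum_of_subset_of_nonneg Finset.sdiff_subset fun p _ _ =>
            div_nonneg (Real.log_natCast_nonneg p) (Nat.cast_nonneg p)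
      _ ≤ _ := sum_log_div_primesBelow_le N
  have h2 : Real.log N / r * ∑ p ∈ Nat.primesBelow (N + 1) \ smallPrimes r N, (p : ℝ)⁻¹ ≤
      Real.log N / r * (2 * r) := by
    refine h1.trans (le_of_eq ?_)
    field_simp
  exact le_of_mul_le_mul_left h2 (by positivity)

theorem additive_eq_sum_primeFactors {g : ℕ → ℝ}
    (hadd : ∀ m n : ℕ, Squarefree m → Squarefree n → Nat.Coprime m n → g (m * n) = g m + g n)
    {n : ℕ} (hn : Squarefree n) : g n = ∑ p ∈ n.primeFactors, g p := by
  have h1 : g 1 = 0 := by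
    have := hadd 1 1 squarefree_one squarefree_one (Nat.coprime_one_left 1)
    simpa using this
  have H : ∀ S : Finset ℕ, (∀ p ∈ S, p.Prime) →
      Squarefree (∏ p ∈ S, p) ∧ g (∏ p ∈ S, p) = ∑ p ∈ S, g p := by
    intro S
    induction S using Finset.induction_on with
    | empty => intro _; simp [h1]
    | insert p S hp ih =>
      intro hS
      have hpp := hS p (Finset.mem_insert_self _ _)
      obtain ⟨h2, h3⟩ := ih fun q hq => hS q (Finset.mem_insert_of_mem hq)
      have hcop : Nat.Coprime p (∏ q ∈ S, q) := by
        refine Nat.Coprime.prod_right fun q hq => ?_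
        rw [Nat.coprime_primes hpp (hS q (Finset.mem_insert_of_mem hq))]
        rintro rfl
        exact hp hq
      rw [Finset.prod_insert hp, Finset.sum_insert hp, ← h3]
      exact ⟨(Nat.squarefree_mul hcop).2 ⟨hpp.prime.squarefree, h2⟩,
        hadd _ _ hpp.prime.squarefree h2 hcop⟩
  have := (H n.primeFactors fun p hp => Nat.prime_of_mem_primeFactors hp).2
  rwa [Nat.prod_primeFactors_of_squarefree hn] at this

/-- The squarefree numbers up to `N`. -/
noncomputable def squarefreeUpTo (N : ℕ) : Finset ℕ :=
  (Finset.range (N + 1)).filter (fun n => Squarefree n)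

theorem card_filter_squarefreeUpTo (D : Finset ℕ) (N : ℕ) :
    ((squarefreeUpTo N).filter (fun n => ∀ p ∈ D, p ∣ n)).card = squarefreeCount D N := by
  rw [squarefreeUpTo, Finset.filter_filter, squarefreeCount]

theorem card_squarefreeUpTo (N : ℕ) : (squarefreeUpTo N).card = squarefreeCount ∅ N := by
  rw [← card_filter_squarefreeUpTo]
  simp

theorem squarefreeUpTo_nonempty {N : ℕ} (hN : 1 ≤ N) : (squarefreeUpTo N).Nonempty :=
  ⟨1, Finset.mem_filter.2 ⟨Finset.mem_range.2 (by omega), squarefree_one⟩⟩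

/-- A uniformly random squarefree number up to `N` is divisible by all the elements of `D` with
probability close to `∏ p ∈ D, 1 / (p + 1)`. -/
theorem exists_density_bound :
    ∃ C : ℝ, 0 < C ∧ ∀ᶠ N : ℕ in atTop, ∀ D : Finset ℕ, (∀ p ∈ D, p.Prime) →
      |(squarefreeCount D N : ℝ) / (squarefreeUpTo N).card - ∏ p ∈ D, ((p : ℝ) + 1)⁻¹| ≤
        C * 3 ^ D.card * Real.exp (-(Real.log N / 2)) := by
  obtain ⟨c, hc, E, hE, hb⟩ := exists_squarefreeCount_bound
  refine ⟨4 * E / c, by positivity, ?_⟩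
  have hlarge : ∀ᶠ N : ℕ in atTop, 2 * E / c ≤ √(N : ℝ) :=
    (Real.tendsto_sqrt_atTop.comp tendsto_natCast_atTop_atTop).eventually_ge_atTop _
  filter_upwards [hlarge, eventually_ge_atTop 1] with N hN hN1 D hD
  have hN0 : (0 : ℝ) < N := by exact_mod_cast hN1
  set s := √(N : ℝ) with hs
  have hs0 : 0 < s := Real.sqrt_pos.2 hN0
  have hss : s * s = N := Real.mul_self_sqrt hN0.le
  have hexp : Real.exp (-(Real.log N / 2)) = s⁻¹ := by
    rw [Real.exp_neg, ← Real.log_sqrt hN0.le, Real.exp_log hs0]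
  have h1 := hb ∅ (by simp) N hN0.le
  have h2 := hb D hD N hN0.le
  rw [Nat.floor_natCast] at h1 h2
  rw [Finset.prod_empty, Finset.card_empty, pow_zero, mul_one, mul_one] at h1
  rw [card_squarefreeUpTo, hexp]
  set Q := (squarefreeCount ∅ N : ℝ)
  set h := ∏ p ∈ D, ((p : ℝ) + 1)⁻¹ with hh
  have hprod : h ≤ 1 :=
    Finset.prod_le_one (fun p _ => by positivity)
      fun p _ => inv_le_one_of_one_le₀ (by linarith [Nat.cast_nonneg (α := ℝ) p])
  have hprod0 : 0 ≤ h := Finset.prod_nonneg fun p _ => by positivity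
  have h3 : (1 : ℝ) ≤ 3 ^ D.card := one_le_pow₀ (by norm_num)
  rw [div_le_iff₀ hc] at hN
  have hQ : c / 2 * N ≤ Q := by
    have := (abs_le.1 h1).1
    nlinarith
  have hQ0 : 0 < Q := lt_of_lt_of_le (by positivity) hQ
  have h4 : |(squarefreeCount D N : ℝ) - h * Q| ≤ 2 * (E * 3 ^ D.card * s) := by
    have h5 : (squarefreeCount D N : ℝ) - h * Q =
        ((squarefreeCount D N : ℝ) - c * h * N) - h * (Q - c * N) := by ring
    rw [h5]
    refine (abs_sub _ _).trans ?_
    rw [abs_mul, abs_of_nonneg hprod0]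
    have h6 : h * |Q - c * N| ≤ 1 * (E * s) := by gcongr
    have h7 : E * 1 * s ≤ E * 3 ^ D.card * s := by gcongr
    linarith
  have h5 : (squarefreeCount D N : ℝ) / Q - h = ((squarefreeCount D N : ℝ) - h * Q) / Q := by
    field_simp
  rw [h5, abs_div, abs_of_pos hQ0, div_le_iff₀ hQ0]
  refine h4.trans ?_
  calc 2 * (E * 3 ^ D.card * s) = 4 * E / c * 3 ^ D.card * s⁻¹ * (c / 2 * N) := by
        rw [← hss]
        field_simp
        ring
    _ ≤ _ := by gcongr

theorem abs_moment_sub_le {N : ℕ} {P : Finset ℕ} {c : ℕ → ℝ} {ε : ℝ} {k : ℕ}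
    (hε : ∀ D ⊆ P, D.card ≤ k →
      |(squarefreeCount D N : ℝ) / (squarefreeUpTo N).card - ∏ p ∈ D, ((p : ℝ) + 1)⁻¹| ≤ ε)
    (hc : ∀ p ∈ P, |c p| ≤ 1) :
    |∑ n ∈ squarefreeUpTo N, ((squarefreeUpTo N).card : ℝ)⁻¹ *
        centeredSum P c (fun p => ((p : ℝ) + 1)⁻¹) (P.filter (· ∣ n)) ^ k -
      ∑ D ∈ P.powerset, bernoulliWeight P (fun p => ((p : ℝ) + 1)⁻¹) D *
        centeredSum P c (fun p => ((p : ℝ) + 1)⁻¹) D ^ k| ≤ ε * (2 * P.card) ^ k := by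
  set q : ℕ → ℝ := fun p => ((p : ℝ) + 1)⁻¹ with hq
  let L : (Finset ℕ → ℝ) →ₗ[ℝ] ℝ :=
    { toFun := fun F => ∑ n ∈ squarefreeUpTo N, ((squarefreeUpTo N).card : ℝ)⁻¹ *
        F (P.filter (· ∣ n)) - ∑ D ∈ P.powerset, bernoulliWeight P q D * F D
      map_add' := by
        intro F G
        simp only [Pi.add_apply, mul_add, Finset.sum_add_distrib]
        ring
      map_smul' := by
        intro a F
        simp only [Pi.smul_apply, smul_eq_mul, RingHom.id_apply, mul_sub, Finset.mul_sum]
        congr 1 <;> exact Finset.sum_congr rfl fun _ _ => by ring }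
  have hL : ∀ F, L F = ∑ n ∈ squarefreeUpTo N, ((squarefreeUpTo N).card : ℝ)⁻¹ *
        F (P.filter (· ∣ n)) - ∑ D ∈ P.powerset, bernoulliWeight P q D * F D := fun _ => rfl
  have h1 := abs_apply_indicator_mul_pow_le L P c (∑ p ∈ P, c p * q p) (ε := ε) (K := k)
    (fun D hD hk => by
      refine le_trans (le_of_eq ?_) (hε D hD hk)
      rw [hL, sum_bernoulliWeight_superset q hD]
      congr 2
      rw [← Finset.mul_sum, Finset.sum_boole, ← card_filter_squarefreeUpTo, div_eq_inv_mul]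
      congr 3
      ext n
      simp only [Finset.mem_filter, and_congr_right_iff]
      intro _
      constructor
      · intro h p hp
        exact (Finset.mem_filter.1 (h hp)).2
      · intro h p hp
        exact Finset.mem_filter.2 ⟨hD hp, h p hp⟩) k ∅ (Finset.empty_subset _) (by simp)
  simp only [Finset.empty_subset, if_true, one_mul] at h1
  rw [hL] at h1
  refine h1.trans ?_
  have hε0 : 0 ≤ ε := (abs_nonneg _).trans (hε ∅ (Finset.empty_subset _) (by simp))
  have hq0 : ∀ p, 0 ≤ q p := fun p => by simp only [hq]; positivity
  have hq1 : ∀ p, q p ≤ 1 := fun p =>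
    inv_le_one_of_one_le₀ (by linarith [Nat.cast_nonneg (α := ℝ) p])
  have h2 : ∑ p ∈ P, |c p| ≤ P.card := by
    simpa using Finset.sum_le_sum hc
  have h3 : |∑ p ∈ P, c p * q p| ≤ P.card := by
    refine (Finset.abs_sum_le_sum_abs _ _).trans (le_trans (Finset.sum_le_sum fun p hp => ?_) h2)
    rw [abs_mul, abs_of_nonneg (hq0 p)]
    exact mul_le_of_le_one_right (abs_nonneg _) (hq1 p)
  gcongr
  linarith

theorem tendsto_moment_sub {r : ℕ → ℝ} (hr : Tendsto r atTop atTop) {c : ℕ → ℕ → ℝ}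
    (hc : ∀ᶠ N in atTop, ∀ p ∈ smallPrimes (r N) N, |c N p| ≤ 1) (k : ℕ) :
    Tendsto (fun N : ℕ => |∑ n ∈ squarefreeUpTo N, ((squarefreeUpTo N).card : ℝ)⁻¹ *
        centeredSum (smallPrimes (r N) N) (c N) (fun p => ((p : ℝ) + 1)⁻¹)
          ((smallPrimes (r N) N).filter (· ∣ n)) ^ k -
      ∑ D ∈ (smallPrimes (r N) N).powerset,
        bernoulliWeight (smallPrimes (r N) N) (fun p => ((p : ℝ) + 1)⁻¹) D *
        centeredSum (smallPrimes (r N) N) (c N) (fun p => ((p : ℝ) + 1)⁻¹) D ^ k|)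
      atTop (nhds 0) := by
  obtain ⟨C, hC, hb⟩ := exists_density_bound
  have hlim : Tendsto (fun N : ℕ => C * 3 ^ k * 2 ^ k * Real.exp (-(Real.log N / 4)))
      atTop (nhds 0) := by
    have : Tendsto (fun N : ℕ => Real.log N / 4) atTop atTop :=
      (Real.tendsto_log_atTop.comp tendsto_natCast_atTop_atTop).atTop_div_const (by norm_num)
    simpa using (Real.tendsto_exp_neg_atTop_nhds_zero.comp this).const_mul (C * 3 ^ k * 2 ^ k)
  refine squeeze_zero' (Eventually.of_forall fun _ => abs_nonneg _) ?_ hlim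
  filter_upwards [hb, hc, hr.eventually_ge_atTop (4 * k), hr.eventually_gt_atTop 0]
    with N hN hcN hrN hr0
  have h1 := abs_moment_sub_le (N := N) (P := smallPrimes (r N) N) (c := c N)
    (ε := C * 3 ^ k * Real.exp (-(Real.log N / 2))) (k := k) (fun D hD hk => by
      refine (hN D fun p hp => prime_of_mem_smallPrimes (hD hp)).trans ?_
      gcongr
      norm_num) hcN
  refine h1.trans ?_
  have h2 := card_smallPrimes_le (r N) N
  have hlog : 0 ≤ Real.log N := Real.log_natCast_nonneg N
  calc C * 3 ^ k * Real.exp (-(Real.log N / 2)) * (2 * ((smallPrimes (r N) N).card : ℝ)) ^ k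
      ≤ C * 3 ^ k * Real.exp (-(Real.log N / 2)) * (2 * Real.exp (Real.log N / r N)) ^ k := by
        gcongr
    _ = C * 3 ^ k * 2 ^ k * Real.exp (-(Real.log N / 2) + k * (Real.log N / r N)) := by
        rw [mul_pow, ← Real.exp_nat_mul, Real.exp_add]
        ring
    _ ≤ C * 3 ^ k * 2 ^ k * Real.exp (-(Real.log N / 4)) := by
        gcongr
        have : k * (Real.log N / r N) ≤ Real.log N / 4 := by
          rw [mul_div_assoc', div_le_div_iff₀ hr0 (by norm_num)]
          nlinarith
        linarith

open MeasureTheory ProbabilityTheory in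
/-- Lévy's continuity theorem for uniform distributions on finite multisets, with Gaussian limit. -/
theorem tendsto_card_filter_le_div_card {ι : Type*} {S : ℕ → Finset ι} (hS : ∀ N, (S N).Nonempty)
    {W : ℕ → ι → ℝ}
    (h : ∀ t : ℝ, Tendsto (fun N => ∑ n ∈ S N, ((((S N).card : ℝ)⁻¹ : ℝ) : ℂ) *
      Complex.exp (((t * W N n : ℝ) : ℂ) * Complex.I)) atTop
      (nhds ((Real.exp (-(t ^ 2 / 2)) : ℝ) : ℂ))) (z : ℝ) :
    Tendsto (fun N => (((S N).filter (fun n => W N n ≤ z)).card : ℝ) / (S N).card) atTop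
      (nhds ((1 / √(2 * π)) * ∫ w in Set.Iic z, Real.exp (-(w ^ 2) / 2))) := by
  let m : ℕ → Measure ℝ := fun N =>
    ∑ n ∈ S N, ENNReal.ofReal ((S N).card : ℝ)⁻¹ • Measure.dirac (W N n)
  have hcard : ∀ N, (0 : ℝ) < (S N).card := fun N => by exact_mod_cast (hS N).card_pos
  have hm : ∀ N, IsProbabilityMeasure (m N) := by
    intro N
    constructor
    simp only [m, Measure.coe_finsetSum, Finset.sum_apply, Measure.smul_apply, smul_eq_mul,
      measure_univ, mul_one, Finset.sum_const, nsmul_eq_mul]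
    rw [← ENNReal.ofReal_natCast, ← ENNReal.ofReal_mul (hcard N).le,
      mul_inv_cancel₀ (hcard N).ne', ENNReal.ofReal_one]
  let μ : ℕ → ProbabilityMeasure ℝ := fun N => ⟨m N, hm N⟩
  let ν : ProbabilityMeasure ℝ := ⟨gaussianReal 0 1, inferInstance⟩
  have hlim : Tendsto μ atTop (nhds ν) := by
    refine ProbabilityMeasure.tendsto_of_tendsto_charFun fun t => ?_
    have h1 : ∀ N, charFun (μ N : Measure ℝ) t = ∑ n ∈ S N, ((((S N).card : ℝ)⁻¹ : ℝ) : ℂ) *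
        Complex.exp (((t * W N n : ℝ) : ℂ) * Complex.I) := by
      intro N
      have h_int : ∀ n ∈ S N, Integrable (fun x : ℝ => Complex.exp (t * x * Complex.I))
          (ENNReal.ofReal ((S N).card : ℝ)⁻¹ • Measure.dirac (W N n)) := by
        intro n _
        exact (integrable_dirac (by simp)).smul_measure ENNReal.ofReal_ne_top
      rw [charFun_apply_real]
      simp only [μ, ProbabilityMeasure.coe_mk, m]
      rw [integral_finsetSum_measure h_int]
      refine Finset.sum_congr rfl fun n _ => ?_
      rw [integral_smul_measure, integral_dirac, ENNReal.toReal_ofReal (by positivity),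
        Complex.real_smul]
      push_cast
      rfl
    have h2 : charFun (ν : Measure ℝ) t = ((Real.exp (-(t ^ 2 / 2)) : ℝ) : ℂ) := by
      simp only [ν, ProbabilityMeasure.coe_mk, charFun_gaussianReal]
      push_cast
      congr 1
      simp
    simp only [h1, h2]
    exact h t
  have hfr : (ν : Measure ℝ) (frontier (Set.Iic z)) = 0 := by
    have : NullSingletonClass (gaussianReal 0 1) := nullSingletonClass_gaussianReal one_ne_zero
    simp only [ν, ProbabilityMeasure.coe_mk, frontier_Iic]
    exact measure_singleton z
  have h3 := ProbabilityMeasure.tendsto_measure_of_null_frontier_of_tendsto' hlim hfr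
  have h4 := (ENNReal.tendsto_toReal (measure_ne_top (ν : Measure ℝ) (Set.Iic z))).comp h3
  have h5 : ((ν : Measure ℝ) (Set.Iic z)).toReal =
      (1 / √(2 * π)) * ∫ w in Set.Iic z, Real.exp (-(w ^ 2) / 2) := by
    simp only [ν, ProbabilityMeasure.coe_mk]
    rw [gaussianReal_apply_eq_integral 0 one_ne_zero, ENNReal.toReal_ofReal
      (integral_nonneg fun x => gaussianPDFReal_nonneg _ _ _), ← integral_const_mul]
    simp [gaussianPDFReal]
  rw [h5] at h4
  refine h4.congr fun N => ?_
  simp only [Function.comp, μ, ProbabilityMeasure.coe_mk, m, Measure.coe_finsetSum,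
    Finset.sum_apply, Measure.smul_apply, smul_eq_mul, measurableSet_Iic, Measure.dirac_apply',
    Set.indicator_apply, Set.mem_Iic, Pi.one_apply]
  rw [ENNReal.toReal_sum fun n _ => by
    split_ifs <;> simp]
  simp only [ENNReal.toReal_mul, ENNReal.toReal_ofReal (inv_nonneg.2 (hcard N).le)]
  rw [Finset.card_filter, div_eq_inv_mul, Nat.cast_sum, Finset.mul_sum]
  refine Finset.sum_congr rfl fun n _ => ?_
  split_ifs <;> simp

theorem abs_sum_sq_mul_variance_sub_le {g : ℕ → ℝ} (hbd : ∀ p : ℕ, p.Prime → |g p| ≤ 1) {r : ℝ}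
    (hr : 0 < r) {N : ℕ} (hN : 2 ≤ N) :
    |∑ p ∈ smallPrimes r N, g p ^ 2 * ((p : ℝ) + 1)⁻¹ * (1 - ((p : ℝ) + 1)⁻¹) -
      ∑ p ∈ Nat.primesBelow (N + 1), g p ^ 2 / p| ≤ 2 * r + 4 := by
  rw [← Finset.sum_sdiff (smallPrimes_subset r N), sub_add_eq_sub_sub_swap,
    ← Finset.sum_sub_distrib]
  have hsq : ∀ p : ℕ, p.Prime → |g p ^ 2| ≤ 1 := fun p hp => by
    rw [abs_pow]
    exact pow_le_one₀ (abs_nonneg _) (hbd p hp)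
  have h1 : |∑ p ∈ smallPrimes r N, (g p ^ 2 * ((p : ℝ) + 1)⁻¹ * (1 - ((p : ℝ) + 1)⁻¹) -
      g p ^ 2 / p)| ≤ 4 := by
    calc _ ≤ ∑ p ∈ smallPrimes r N, |g p ^ 2 * ((p : ℝ) + 1)⁻¹ * (1 - ((p : ℝ) + 1)⁻¹) -
          g p ^ 2 / p| := Finset.abs_sum_le_sum_abs _ _
      _ ≤ ∑ p ∈ smallPrimes r N, 2 * ((p : ℝ) ^ 2)⁻¹ := by
          refine Finset.sum_le_sum fun p hp => ?_
          have hp' := prime_of_mem_smallPrimes hp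
          have hp0 : (0 : ℝ) < p := by exact_mod_cast hp'.pos
          have he : g p ^ 2 * ((p : ℝ) + 1)⁻¹ * (1 - ((p : ℝ) + 1)⁻¹) - g p ^ 2 / p =
              -(g p ^ 2 * ((2 * p + 1) / (p * (p + 1) ^ 2))) := by
            field_simp
            ring
          rw [he, abs_neg, abs_mul,
            abs_of_nonneg (a := (2 * (p : ℝ) + 1) / (p * (p + 1) ^ 2)) (by positivity)]
          refine (mul_le_of_le_one_left (by positivity) (hsq p hp')).trans ?_
          rw [← div_eq_mul_inv, div_le_div_iff₀ (by positivity) (by positivity)]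
          nlinarith [sq_nonneg (p : ℝ)]
      _ = 2 * ∑ p ∈ smallPrimes r N, ((p : ℝ) ^ 2)⁻¹ := by rw [Finset.mul_sum]
      _ ≤ 2 * ∑ p ∈ Nat.primesBelow (N + 1), ((p : ℝ) ^ 2)⁻¹ := by
          gcongr
          exact smallPrimes_subset r N
      _ ≤ 4 := by linarith [sum_inv_sq_primesBelow_le N]
  have h2 : |∑ p ∈ Nat.primesBelow (N + 1) \ smallPrimes r N, g p ^ 2 / p| ≤ 2 * r := by
    refine (Finset.abs_sum_le_sum_abs _ _).trans
      (le_trans (Finset.sum_le_sum fun p hp => ?_) (sum_inv_sdiff_smallPrimes_le hr hN))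
    rw [abs_div, Nat.abs_cast, div_eq_mul_inv]
    exact mul_le_of_le_one_left (by positivity)
      (hsq p (Nat.mem_primesBelow.1 (Finset.mem_sdiff.1 hp).1).2)
  refine (abs_sub _ _).trans ?_
  linarith

theorem abs_sub_centeredSum_le {g : ℕ → ℝ}
    (hadd : ∀ m n : ℕ, Squarefree m → Squarefree n → Nat.Coprime m n → g (m * n) = g m + g n)
    (hbd : ∀ p : ℕ, p.Prime → |g p| ≤ 1) {r : ℝ} (hr : 0 < r) {N : ℕ} (hN : 2 ≤ N) {n : ℕ}
    (hn : n ∈ squarefreeUpTo N) :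
    |g n - ∑ p ∈ Nat.primesBelow (N + 1), g p / p - centeredSum (smallPrimes r N) g
      (fun p => ((p : ℝ) + 1)⁻¹) ((smallPrimes r N).filter (· ∣ n))| ≤ 3 * r + 2 := by
  obtain ⟨hnN, hsf⟩ := Finset.mem_filter.1 hn
  have hn0 : n ≠ 0 := hsf.ne_zero
  set P := smallPrimes r N with hP
  have hmain : ∑ p ∈ P, g p * (if p ∈ P.filter (· ∣ n) then (1 : ℝ) else 0) =
      ∑ p ∈ n.primeFactors.filter (· ∈ P), g p := by
    simp only [mul_ite, mul_one, mul_zero]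
    rw [← Finset.sum_filter]
    refine Finset.sum_congr ?_ fun _ _ => rfl
    ext p
    simp only [Finset.mem_filter, Nat.mem_primeFactors]
    constructor
    · rintro ⟨h, -, h'⟩
      exact ⟨⟨prime_of_mem_smallPrimes h, h', hn0⟩, h⟩
    · rintro ⟨⟨-, h', -⟩, h⟩
      exact ⟨h, h, h'⟩
  have hsplit : g n - ∑ p ∈ Nat.primesBelow (N + 1), g p / p - centeredSum P g
      (fun p => ((p : ℝ) + 1)⁻¹) (P.filter (· ∣ n)) =
      ∑ p ∈ n.primeFactors.filter (· ∉ P), g p -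
        ∑ p ∈ Nat.primesBelow (N + 1) \ P, g p / p -
        ∑ p ∈ P, (g p / p - g p * ((p : ℝ) + 1)⁻¹) := by
    rw [centeredSum, hmain, additive_eq_sum_primeFactors hadd hsf,
      ← Finset.sum_filter_add_sum_filter_not n.primeFactors (· ∈ P),
      ← Finset.sum_sdiff (smallPrimes_subset r N), Finset.sum_sub_distrib]
    ring
  have h1 : |∑ p ∈ n.primeFactors.filter (· ∉ P), g p| ≤ r := by
    have hc : |∑ p ∈ n.primeFactors.filter (· ∉ P), g p| ≤
        (n.primeFactors.filter (· ∉ P)).card := by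
      refine (Finset.abs_sum_le_sum_abs _ _).trans ?_
      rw [← nsmul_one]
      exact Finset.sum_le_card_nsmul _ _ _ fun p hp =>
        hbd p (Nat.prime_of_mem_primeFactors (Finset.mem_filter.1 hp).1)
    have hl : ((n.primeFactors.filter (· ∉ P)).card : ℝ) * (Real.log N / r) ≤ Real.log N := by
      refine (card_mul_le_log hn0 (Finset.filter_subset _ _) fun p hp => ?_).trans
        (Real.log_le_log (by exact_mod_cast Nat.pos_of_ne_zero hn0)
          (by exact_mod_cast Nat.lt_succ_iff.1 (Finset.mem_range.1 hnN)))
      obtain ⟨hpn, hpP⟩ := Finset.mem_filter.1 hp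
      refine (log_lt_of_notMem_smallPrimes (Nat.mem_primesBelow.2 ⟨?_,
        Nat.prime_of_mem_primeFactors hpn⟩) hpP).le
      exact (Nat.le_of_mem_primeFactors hpn).trans_lt (Finset.mem_range.1 hnN)
    have hlog : 0 < Real.log N := Real.log_pos (by exact_mod_cast hN)
    rw [mul_div_assoc', div_le_iff₀ hr, mul_comm] at hl
    exact hc.trans (le_of_mul_le_mul_left hl hlog)
  have h2 : |∑ p ∈ Nat.primesBelow (N + 1) \ P, g p / p| ≤ 2 * r := by
    refine (Finset.abs_sum_le_sum_abs _ _).trans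
      (le_trans (Finset.sum_le_sum fun p hp => ?_) (sum_inv_sdiff_smallPrimes_le hr hN))
    rw [abs_div, Nat.abs_cast, div_eq_mul_inv]
    exact mul_le_of_le_one_left (by positivity)
      (hbd p (Nat.mem_primesBelow.1 (Finset.mem_sdiff.1 hp).1).2)
  have h3 : |∑ p ∈ P, (g p / p - g p * ((p : ℝ) + 1)⁻¹)| ≤ 2 := by
    calc _ ≤ ∑ p ∈ P, |g p / p - g p * ((p : ℝ) + 1)⁻¹| := Finset.abs_sum_le_sum_abs _ _
      _ ≤ ∑ p ∈ P, ((p : ℝ) ^ 2)⁻¹ := by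
          refine Finset.sum_le_sum fun p hp => ?_
          have hp' := prime_of_mem_smallPrimes hp
          have hp0 : (0 : ℝ) < p := by exact_mod_cast hp'.pos
          have he : g p / p - g p * ((p : ℝ) + 1)⁻¹ = g p * (p * (p + 1) : ℝ)⁻¹ := by
            field_simp
            ring
          rw [he, abs_mul, abs_of_nonneg (a := (p * (p + 1) : ℝ)⁻¹) (by positivity)]
          refine (mul_le_of_le_one_left (by positivity) (hbd p hp')).trans ?_
          gcongr
          nlinarith
      _ ≤ ∑ p ∈ Nat.primesBelow (N + 1), ((p : ℝ) ^ 2)⁻¹ :=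
          Finset.sum_le_sum_of_subset_of_nonneg (smallPrimes_subset r N)
            fun p _ _ => by positivity
      _ ≤ 2 := sum_inv_sq_primesBelow_le N
  rw [hsplit]
  refine (abs_sub _ _).trans ((add_le_add_left (abs_sub _ _) _).trans ?_)
  linarith

theorem norm_exp_mul_I_sub_exp_mul_I_le (x y : ℝ) :
    ‖Complex.exp ((x : ℂ) * Complex.I) - Complex.exp ((y : ℂ) * Complex.I)‖ ≤ |x - y| := by
  have h : Complex.exp ((x : ℂ) * Complex.I) - Complex.exp ((y : ℂ) * Complex.I) =
      Complex.exp ((y : ℂ) * Complex.I) *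
        (Complex.exp (Complex.I * ((x - y : ℝ) : ℂ)) - 1) := by
    rw [mul_sub, ← Complex.exp_add, mul_one]
    push_cast
    ring_nf
  rw [h, norm_mul, Complex.norm_exp_ofReal_mul_I, one_mul, ← Real.norm_eq_abs]
  exact Real.norm_exp_I_mul_ofReal_sub_one_le

theorem sum_div_sq_mul_inv_le_one {g : ℕ → ℝ} {b : ℝ} {N : ℕ}
    (hb : b = √(∑ p ∈ Nat.primesBelow (N + 1), g p ^ 2 / p)) (hb0 : 0 < b) (r : ℝ) :
    ∑ p ∈ smallPrimes r N, (g p / b) ^ 2 * ((p : ℝ) + 1)⁻¹ ≤ 1 := by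
  have hsq : b ^ 2 = ∑ p ∈ Nat.primesBelow (N + 1), g p ^ 2 / p := by
    rw [hb, Real.sq_sqrt (Finset.sum_nonneg fun p _ => by positivity)]
  calc _ ≤ ∑ p ∈ smallPrimes r N, g p ^ 2 / p / b ^ 2 := by
        refine Finset.sum_le_sum fun p hp => ?_
        have hp0 : (0 : ℝ) < p := by exact_mod_cast (prime_of_mem_smallPrimes hp).pos
        rw [div_pow, div_right_comm, div_eq_mul_inv _ (p : ℝ)]
        gcongr
        linarith
    _ ≤ ∑ p ∈ Nat.primesBelow (N + 1), g p ^ 2 / p / b ^ 2 :=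
        Finset.sum_le_sum_of_subset_of_nonneg (smallPrimes_subset r N) fun p _ _ => by positivity
    _ = 1 := by rw [← Finset.sum_div, ← hsq, div_self (by positivity)]

theorem abs_mul_div_le_div {g : ℕ → ℝ} (hbd : ∀ p : ℕ, p.Prime → |g p| ≤ 1) {b : ℝ} (hb : 0 < b)
    (s : ℝ) {p : ℕ} (hp : p.Prime) : |s * (g p / b)| ≤ |s| / b := by
  rw [abs_mul, abs_div, abs_of_pos hb, mul_div_assoc']
  gcongr
  exact mul_le_of_le_one_right (abs_nonneg _) (hbd p hp)

theorem tendsto_charFun_centeredSum_sub {g b : ℕ → ℝ} (hbd : ∀ p : ℕ, p.Prime → |g p| ≤ 1)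
    (hb : ∀ N, b N = √(∑ p ∈ Nat.primesBelow (N + 1), g p ^ 2 / p))
    (hlim : Tendsto b atTop atTop) {r : ℕ → ℝ} (hr : Tendsto r atTop atTop) (t : ℝ) :
    Tendsto (fun N => ∑ n ∈ squarefreeUpTo N, ((((squarefreeUpTo N).card : ℝ)⁻¹ : ℝ) : ℂ) *
        Complex.exp (((t * centeredSum (smallPrimes (r N) N) (fun p => g p / b N)
          (fun p => ((p : ℝ) + 1)⁻¹) ((smallPrimes (r N) N).filter (· ∣ n)) : ℝ) : ℂ) *
          Complex.I) -
      ∑ D ∈ (smallPrimes (r N) N).powerset,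
        (bernoulliWeight (smallPrimes (r N) N) (fun p => ((p : ℝ) + 1)⁻¹) D : ℂ) *
        Complex.exp (((t * centeredSum (smallPrimes (r N) N) (fun p => g p / b N)
          (fun p => ((p : ℝ) + 1)⁻¹) D : ℝ) : ℂ) * Complex.I)) atTop (nhds 0) := by
  have hq0 : ∀ p : ℕ, 0 ≤ ((p : ℝ) + 1)⁻¹ := fun p => by positivity
  have hq1 : ∀ p : ℕ, ((p : ℝ) + 1)⁻¹ ≤ 1 := fun p =>
    inv_le_one_of_one_le₀ (by linarith [p.cast_nonneg (α := ℝ)])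
  have hc : ∀ᶠ N in atTop, ∀ p ∈ smallPrimes (r N) N, |g p / b N| ≤ 1 := by
    filter_upwards [hlim.eventually_ge_atTop 1] with N hN p hp
    have := abs_mul_div_le_div hbd (by linarith) 1 (prime_of_mem_smallPrimes hp) (b := b N)
    rw [one_mul, abs_one] at this
    exact this.trans (div_le_one_of_le₀ hN (by linarith))
  rw [tendsto_zero_iff_norm_tendsto_zero]
  refine tendsto_order.2 ⟨fun e he => Eventually.of_forall fun _ => he.trans_le (norm_nonneg _),
    fun e he => ?_⟩
  obtain ⟨m, hm⟩ := exists_pow_lt_of_lt_one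
    (show 0 < e / 2 / (4 * Real.exp ((2 * t) ^ 2)) by positivity)
    (show (1 / 2 : ℝ) ^ 2 < 1 by norm_num)
  rw [← pow_mul, lt_div_iff₀ (by positivity)] at hm
  have hK : Even (2 * m) := even_two_mul m
  have hsum := tendsto_finsetSum (Finset.range (2 * m + 1)) fun k _ =>
    (tendsto_moment_sub hr hc k).const_mul (|t| ^ k / k.factorial)
  simp only [mul_zero, Finset.sum_const_zero] at hsum
  filter_upwards [hsum.eventually_lt_const (half_pos he),
    hlim.eventually_ge_atTop (max 1 |2 * t|)] with N hN hbN
  have hb0 : 0 < b N := by linarith [le_max_left 1 |2 * t|]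
  have htail := sum_bernoulliWeight_mul_pow_le (P := smallPrimes (r N) N)
    (c := fun p => g p / b N) hq0 hq1 (t := t) (fun p hp =>
      (abs_mul_div_le_div hbd hb0 _ (prime_of_mem_smallPrimes hp)).trans
        (div_le_one_of_le₀ ((le_max_right _ _).trans hbN) hb0.le)) hK
  have hexp : Real.exp ((2 * t) ^ 2 * ∑ p ∈ smallPrimes (r N) N,
      (g p / b N) ^ 2 * ((p : ℝ) + 1)⁻¹) ≤ Real.exp ((2 * t) ^ 2) :=
    Real.exp_le_exp.2 (mul_le_of_le_one_right (sq_nonneg _)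
      (sum_div_sq_mul_inv_le_one (hb N) hb0 (r N)))
  have hpow : (0 : ℝ) < (1 / 2) ^ (2 * m) := by positivity
  refine (norm_sum_exp_sub_sum_exp_le _ _ _ _ _ _ (fun n _ => by positivity)
    (fun D _ => bernoulliWeight_nonneg hq0 hq1 D) hK t).trans_lt ?_
  have := mul_le_mul_of_nonneg_left hexp hpow.le
  linarith

theorem tendsto_sum_sq_mul_variance {g b : ℕ → ℝ} (hbd : ∀ p : ℕ, p.Prime → |g p| ≤ 1)
    (hb : ∀ N, b N = √(∑ p ∈ Nat.primesBelow (N + 1), g p ^ 2 / p))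
    (hlim : Tendsto b atTop atTop) :
    Tendsto (fun N => ∑ p ∈ smallPrimes (√(b N)) N,
      (g p / b N) ^ 2 * ((p : ℝ) + 1)⁻¹ * (1 - ((p : ℝ) + 1)⁻¹)) atTop (nhds 1) := by
  have h0 : Tendsto (fun N => 6 / b N) atTop (nhds 0) := hlim.const_div_atTop 6
  rw [tendsto_iff_norm_sub_tendsto_zero]
  refine squeeze_zero' (Eventually.of_forall fun _ => norm_nonneg _) ?_ h0
  filter_upwards [hlim.eventually_ge_atTop 1, eventually_ge_atTop 2] with N hN hN2
  have hb0 : 0 < b N := by linarith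
  have hsq : b N ^ 2 = ∑ p ∈ Nat.primesBelow (N + 1), g p ^ 2 / p := by
    rw [hb, Real.sq_sqrt (Finset.sum_nonneg fun p _ => by positivity)]
  have h1 := abs_sum_sq_mul_variance_sub_le hbd (Real.sqrt_pos.2 hb0) hN2
  have h2 : ∑ p ∈ smallPrimes (√(b N)) N,
      (g p / b N) ^ 2 * ((p : ℝ) + 1)⁻¹ * (1 - ((p : ℝ) + 1)⁻¹) - 1 =
      (∑ p ∈ smallPrimes (√(b N)) N, g p ^ 2 * ((p : ℝ) + 1)⁻¹ * (1 - ((p : ℝ) + 1)⁻¹) -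
        b N ^ 2) / b N ^ 2 := by
    rw [sub_div, div_self (by positivity), Finset.sum_div]
    congr 1
    refine Finset.sum_congr rfl fun p _ => ?_
    rw [div_pow]
    ring
  have h3 : √(b N) ≤ b N := Real.sqrt_le_self_iff.2 (Or.inr hN)
  rw [Real.norm_eq_abs, h2, hsq, abs_div, ← hsq, abs_of_pos (pow_pos hb0 2),
    div_le_div_iff₀ (pow_pos hb0 2) hb0]
  rw [← hsq] at h1
  nlinarith

theorem tendsto_charFun_bernoulli {g b : ℕ → ℝ} (hbd : ∀ p : ℕ, p.Prime → |g p| ≤ 1)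
    (hb : ∀ N, b N = √(∑ p ∈ Nat.primesBelow (N + 1), g p ^ 2 / p))
    (hlim : Tendsto b atTop atTop) (t : ℝ) :
    Tendsto (fun N => ∑ D ∈ (smallPrimes (√(b N)) N).powerset,
        (bernoulliWeight (smallPrimes (√(b N)) N) (fun p => ((p : ℝ) + 1)⁻¹) D : ℂ) *
        Complex.exp (((t * centeredSum (smallPrimes (√(b N)) N) (fun p => g p / b N)
          (fun p => ((p : ℝ) + 1)⁻¹) D : ℝ) : ℂ) * Complex.I)) atTop
      (nhds ((Real.exp (-(t ^ 2 / 2)) : ℝ) : ℂ)) := by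
  have hq0 : ∀ p : ℕ, 0 ≤ ((p : ℝ) + 1)⁻¹ := fun p => by positivity
  have hq1 : ∀ p : ℕ, ((p : ℝ) + 1)⁻¹ ≤ 1 := fun p =>
    inv_le_one_of_one_le₀ (by linarith [p.cast_nonneg (α := ℝ)])
  have hV : Tendsto (fun N => ((Real.exp (-(t ^ 2 / 2 * ∑ p ∈ smallPrimes (√(b N)) N,
      (g p / b N) ^ 2 * ((p : ℝ) + 1)⁻¹ * (1 - ((p : ℝ) + 1)⁻¹))) : ℝ) : ℂ)) atTop
      (nhds ((Real.exp (-(t ^ 2 / 2)) : ℝ) : ℂ)) := by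
    have h := (tendsto_sum_sq_mul_variance hbd hb hlim).const_mul (t ^ 2 / 2)
    rw [mul_one] at h
    exact (Complex.continuous_ofReal.tendsto _).comp ((Real.continuous_exp.tendsto _).comp h.neg)
  have h0 : Tendsto (fun N => 3 * (|t| / b N) * t ^ 2) atTop (nhds 0) := by
    simpa using ((hlim.const_div_atTop |t|).const_mul 3).mul_const (t ^ 2)
  refine tendsto_of_tendsto_of_dist hV (squeeze_zero' (Eventually.of_forall fun _ => dist_nonneg)
    ?_ h0)
  filter_upwards [hlim.eventually_ge_atTop (max 1 |t|)] with N hbN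
  have hb0 : 0 < b N := by linarith [le_max_left 1 |t|]
  rw [dist_comm, dist_eq_norm]
  refine (norm_sum_bernoulliWeight_mul_exp_sub_le hq0 hq1 (δ := |t| / b N)
    (div_le_one_of_le₀ ((le_max_right _ _).trans hbN) hb0.le) fun p hp =>
      abs_mul_div_le_div hbd hb0 t (prime_of_mem_smallPrimes hp)).trans ?_
  exact mul_le_of_le_one_right (by positivity) (sum_div_sq_mul_inv_le_one (hb N) hb0 _)

theorem tendsto_charFun_additive {g a b : ℕ → ℝ}
    (hadd : ∀ m n : ℕ, Squarefree m → Squarefree n → Nat.Coprime m n → g (m * n) = g m + g n)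
    (hbd : ∀ p : ℕ, p.Prime → |g p| ≤ 1)
    (ha : ∀ N, a N = ∑ p ∈ Nat.primesBelow (N + 1), g p / p)
    (hb : ∀ N, b N = √(∑ p ∈ Nat.primesBelow (N + 1), g p ^ 2 / p))
    (hlim : Tendsto b atTop atTop) (t : ℝ) :
    Tendsto (fun N => ∑ n ∈ squarefreeUpTo N, ((((squarefreeUpTo N).card : ℝ)⁻¹ : ℝ) : ℂ) *
        Complex.exp (((t * ((g n - a N) / b N) : ℝ) : ℂ) * Complex.I)) atTop
      (nhds ((Real.exp (-(t ^ 2 / 2)) : ℝ) : ℂ)) := by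
  have hr : Tendsto (fun N => √(b N)) atTop atTop := Real.tendsto_sqrt_atTop.comp hlim
  have h1 := (tendsto_charFun_centeredSum_sub hbd hb hlim hr t).add
    (tendsto_charFun_bernoulli hbd hb hlim t)
  simp only [sub_add_cancel, zero_add] at h1
  have h0 : Tendsto (fun N => |t| * (5 / √(b N))) atTop (nhds 0) := by
    simpa using (hr.const_div_atTop 5).const_mul |t|
  refine tendsto_of_tendsto_of_dist h1 (squeeze_zero' (Eventually.of_forall fun _ => dist_nonneg)
    ?_ h0)
  filter_upwards [hlim.eventually_ge_atTop 1, eventually_ge_atTop 2] with N hbN hN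
  have hb0 : 0 < b N := by linarith
  have hs1 : 1 ≤ √(b N) := Real.one_le_sqrt.2 hbN
  have hss : √(b N) * √(b N) = b N := Real.mul_self_sqrt hb0.le
  have hcard : (0 : ℝ) < (squarefreeUpTo N).card := by
    exact_mod_cast (squarefreeUpTo_nonempty (by omega : 1 ≤ N)).card_pos
  rw [dist_eq_norm, ← Finset.sum_sub_distrib]
  calc _ ≤ ∑ n ∈ squarefreeUpTo N, ((squarefreeUpTo N).card : ℝ)⁻¹ * (|t| * (5 / √(b N))) := by
        refine norm_sum_le_of_le _ fun n hn => ?_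
        rw [← mul_sub, norm_mul, Complex.norm_real, Real.norm_of_nonneg (by positivity)]
        gcongr
        refine (norm_exp_mul_I_sub_exp_mul_I_le _ _).trans ?_
        rw [← mul_sub, abs_mul]
        gcongr
        have h2 := abs_sub_centeredSum_le hadd hbd (Real.sqrt_pos.2 hb0) hN hn
        rw [← ha] at h2
        have h3 : centeredSum (smallPrimes (√(b N)) N) (fun p => g p / b N)
            (fun p => ((p : ℝ) + 1)⁻¹) ((smallPrimes (√(b N)) N).filter (· ∣ n)) =
            centeredSum (smallPrimes (√(b N)) N) g
            (fun p => ((p : ℝ) + 1)⁻¹) ((smallPrimes (√(b N)) N).filter (· ∣ n)) / b N := by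
          rw [centeredSum, centeredSum, sub_div, Finset.sum_div, Finset.sum_div]
          congr 1 <;> exact Finset.sum_congr rfl fun p _ => by ring
        rw [h3, ← sub_div, abs_div, abs_of_pos hb0, abs_sub_comm,
          div_le_div_iff₀ hb0 (Real.sqrt_pos.2 hb0)]
        nlinarith
    _ = |t| * (5 / √(b N)) := by
        rw [Finset.sum_const, nsmul_eq_mul, mul_inv_cancel_left₀ hcard.ne']

theorem tendsto_atTop_of_tendsto_div_log_log_log {B : ℝ → ℝ}
    (h : Tendsto (fun x : ℝ => B x / Real.log (Real.log (Real.log x))) atTop atTop) :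
    Tendsto B atTop atTop := by
  have hl : Tendsto (fun x : ℝ => Real.log (Real.log (Real.log x))) atTop atTop :=
    Real.tendsto_log_atTop.comp (Real.tendsto_log_atTop.comp Real.tendsto_log_atTop)
  refine (h.atTop_mul_atTop₀ hl).congr' ?_
  filter_upwards [hl.eventually_gt_atTop 0] with x hx
  exact div_mul_cancel₀ _ hx.ne'

/-- Erdős–Kac theorem for additive functions on squarefree numbers. -/
theorem erdos_kac_squarefree
    (g : ℕ → ℝ)
    (hadd : ∀ m n : ℕ, Squarefree m → Squarefree n → Nat.Coprime m n →
      g (m * n) = g m + g n)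
    (hbd : ∀ p : ℕ, p.Prime → |g p| ≤ 1)
    (A B : ℝ → ℝ)
    (hA : ∀ x : ℝ, A x = ∑ p ∈ Nat.primesBelow (⌊x⌋₊ + 1), g p / p)
    (hB : ∀ x : ℝ, B x = Real.sqrt (∑ p ∈ Nat.primesBelow (⌊x⌋₊ + 1), g p ^ 2 / p))
    (hgrow : Tendsto (fun x : ℝ => B x / Real.log (Real.log (Real.log x))) atTop atTop)
    (z : ℝ) :
    Tendsto (fun x : ℝ =>
      (((Finset.range (⌊x⌋₊ + 1)).filter
          (fun n => Squarefree n ∧ g n - A x ≤ z * B x)).card : ℝ) /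
      (((Finset.range (⌊x⌋₊ + 1)).filter (fun n => Squarefree n)).card : ℝ))
      atTop
      (nhds ((1 / Real.sqrt (2 * Real.pi)) *
        ∫ w in Set.Iic z, Real.exp (-(w ^ 2) / 2))) := by
  have hlim : Tendsto (fun N : ℕ => B N) atTop atTop :=
    (tendsto_atTop_of_tendsto_div_log_log_log hgrow).comp tendsto_natCast_atTop_atTop
  have hA' : ∀ N : ℕ, A N = ∑ p ∈ Nat.primesBelow (N + 1), g p / p := fun N => by
    rw [hA, Nat.floor_natCast]
  have hB' : ∀ N : ℕ, B N = √(∑ p ∈ Nat.primesBelow (N + 1), g p ^ 2 / p) := fun N => by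
    rw [hB, Nat.floor_natCast]
  have hG := tendsto_card_filter_le_div_card
    (fun N => squarefreeUpTo_nonempty (Nat.le_add_left 1 N)) (fun t =>
      (tendsto_charFun_additive hadd hbd hA' hB' hlim t).comp (tendsto_add_atTop_nat 1)) z
  have hG' := (((tendsto_add_atTop_iff_nat (f := fun N : ℕ =>
    (((squarefreeUpTo N).filter (fun n => (g n - A N) / B N ≤ z)).card : ℝ) /
      (squarefreeUpTo N).card) 1).1 hG).comp tendsto_nat_floor_atTop (α := ℝ))
  refine hG'.congr' ?_
  filter_upwards [(tendsto_atTop_of_tendsto_div_log_log_log hgrow).eventually_gt_atTop 0] with x hx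
  have hAx : A (⌊x⌋₊ : ℝ) = A x := by rw [hA', hA]
  have hBx : B (⌊x⌋₊ : ℝ) = B x := by rw [hB', hB]
  simp only [Function.comp, squarefreeUpTo, Finset.filter_filter, hAx, hBx, div_le_iff₀ hx]
end

section
/- Let c be an integer that is not a perfect square. Then there exists a constant C such that for all real x ≥ 3, |∑_{p ≤ x, p odd prime} (1 + (c/p))/p − log log x| ≤ C, where (c/p) denotes the Legendre symbol of c modulo p (which is 0 when p divides c). -/
open DirichletCharacter in
lemma abs_tsum_re_sub_log_norm_LFunction_le {N : ℕ} [NeZero N] (χ : DirichletCharacter ℂ N)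
    {s : ℝ} (hs : 1 < s) :
    |(∑' p : Nat.Primes, (χ p).re * (p : ℝ) ^ (-s)) - Real.log ‖LFunction χ s‖| ≤
      ∑' p : Nat.Primes, (p : ℝ) ^ (-2 : ℝ) := by
  have hs' : 1 < (s : ℂ).re := by simpa
  have hsum := summable_neg_log_one_sub_mul_prime_cpow (χ := χ) hs'
  have hsum2 : Summable fun p : Nat.Primes ↦ (p : ℝ) ^ (-2 : ℝ) :=
    Nat.Primes.summable_rpow.mpr (by norm_num)
  have hexp := congrArg norm (LSeries_eulerProduct_exp_log χ hs')
  rw [Complex.norm_exp, ← LFunction_eq_LSeries χ hs'] at hexp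
  have hcast (p : Nat.Primes) : (p : ℂ) ^ (-(s : ℂ)) = ((p : ℝ) ^ (-s) : ℝ) := by
    rw [Complex.ofReal_cpow (by positivity)]
    simp
  have hterm (p : Nat.Primes) :
      ‖-Complex.log (1 - χ p * p ^ (-(s : ℂ))) - χ p * p ^ (-(s : ℂ))‖ ≤ (p : ℝ) ^ (-2 : ℝ) := by
    have hp2 : (2 : ℝ) ≤ p := mod_cast p.2.two_le
    have hp0 : (0 : ℝ) < p := by positivity
    set z : ℂ := χ p * p ^ (-(s : ℂ))
    have hz : ‖z‖ ≤ (p : ℝ)⁻¹ := by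
      rw [norm_mul, hcast, Complex.norm_real, Real.norm_of_nonneg (by positivity),
        ← Real.rpow_neg_one]
      have h2 : (p : ℝ) ^ (-s) ≤ (p : ℝ) ^ (-1 : ℝ) :=
        Real.rpow_le_rpow_of_exponent_le (by linarith) (by linarith)
      have h1 := χ.norm_le_one p
      have h3 : 0 ≤ (p : ℝ) ^ (-s) := by positivity
      nlinarith
    have hz2 : ‖z‖ ≤ 1 / 2 := hz.trans (by rw [one_div]; gcongr)
    have hb := Complex.norm_log_one_add_sub_self_le (z := -z) (by rw [norm_neg]; linarith)
    rw [norm_neg] at hb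
    have hinv : (1 - ‖z‖)⁻¹ ≤ 2 := by
      rw [inv_le_comm₀ (by linarith) (by norm_num)]; linarith
    have hsq : ‖z‖ ^ 2 ≤ (p : ℝ) ^ (-2 : ℝ) := by
      rw [Real.rpow_neg hp0.le, Real.rpow_two, ← inv_pow]; gcongr
    calc ‖-Complex.log (1 - z) - z‖ = ‖Complex.log (1 + -z) - -z‖ := by
          rw [← norm_neg]; congr 1; ring_nf
      _ ≤ _ := hb
      _ ≤ ‖z‖ ^ 2 * 2 / 2 := by gcongr
      _ ≤ _ := by linarith
  have hre (p : Nat.Primes) : (χ p).re * (p : ℝ) ^ (-s) = (χ p * p ^ (-(s : ℂ))).re := by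
    rw [hcast, Complex.re_mul_ofReal]
  have hdiff : Summable fun p : Nat.Primes ↦
      (-Complex.log (1 - χ p * p ^ (-(s : ℂ))) - χ p * p ^ (-(s : ℂ))) :=
    .of_norm_bounded hsum2 hterm
  have hsum3 : Summable fun p : Nat.Primes ↦ χ p * (p : ℂ) ^ (-(s : ℂ)) := by
    simpa using hsum.sub hdiff
  simp_rw [hre]
  rw [← hexp, Real.log_exp, ← Complex.re_tsum hsum3, abs_sub_comm, ← Complex.sub_re,
    ← hsum.tsum_sub hsum3]
  exact (Complex.abs_re_le_norm _).trans (tsum_of_norm_bounded hsum2.hasSum hterm)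

lemma exists_abs_log_norm_le_of_continuous {f : ℂ → ℂ} (hf : Continuous f)
    (h0 : ∀ s : ℝ, 1 ≤ s → f s ≠ 0) :
    ∃ B : ℝ, ∀ s ∈ Set.Icc (1 : ℝ) 2, |Real.log ‖f s‖| ≤ B :=
  isCompact_Icc.exists_bound_of_continuousOn (f := fun s : ℝ ↦ Real.log ‖f s‖) <|
    ContinuousOn.log (by fun_prop) fun s hs ↦ norm_ne_zero_iff.mpr (h0 s hs.1)

open DirichletCharacter in
lemma exists_abs_tsum_primes_re_character_le {N : ℕ} [NeZero N] {χ : DirichletCharacter ℂ N}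
    (hχ : χ ≠ 1) :
    ∃ B : ℝ, ∀ s ∈ Set.Ioc (1 : ℝ) 2,
      |∑' p : Nat.Primes, (χ p).re * (p : ℝ) ^ (-s)| ≤ B := by
  obtain ⟨B, hB⟩ := exists_abs_log_norm_le_of_continuous
    (differentiable_LFunction hχ).continuous
    fun s hs ↦ LFunction_ne_zero_of_one_le_re χ (.inl hχ) (by simpa)
  refine ⟨(∑' p : Nat.Primes, (p : ℝ) ^ (-2 : ℝ)) + B, fun s hs ↦ ?_⟩
  have h1 := abs_tsum_re_sub_log_norm_LFunction_le χ hs.1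
  have h2 := hB s ⟨hs.1.le, hs.2⟩
  rw [abs_le] at *
  constructor <;> linarith

open DirichletCharacter in
lemma exists_abs_tsum_primes_add_log_le :
    ∃ B : ℝ, ∀ s ∈ Set.Ioc (1 : ℝ) 2,
      |(∑' p : Nat.Primes, (p : ℝ) ^ (-s)) + Real.log (s - 1)| ≤ B := by
  have hne (s : ℝ) (hs : 1 ≤ s) : LFunctionTrivChar₁ 1 (s : ℂ) ≠ 0 := by
    rcases eq_or_ne s 1 with rfl | h
    · exact_mod_cast LFunctionTrivChar₁_apply_one_ne_zero 1
    · have h' : (s : ℂ) ≠ 1 := mod_cast h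
      rw [LFunctionTrivChar₁, Function.update_of_ne h']
      exact mul_ne_zero (sub_ne_zero.mpr h')
        (LFunction_ne_zero_of_one_le_re _ (.inr h') (by simpa))
  obtain ⟨B, hB⟩ := exists_abs_log_norm_le_of_continuous
    (differentiable_LFunctionTrivChar₁ 1).continuous hne
  refine ⟨(∑' p : Nat.Primes, (p : ℝ) ^ (-2 : ℝ)) + B, fun s hs ↦ ?_⟩
  have h1 := abs_tsum_re_sub_log_norm_LFunction_le (1 : DirichletCharacter ℂ 1) hs.1
  have h2 := hB s ⟨hs.1.le, hs.2⟩
  have h' : (s : ℂ) ≠ 1 := mod_cast hs.1.ne'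
  have h3 : LFunction (1 : DirichletCharacter ℂ 1) s ≠ 0 :=
    LFunction_ne_zero_of_one_le_re _ (.inr h') (by simpa using hs.1.le)
  have h4 : ‖(s : ℂ) - 1‖ = s - 1 := by
    rw [← Complex.ofReal_one, ← Complex.ofReal_sub, Complex.norm_real,
      Real.norm_of_nonneg (by linarith [hs.1])]
  rw [LFunctionTrivChar₁, Function.update_of_ne h', LFunctionTrivChar, norm_mul, h4,
    Real.log_mul (by linarith [hs.1]) (norm_ne_zero_iff.mpr h3)] at h2
  simp only [MulChar.one_apply (isUnit_of_subsingleton _), Complex.one_re, one_mul] at h1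
  rw [abs_le] at *
  constructor <;> linarith

lemma exists_tsum_primes_log_mul_rpow_le :
    ∃ C : ℝ, ∀ s ∈ Set.Ioc (1 : ℝ) 2,
      Summable (fun p : Nat.Primes ↦ Real.log p * (p : ℝ) ^ (-s)) ∧
        ∑' p : Nat.Primes, Real.log p * (p : ℝ) ^ (-s) ≤ C / (s - 1) := by
  obtain ⟨B, hB⟩ := exists_abs_tsum_primes_add_log_le
  refine ⟨2 * (Real.log 2 + 2 * B), fun s ⟨hs1, hs2⟩ ↦ ?_⟩
  set h := (s - 1) / 2 with hh
  have hpos : 0 < h := by linarith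
  have hterm (p : Nat.Primes) :
      Real.log p * (p : ℝ) ^ (-s) ≤ ((p : ℝ) ^ (-(1 + h)) - (p : ℝ) ^ (-s)) / h := by
    have hp0 : (0 : ℝ) < p := mod_cast p.2.pos
    have hexp : 1 + h * Real.log p ≤ (p : ℝ) ^ h := by
      rw [Real.rpow_def_of_pos hp0]
      linarith [Real.add_one_le_exp (Real.log p * h)]
    have hsplit : (p : ℝ) ^ (-(1 + h)) = (p : ℝ) ^ (-s) * (p : ℝ) ^ h := by
      rw [← Real.rpow_add hp0]; congr 1; linarith
    rw [le_div_iff₀ hpos, hsplit]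
    have : 0 < (p : ℝ) ^ (-s) := by positivity
    nlinarith
  have hsum1 : Summable fun p : Nat.Primes ↦ (p : ℝ) ^ (-s) :=
    Nat.Primes.summable_rpow.mpr (by linarith)
  have hsum2 : Summable fun p : Nat.Primes ↦ (p : ℝ) ^ (-(1 + h)) :=
    Nat.Primes.summable_rpow.mpr (by linarith)
  have hsum3 := (hsum2.sub hsum1).div_const h
  have hsum : Summable fun p : Nat.Primes ↦ Real.log p * (p : ℝ) ^ (-s) :=
    hsum3.of_nonneg_of_le (fun p ↦ by positivity) hterm
  refine ⟨hsum, (hsum.tsum_le_tsum hterm hsum3).trans ?_⟩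
  rw [tsum_div_const, hsum2.tsum_sub hsum1, div_le_div_iff₀ hpos (by linarith)]
  have h1 := hB s ⟨hs1, hs2⟩
  have h2 := hB (1 + h) ⟨by linarith, by linarith⟩
  rw [show 1 + h - 1 = h by ring, show h = (s - 1) / 2 from rfl,
    Real.log_div (by linarith) (by norm_num)] at h2
  rw [abs_le] at h1 h2
  have key : (∑' p : Nat.Primes, (p : ℝ) ^ (-(1 + h))) - ∑' p : Nat.Primes, (p : ℝ) ^ (-s) ≤
      Real.log 2 + 2 * B := by linarith
  rw [show s - 1 = 2 * h by linarith]
  linarith [mul_le_mul_of_nonneg_right key hpos.le]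

lemma exists_abs_sum_primesBelow_sub_tsum_le :
    ∃ C : ℝ, ∀ a : ℕ → ℝ, (∀ n, |a n| ≤ 1) → ∀ x : ℝ, 3 ≤ x →
      |(∑ p ∈ Nat.primesBelow (⌊x⌋₊ + 1), a p / p) -
        ∑' p : Nat.Primes, a p * (p : ℝ) ^ (-(1 + (Real.log x)⁻¹))| ≤ C := by
  obtain ⟨C, hC⟩ := exists_tsum_primes_log_mul_rpow_le
  refine ⟨Real.exp 1 * C, fun a ha x hx ↦ ?_⟩
  have hL : 1 < Real.log x := by
    rw [Real.lt_log_iff_exp_lt (by linarith)]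
    linarith [Real.exp_one_lt_d9]
  set L := Real.log x with hLdef
  have hLinv : L⁻¹ ≤ 1 := inv_le_one_of_one_le₀ hL.le
  have hLinv0 : 0 < L⁻¹ := by positivity
  set s := 1 + L⁻¹ with hs
  obtain ⟨hsum, hle⟩ := hC s ⟨by linarith, by linarith⟩
  set b : ℕ → ℝ := fun p ↦ if (p : ℝ) ≤ x then a p / p else 0 with hb
  have hterm (p : Nat.Primes) : ‖b p - a p * (p : ℝ) ^ (-s)‖ ≤
      Real.exp 1 / L * (Real.log p * (p : ℝ) ^ (-s)) := by
    have hp1 : (1 : ℝ) < p := mod_cast p.2.one_lt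
    have hp0 : (0 : ℝ) < p := by linarith
    have hlogp := Real.log_pos hp1
    have hq : 0 < (p : ℝ) ^ (-s) := by positivity
    have hrw : Real.exp 1 / L * (Real.log p * (p : ℝ) ^ (-s)) =
        Real.exp 1 * (Real.log p / L) * (p : ℝ) ^ (-s) := by ring
    have ha' := ha p
    rw [hrw, Real.norm_eq_abs]
    by_cases hpx : (p : ℝ) ≤ x
    · have hlog : Real.log p ≤ L := Real.log_le_log hp0 hpx
      set u := Real.log p / L with hu
      have hu0 : 0 ≤ u := by positivity
      have hu1 : u ≤ 1 := (div_le_one (by linarith)).mpr hlog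
      have hinv : (p : ℝ)⁻¹ = (p : ℝ) ^ (-s) * Real.exp u := by
        have : Real.exp u = (p : ℝ) ^ L⁻¹ := by
          rw [Real.rpow_def_of_pos hp0, hu, div_eq_mul_inv]
        rw [this, ← Real.rpow_add hp0, ← Real.rpow_neg_one]
        congr 1; rw [hs]; ring
      have hexp : Real.exp u - 1 ≤ Real.exp 1 * u := by
        have h1 : 1 - u ≤ Real.exp (-u) := by linarith [Real.add_one_le_exp (-u)]
        have h2 : Real.exp u * Real.exp (-u) = 1 := by rw [← Real.exp_add]; simp
        have h3 : Real.exp u ≤ Real.exp 1 := Real.exp_le_exp.mpr hu1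
        nlinarith [Real.exp_pos u]
      have hexp0 : 0 ≤ Real.exp u - 1 := by linarith [Real.add_one_le_exp u]
      have : b p - a p * (p : ℝ) ^ (-s) = a p * ((Real.exp u - 1) * (p : ℝ) ^ (-s)) := by
        simp only [hb, if_pos hpx, div_eq_mul_inv]
        rw [hinv]; ring
      rw [this, abs_mul, abs_of_nonneg (a := _ * _) (by positivity)]
      calc _ ≤ 1 * ((Real.exp u - 1) * (p : ℝ) ^ (-s)) := by gcongr
        _ ≤ _ := by rw [one_mul]; gcongr
    · have hlog : L ≤ Real.log p := Real.log_le_log (by linarith) (by linarith)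
      have h1 : 1 ≤ Real.log p / L := (one_le_div (by linarith)).mpr hlog
      have h2 : 1 ≤ Real.exp 1 := by linarith [Real.add_one_le_exp 1]
      simp only [hb, if_neg hpx, zero_sub, abs_neg, abs_mul, abs_of_pos hq]
      gcongr
      exact ha'.trans (one_le_mul_of_one_le_of_one_le h2 h1)
  have hsum1 : Summable fun p : Nat.Primes ↦ a p * (p : ℝ) ^ (-s) := by
    refine .of_norm_bounded (Nat.Primes.summable_rpow.mpr (show -s < -1 by linarith)) fun p ↦ ?_
    rw [norm_mul, Real.norm_of_nonneg (r := _ ^ _) (by positivity)]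
    exact mul_le_of_le_one_left (by positivity) (ha p)
  have hsum2 := hsum.mul_left (Real.exp 1 / L)
  have hdiff : Summable fun p : Nat.Primes ↦ b p - a p * (p : ℝ) ^ (-s) :=
    .of_norm_bounded hsum2 hterm
  have hsumb : Summable fun p : Nat.Primes ↦ b p := by simpa using hdiff.add hsum1
  have hfin : ∑ p ∈ Nat.primesBelow (⌊x⌋₊ + 1), a p / p = ∑' p : Nat.Primes, b p := by
    have hmem (p : ℕ) : p ∈ Nat.primesBelow (⌊x⌋₊ + 1) ↔ (p : ℝ) ≤ x ∧ p.Prime := by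
      rw [Nat.mem_primesBelow, Nat.lt_succ_iff, Nat.le_floor_iff (by linarith)]
    have h := tsum_subtype {p : ℕ | p.Prime} b
    refine Eq.trans ?_ h.symm
    rw [tsum_eq_sum (s := Nat.primesBelow (⌊x⌋₊ + 1))]
    · refine Finset.sum_congr rfl fun p hp ↦ ?_
      rw [hmem] at hp
      simp [hb, hp.1, hp.2]
    · intro p hp
      rw [hmem, and_comm, not_and] at hp
      by_cases hp' : p.Prime <;> simp_all
  rw [hfin, ← hsumb.tsum_sub hsum1]
  calc |∑' p : Nat.Primes, (b p - a p * (p : ℝ) ^ (-s))|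
      ≤ ∑' p : Nat.Primes, Real.exp 1 / L * (Real.log p * (p : ℝ) ^ (-s)) :=
        tsum_of_norm_bounded hsum2.hasSum hterm
    _ = Real.exp 1 / L * ∑' p : Nat.Primes, Real.log p * (p : ℝ) ^ (-s) := tsum_mul_left
    _ ≤ Real.exp 1 / L * (C / (s - 1)) := by gcongr
    _ = Real.exp 1 * C := by rw [hs]; field_simp; ring

section

open scoped NumberTheorySymbols

lemma Nat.odd_of_isUnit_natCast_zmod_four_mul {m n : ℕ} (h : IsUnit (n : ZMod (4 * m))) :
    Odd n := by
  rw [ZMod.isUnit_iff_coprime] at h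
  exact (Nat.Coprime.coprime_dvd_right (Dvd.intro _ (by ring : 2 * (2 * m) = 4 * m)) h).odd_of_right

open Classical in
/-- The quadratic character `n ↦ J(c | n)` on odd `n`, as a Dirichlet character
modulo `4 * |c|`. -/
noncomputable def jacobiCharacter (c : ℤ) [NeZero (4 * c.natAbs)] :
    DirichletCharacter ℂ (4 * c.natAbs) where
  toFun u := if IsUnit u then (J(c | u.val) : ℂ) else 0
  map_one' := by
    have h := jacobiSym.mod_right c odd_one
    simp only [isUnit_one, if_true, ZMod.val_one_eq_one_mod]
    rw [← h, jacobiSym.one_right, Int.cast_one]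
  map_mul' u v := by
    by_cases hu : IsUnit u
    · by_cases hv : IsUnit v
      · have hu' := Nat.odd_of_isUnit_natCast_zmod_four_mul (n := u.val)
          (by rwa [ZMod.natCast_zmod_val])
        have hv' := Nat.odd_of_isUnit_natCast_zmod_four_mul (n := v.val)
          (by rwa [ZMod.natCast_zmod_val])
        rw [if_pos hu, if_pos hv, if_pos (hu.mul hv), ZMod.val_mul,
          ← jacobiSym.mod_right c (hu'.mul hv'), jacobiSym.mul_right' c hu'.pos.ne' hv'.pos.ne',
          Int.cast_mul]
      · simp [hv]
    · simp [hu]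
  map_nonunit' _ hu := if_neg hu

lemma jacobiCharacter_natCast_of_odd (c : ℤ) [NeZero (4 * c.natAbs)] {n : ℕ} (hn : Odd n) :
    jacobiCharacter c n = J(c | n) := by
  classical
  change (if IsUnit (n : ZMod (4 * c.natAbs)) then (J(c | (n : ZMod (4 * c.natAbs)).val) : ℂ)
    else 0) = _
  split_ifs with h
  · rw [ZMod.val_natCast, ← jacobiSym.mod_right c hn]
  · rw [eq_comm, Int.cast_eq_zero, jacobiSym.eq_zero_iff]
    refine ⟨hn.pos.ne', fun hg ↦ h ?_⟩
    rw [ZMod.isUnit_iff_coprime]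
    refine Nat.Coprime.mul_right ?_ (Nat.Coprime.symm (by simpa [Int.gcd] using hg))
    exact Nat.Coprime.pow_right 2 (Nat.coprime_two_right.mpr hn)

lemma jacobiCharacter_two (c : ℤ) [NeZero (4 * c.natAbs)] : jacobiCharacter c (2 : ℕ) = 0 := by
  refine MulChar.map_nonunit _ fun h ↦ ?_
  exact absurd (Nat.odd_of_isUnit_natCast_zmod_four_mul h) (by decide)

lemma jacobiSym_pow_mul_eq_neg_one {q e : ℕ} [Fact q.Prime] (hq : q ≠ 2) (he : Odd e) {d : ℤ}
    (hd : ¬ (q : ℤ) ∣ d) : ∃ n : ℕ, Odd n ∧ J((q : ℤ) ^ e * d | n) = -1 := by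
  have hqp : q.Prime := Fact.out
  have hqodd := hqp.odd_of_ne_two hq
  obtain ⟨r, hr⟩ := FiniteField.exists_nonsquare (F := ZMod q) (by rwa [ZMod.ringChar_zmod_n])
  have hcop : Nat.Coprime q (4 * d.natAbs) := by
    refine Nat.Coprime.mul_right ?_ (hqp.coprime_iff_not_dvd.mpr (by rwa [← Int.natCast_dvd]))
    exact Nat.Coprime.pow_right 2 (Nat.coprime_two_right.mpr hqodd)
  obtain ⟨n, hn1, hn2⟩ := Nat.chineseRemainder hcop r.val 1
  have hn4 : n % 4 = 1 := (hn2.of_mul_right _)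
  have hnodd : Odd n := Nat.odd_iff.mpr (by omega)
  have hJd : J(d | n) = 1 := by
    rw [jacobiSym.mod_right d hnodd, hn2, ← jacobiSym.mod_right d odd_one, jacobiSym.one_right]
  have hJq : J(q | n) = -1 := by
    rw [jacobiSym.quadratic_reciprocity_one_mod_four' hqodd hn4,
      ZMod.nonsquare_iff_jacobiSym_eq_neg_one]
    have : ((n : ℤ) : ZMod q) = r := by
      rw [Int.cast_natCast, (ZMod.natCast_eq_natCast_iff _ _ _).mpr hn1, ZMod.natCast_zmod_val]
    rwa [this]
  exact ⟨n, hnodd, by rw [jacobiSym.mul_left, jacobiSym.pow_left, hJq, hJd, he.neg_one_pow, mul_one]⟩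

lemma exists_jacobiSym_eq_neg_one_of_neg {c : ℤ} (hc : c < 0) :
    ∃ n : ℕ, Odd n ∧ J(c | n) = -1 := by
  obtain ⟨m, rfl⟩ : ∃ m : ℕ, c = -((m + 1 : ℕ) : ℤ) := ⟨c.natAbs - 1, by omega⟩
  have hodd : Odd (4 * m + 3) := Nat.odd_iff.mpr (by omega)
  refine ⟨4 * m + 3, hodd, ?_⟩
  have h4 : J(4 * ((m + 1 : ℕ) : ℤ) | 4 * m + 3) = 1 := by
    rw [← jacobiSym.one_left (4 * m + 3)]
    apply jacobiSym.mod_left'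
    have : 4 * ((m + 1 : ℕ) : ℤ) = 1 + ((4 * m + 3 : ℕ) : ℤ) := by push_cast; ring
    rw [this, Int.add_emod_right]
  rw [jacobiSym.mul_left, jacobiSym.at_four hodd, one_mul] at h4
  rw [jacobiSym.neg _ hodd, h4, ZMod.χ₄_nat_three_mod_four (by omega), mul_one]

lemma exists_jacobiSym_two_mul_sq_eq_neg_one {b : ℕ} (hb : b ≠ 0) :
    ∃ n : ℕ, Odd n ∧ J(2 * (b : ℤ) ^ 2 | n) = -1 := by
  obtain ⟨p, hpb, hp, hp3⟩ := Nat.forall_exists_prime_gt_and_eq_mod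
    (q := 8) (a := 3) (by decide) (max b 2)
  have hodd : Odd p := hp.odd_of_ne_two (by omega)
  have hcop : (b : ℤ).gcd p = 1 := by
    rw [Int.gcd_natCast_natCast, Nat.gcd_comm]
    exact hp.coprime_iff_not_dvd.mpr fun h ↦ by
      have := Nat.le_of_dvd (Nat.pos_of_ne_zero hb) h
      omega
  refine ⟨p, hodd, ?_⟩
  rw [jacobiSym.mul_left, jacobiSym.sq_one' hcop, jacobiSym.at_two hodd, hp3]
  decide

lemma exists_jacobiSym_eq_neg_one_of_not_isSquare {c : ℤ} (hc : ¬ IsSquare c) :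
    ∃ n : ℕ, Odd n ∧ J(c | n) = -1 := by
  rcases lt_or_ge c 0 with hneg | hnonneg
  · exact exists_jacobiSym_eq_neg_one_of_neg hneg
  lift c to ℕ using hnonneg
  obtain ⟨a, b, rfl, ha⟩ := Nat.sq_mul_squarefree c
  have hb : b ≠ 0 := by rintro rfl; simp at hc
  by_cases hq : ∃ q : ℕ, q.Prime ∧ q ∣ a ∧ q ≠ 2
  · obtain ⟨q, hqp, ⟨t, rfl⟩, hq2⟩ := hq
    have : Fact q.Prime := ⟨hqp⟩
    obtain ⟨f, b', hb', rfl⟩ := Nat.exists_eq_pow_mul_and_not_dvd hb q hqp.ne_one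
    have ht : ¬ q ∣ t := fun h ↦ hqp.not_isUnit (ha q (mul_dvd_mul_left q h))
    have hd : ¬ (q : ℤ) ∣ ((t * b' ^ 2 : ℕ) : ℤ) := by
      rw [Int.natCast_dvd_natCast, hqp.dvd_mul]
      exact not_or_intro ht fun h ↦ hb' (hqp.dvd_of_dvd_pow h)
    have heq : (((q ^ f * b') ^ 2 * (q * t) : ℕ) : ℤ) =
        (q : ℤ) ^ (2 * f + 1) * ((t * b' ^ 2 : ℕ) : ℤ) := by push_cast; ring
    rw [heq]
    exact jacobiSym_pow_mul_eq_neg_one hq2 (odd_two_mul_add_one f) hd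
  · push Not at hq
    have h2 := Nat.eq_prime_pow_of_unique_prime_dvd ha.ne_zero fun {d} hd hda ↦ hq d hd hda
    have hlen : a.primeFactorsList.length = 1 := by
      by_contra hne
      rcases Nat.eq_zero_or_pos a.primeFactorsList.length with h | h
      · rw [h, pow_zero] at h2
        rw [h2] at hc
        exact hc ⟨b, by push_cast; ring⟩
      · have h4 : 2 * 2 ∣ a := by rw [h2]; exact pow_dvd_pow 2 (m := 2) (by omega)
        exact absurd (ha 2 h4) (by decide)
    rw [hlen, pow_one] at h2
    obtain ⟨n, hn, h⟩ := exists_jacobiSym_two_mul_sq_eq_neg_one hb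
    refine ⟨n, hn, ?_⟩
    rw [← h, h2]
    push_cast
    rw [mul_comm]

lemma jacobiCharacter_ne_one {c : ℤ} [NeZero (4 * c.natAbs)] (hc : ¬ IsSquare c) :
    jacobiCharacter c ≠ 1 := by
  obtain ⟨n, hn, hJ⟩ := exists_jacobiSym_eq_neg_one_of_not_isSquare hc
  intro h
  have h1 := jacobiCharacter_natCast_of_odd c hn
  rw [hJ, h] at h1
  by_cases hu : IsUnit (n : ZMod (4 * c.natAbs))
  · rw [MulChar.one_apply hu] at h1
    norm_num at h1
  · rw [MulChar.map_nonunit _ hu] at h1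
    norm_num at h1

end

/-- Mertens-type estimate for primes where a non-square is a QR. -/
theorem mertens_legendre_nonsquare (c : ℤ) (hc : ¬ IsSquare c) :
    ∃ C : ℝ, ∀ x : ℝ, 3 ≤ x →
      |(∑ p ∈ (Nat.primesBelow (⌊x⌋₊ + 1)).filter (fun p => p ≠ 2),
          (1 + (jacobiSym c p : ℝ)) / p) - Real.log (Real.log x)| ≤ C := by
  have hc0 : c ≠ 0 := by rintro rfl; exact hc IsSquare.zero
  have : NeZero (4 * c.natAbs) := ⟨by omega⟩
  set χ := jacobiCharacter c with hχ
  obtain ⟨B₁, hB₁⟩ := exists_abs_tsum_primes_add_log_le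
  obtain ⟨B₂, hB₂⟩ := exists_abs_tsum_primes_re_character_le (jacobiCharacter_ne_one hc)
  obtain ⟨C, hC⟩ := exists_abs_sum_primesBelow_sub_tsum_le
  refine ⟨2 * C + B₁ + B₂ + 1 / 2, fun x hx ↦ ?_⟩
  have hL : 1 < Real.log x := by
    rw [Real.lt_log_iff_exp_lt (by linarith)]
    linarith [Real.exp_one_lt_d9]
  have hs : 1 + (Real.log x)⁻¹ ∈ Set.Ioc (1 : ℝ) 2 := by
    have h0 : 0 < (Real.log x)⁻¹ := by positivity
    have h1 : (Real.log x)⁻¹ ≤ 1 := inv_le_one_of_one_le₀ hL.le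
    exact ⟨by linarith, by linarith⟩
  have hone := hC (fun _ ↦ 1) (by simp) x hx
  have hchi := hC (fun n ↦ (χ n).re)
    (fun n ↦ (Complex.abs_re_le_norm _).trans (χ.norm_le_one n)) x hx
  have h1 := hB₁ _ hs
  have h2 := hB₂ _ hs
  rw [add_sub_cancel_left, Real.log_inv] at h1
  simp only [one_mul] at hone
  have hmem : 2 ∈ Nat.primesBelow (⌊x⌋₊ + 1) := by
    rw [Nat.mem_primesBelow, Nat.lt_succ_iff, Nat.le_floor_iff (by linarith)]
    exact ⟨by push_cast; linarith, Nat.prime_two⟩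
  have hsum : ∑ p ∈ (Nat.primesBelow (⌊x⌋₊ + 1)).filter (fun p => p ≠ 2),
      (1 + (jacobiSym c p : ℝ)) / p =
      (∑ p ∈ Nat.primesBelow (⌊x⌋₊ + 1), (1 : ℝ) / p) +
        (∑ p ∈ Nat.primesBelow (⌊x⌋₊ + 1), (χ p).re / p) - 1 / 2 := by
    rw [← Finset.sum_add_distrib, Finset.filter_ne', ← Finset.sum_erase_add _ _ hmem, hχ,
      jacobiCharacter_two, Complex.zero_re, zero_div, add_zero, Nat.cast_ofNat, add_sub_cancel_right]
    refine Finset.sum_congr rfl fun p hp ↦ ?_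
    rw [Finset.mem_erase, Nat.mem_primesBelow] at hp
    rw [jacobiCharacter_natCast_of_odd c (hp.2.2.odd_of_ne_two hp.1), Complex.intCast_re, add_div]
  rw [hsum]
  rw [abs_le] at *
  constructor <;> linarith
end

section
/- There exists a constant C such that for every real X ≥ 1 and every squarefree natural number d, |#{n ≤ X : n squarefree and d ∣ n} − (6/π²)·X/σ(d)| ≤ C·d·√X, where σ(d) is the sum of the positive divisors of d. -/
open Finset ArithmeticFunction

/-- The number of squarefree `n ≤ N` divisible by `d`. -/
def squarefreeMultipleCount (N d : ℕ) : ℕ :=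
  ((range (N + 1)).filter (fun n => Squarefree n ∧ d ∣ n)).card

theorem squarefreeMultipleCount_prime_mul (N : ℕ) {p d : ℕ} (hp : p.Prime) (hpd : ¬ p ∣ d) :
    squarefreeMultipleCount N (p * d) + squarefreeMultipleCount (N / p) (p * d) =
      squarefreeMultipleCount (N / p) d := by
  have hcop : Nat.Coprime p d := (Nat.Prime.coprime_iff_not_dvd hp).2 hpd
  unfold squarefreeMultipleCount
  rw [← card_filter_add_card_filter_not
    (s := (range (N / p + 1)).filter fun n => Squarefree n ∧ d ∣ n) (fun n => p ∣ n), add_comm]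
  congr 1
  · congr 1
    ext n
    simp only [mem_filter, mem_range, and_assoc]
    refine and_congr_right fun _ => and_congr_right fun _ => ⟨fun h => ?_, fun h => ?_⟩
    · exact ⟨(Dvd.intro_left p rfl).trans h, (Dvd.intro d rfl).trans h⟩
    · exact hcop.mul_dvd_of_dvd_of_dvd h.2 h.1
  · symm
    refine card_bij (fun n _ => p * n) ?_ ?_ ?_
    · intro n hn
      simp only [mem_filter, mem_range] at hn ⊢
      obtain ⟨⟨hlt, hsq, hdn⟩, hpn⟩ := hn
      refine ⟨?_, ?_, Nat.mul_dvd_mul_left p hdn⟩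
      · have := (Nat.le_div_iff_mul_le hp.pos).1 (Nat.lt_succ_iff.1 hlt)
        rw [mul_comm]
        omega
      · exact Nat.squarefree_mul_iff.2
          ⟨(Nat.Prime.coprime_iff_not_dvd hp).2 hpn, hp.prime.squarefree, hsq⟩
    · intro a _ b _ h
      exact Nat.eq_of_mul_eq_mul_left hp.pos h
    · intro n hn
      simp only [mem_filter, mem_range] at hn
      obtain ⟨hlt, hsq, hdn⟩ := hn
      obtain ⟨m, rfl⟩ := (Dvd.intro d rfl).trans hdn
      obtain ⟨hpm, -, hm⟩ := Nat.squarefree_mul_iff.1 hsq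
      refine ⟨m, ?_, rfl⟩
      simp only [mem_filter, mem_range]
      refine ⟨⟨?_, hm, Nat.dvd_of_mul_dvd_mul_left hp.pos hdn⟩,
        (Nat.Prime.coprime_iff_not_dvd hp).1 hpm⟩
      rw [Nat.lt_succ_iff, Nat.le_div_iff_mul_le hp.pos, mul_comm]
      omega

theorem sq_dvd_sq_mul_iff_of_squarefree {a b k : ℕ} (ha : Squarefree a) (hb : b ≠ 0) :
    k ^ 2 ∣ b ^ 2 * a ↔ k ∣ b := by
  refine ⟨fun h => ?_, fun h => (pow_dvd_pow_of_dvd h 2).trans (Dvd.intro a rfl)⟩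
  have hk : k ≠ 0 := by
    rintro rfl
    have := ha.ne_zero
    simp_all
  rw [← Nat.factorization_le_iff_dvd hk hb]
  rw [← Nat.factorization_le_iff_dvd (by positivity) (mul_ne_zero (by positivity) ha.ne_zero),
    Nat.factorization_mul (by positivity) ha.ne_zero] at h
  intro q
  have h1 := h q
  have h2 := ha.natFactorization_le_one q
  simp only [Nat.factorization_pow, Finsupp.add_apply, Finsupp.smul_apply, smul_eq_mul] at h1
  omega

theorem sum_moebius_filter_sq_dvd {n K : ℕ} (hn : 0 < n) (hK : n < (K + 1) ^ 2) :
    ∑ k ∈ (Ioc 0 K).filter (fun k => k ^ 2 ∣ n), moebius k = if Squarefree n then 1 else 0 := by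
  obtain ⟨a, b, ha, hb, rfl, hsq⟩ := Nat.sq_mul_squarefree_of_pos hn
  have hset : (Ioc 0 K).filter (fun k => k ^ 2 ∣ b ^ 2 * a) = b.divisors := by
    ext k
    simp only [mem_filter, mem_Ioc, Nat.mem_divisors,
      sq_dvd_sq_mul_iff_of_squarefree hsq hb.ne']
    refine ⟨fun h => ⟨h.2, hb.ne'⟩, fun h => ⟨⟨Nat.pos_of_dvd_of_pos h.1 hb, ?_⟩, h.1⟩⟩
    have h1 := Nat.le_of_dvd hb h.1
    have h2 : b ^ 2 < (K + 1) ^ 2 := by nlinarith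
    have := lt_of_pow_lt_pow_left₀ 2 (by positivity) h2
    omega
  rw [hset, ← coe_mul_zeta_apply, moebius_mul_coe_zeta, one_apply]
  congr 1
  refine propext ⟨?_, fun h => ?_⟩
  · rintro rfl
    simpa using hsq
  · exact Nat.isUnit_iff.1 (h b ⟨a, by ring⟩)

theorem squarefreeMultipleCount_one_eq_sum {N K : ℕ} (hK : N < (K + 1) ^ 2) :
    (squarefreeMultipleCount N 1 : ℤ) = ∑ k ∈ Ioc 0 K, moebius k * ((N / k ^ 2 : ℕ) : ℤ) := by
  have h1 : (squarefreeMultipleCount N 1 : ℤ) =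
      ∑ n ∈ Ioc 0 N, if Squarefree n then (1 : ℤ) else 0 := by
    rw [sum_boole, squarefreeMultipleCount]
    congr 2
    ext n
    simp only [mem_filter, mem_range, mem_Ioc, one_dvd, and_true]
    refine and_congr_left fun h => ?_
    have := h.ne_zero
    omega
  rw [h1]
  calc _ = ∑ n ∈ Ioc 0 N, ∑ k ∈ Ioc 0 K, if k ^ 2 ∣ n then moebius k else 0 := by
        refine sum_congr rfl fun n hn => ?_
        rw [mem_Ioc] at hn
        rw [← sum_moebius_filter_sq_dvd hn.1 (hn.2.trans_lt hK), sum_filter]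
    _ = ∑ k ∈ Ioc 0 K, ∑ n ∈ Ioc 0 N, if k ^ 2 ∣ n then moebius k else 0 := sum_comm
    _ = _ := by
        refine sum_congr rfl fun k _ => ?_
        rw [← sum_filter, sum_const, Nat.Ioc_filter_dvd_card_eq_div, nsmul_eq_mul, mul_comm]

theorem hasSum_moebius_div_sq :
    HasSum (fun n : ℕ => (moebius n : ℝ) / (n : ℝ) ^ 2) (6 / Real.pi ^ 2) := by
  have hs : 1 < (2 : ℂ).re := by norm_num
  have h1 := LSeries_one_mul_Lseries_moebius hs
  rw [LSeries_one_eq_riemannZeta hs, riemannZeta_two] at h1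
  have h2 := (LSeriesSummable_moebius_iff.2 hs).LSeriesHasSum
  have h3 : LSeries (fun n => ((moebius n : ℤ) : ℂ)) 2 = ((6 / Real.pi ^ 2 : ℝ) : ℂ) := by
    have hpi : (Real.pi : ℂ) ≠ 0 := by exact_mod_cast Real.pi_ne_zero
    push_cast
    field_simp at h1 ⊢
    linear_combination h1
  rw [h3] at h2
  rw [← Complex.hasSum_ofReal]
  rw [LSeriesHasSum] at h2
  convert h2 using 1
  funext n
  rcases eq_or_ne n 0 with rfl | hn
  · simp
  · rw [LSeries.term_of_ne_zero hn]
    norm_num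

theorem abs_moebius_div_sq_le (n : ℕ) :
    |(moebius n : ℝ) / (n : ℝ) ^ 2| ≤ ((n : ℝ) ^ 2)⁻¹ := by
  have h : |(moebius n : ℝ)| ≤ 1 := by exact_mod_cast abs_moebius_le_one (n := n)
  rw [abs_div, abs_of_nonneg (sq_nonneg (n : ℝ)), div_eq_mul_inv]
  exact mul_le_of_le_one_left (by positivity) h

theorem abs_sum_moebius_div_sq_sub_le (K : ℕ) :
    |∑ k ∈ Ioc 0 K, (moebius k : ℝ) / (k : ℝ) ^ 2 - 6 / Real.pi ^ 2| ≤ 2 / ((K : ℝ) + 1) := by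
  have hlim := (hasSum_moebius_div_sq.tendsto_sum_nat.const_sub
    (∑ k ∈ Ioc 0 K, (moebius k : ℝ) / (k : ℝ) ^ 2)).abs
  refine le_of_tendsto hlim ?_
  filter_upwards [Filter.eventually_ge_atTop (K + 1)] with n hn
  have hsplit : ∑ k ∈ range n, (moebius k : ℝ) / (k : ℝ) ^ 2 =
      ∑ k ∈ Ioc 0 K, (moebius k : ℝ) / (k : ℝ) ^ 2 +
        ∑ k ∈ Ioo K n, (moebius k : ℝ) / (k : ℝ) ^ 2 := by
    rw [← sum_union]
    · symm
      refine sum_subset ?_ ?_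
      · intro k hk
        simp only [mem_union, mem_Ioc, mem_Ioo, mem_range] at hk ⊢
        omega
      · intro k hk hk'
        simp only [mem_union, mem_Ioc, mem_Ioo, mem_range] at hk hk'
        obtain rfl : k = 0 := by omega
        simp
    · rw [disjoint_left]
      intro k hk hk'
      simp only [mem_Ioc, mem_Ioo] at hk hk'
      omega
  rw [hsplit, sub_add_cancel_left, abs_neg]
  exact (abs_sum_le_sum_abs _ _).trans
    ((sum_le_sum fun k _ => abs_moebius_div_sq_le k).trans (sum_Ioo_inv_sq_le (α := ℝ) K n))

theorem abs_squarefreeMultipleCount_one_sub_le {X : ℝ} (hX : 0 ≤ X) :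
    |(squarefreeMultipleCount ⌊X⌋₊ 1 : ℝ) - 6 / Real.pi ^ 2 * X| ≤ 3 * √X := by
  set K := ⌊√X⌋₊ with hKdef
  have hK1 : (K : ℝ) ≤ √X := Nat.floor_le (Real.sqrt_nonneg X)
  have hK2 : √X < K + 1 := Nat.lt_floor_add_one _
  have hsq : √X ^ 2 = X := Real.sq_sqrt hX
  have hN : ⌊X⌋₊ < (K + 1) ^ 2 := by
    rw [Nat.floor_lt hX]
    push_cast
    have := Real.sqrt_nonneg X
    nlinarith
  have hcount : (squarefreeMultipleCount ⌊X⌋₊ 1 : ℝ) =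
      ∑ k ∈ Ioc 0 K, (moebius k : ℝ) * ((⌊X⌋₊ / k ^ 2 : ℕ) : ℝ) := by
    have h := congrArg (Int.cast : ℤ → ℝ) (squarefreeMultipleCount_one_eq_sum hN)
    push_cast at h
    exact h
  have hround : |∑ k ∈ Ioc 0 K, (moebius k : ℝ) * ((⌊X⌋₊ / k ^ 2 : ℕ) : ℝ) -
      (∑ k ∈ Ioc 0 K, (moebius k : ℝ) / (k : ℝ) ^ 2) * X| ≤ K := by
    rw [sum_mul, ← sum_sub_distrib]
    refine (abs_sum_le_sum_abs _ _).trans ((sum_le_card_nsmul _ _ 1 fun k hk => ?_).trans ?_)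
    · have h : |(moebius k : ℝ)| ≤ 1 := by exact_mod_cast abs_moebius_le_one (n := k)
      have hfl : ((⌊X⌋₊ / k ^ 2 : ℕ) : ℝ) = (⌊X / ((k ^ 2 : ℕ) : ℝ)⌋₊ : ℝ) := by
        rw [Nat.floor_div_natCast]
      have hkX : 0 ≤ X / ((k ^ 2 : ℕ) : ℝ) := by positivity
      have h1 := Nat.floor_le hkX
      have h2 := Nat.lt_floor_add_one (X / ((k ^ 2 : ℕ) : ℝ))
      have heq : (moebius k : ℝ) * ((⌊X⌋₊ / k ^ 2 : ℕ) : ℝ) - (moebius k : ℝ) / (k : ℝ) ^ 2 * X =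
          moebius k * ((⌊X / ((k ^ 2 : ℕ) : ℝ)⌋₊ : ℝ) - X / ((k ^ 2 : ℕ) : ℝ)) := by
        rw [hfl]
        push_cast
        ring
      rw [heq, abs_mul]
      refine mul_le_one₀ h (abs_nonneg _) ?_
      rw [abs_le]
      constructor <;> linarith
    · simp
  have htail : |(∑ k ∈ Ioc 0 K, (moebius k : ℝ) / (k : ℝ) ^ 2) * X - 6 / Real.pi ^ 2 * X| ≤
      2 * √X := by
    rw [← sub_mul, abs_mul, abs_of_nonneg hX]
    calc _ ≤ 2 / ((K : ℝ) + 1) * X :=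
          mul_le_mul_of_nonneg_right (abs_sum_moebius_div_sq_sub_le K) hX
      _ ≤ 2 * √X := by
          rw [div_mul_eq_mul_div, div_le_iff₀ (by positivity)]
          have := Real.sqrt_nonneg X
          nlinarith
  rw [hcount]
  have := abs_sub_le (∑ k ∈ Ioc 0 K, (moebius k : ℝ) * ((⌊X⌋₊ / k ^ 2 : ℕ) : ℝ))
    ((∑ k ∈ Ioc 0 K, (moebius k : ℝ) / (k : ℝ) ^ 2) * X) (6 / Real.pi ^ 2 * X)
  linarith

theorem sum_divisors_prime_mul {p d : ℕ} (hp : p.Prime) (hpd : ¬ p ∣ d) :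
    (∑ e ∈ (p * d).divisors, (e : ℝ)) = (p + 1) * ∑ e ∈ d.divisors, (e : ℝ) := by
  have h := Nat.Coprime.sum_divisors_mul ((Nat.Prime.coprime_iff_not_dvd hp).2 hpd)
  rw [hp.sum_divisors] at h
  have h' := congrArg (Nat.cast : ℕ → ℝ) h
  push_cast at h'
  exact h'

theorem one_le_sum_divisors {d : ℕ} (hd : d ≠ 0) : (1 : ℝ) ≤ ∑ e ∈ d.divisors, (e : ℝ) := by
  have h := single_le_sum (f := fun e : ℕ => (e : ℝ)) (fun e _ => Nat.cast_nonneg e)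
    (Nat.one_mem_divisors.2 hd)
  simpa using h

theorem abs_squarefreeMultipleCount_prime_mul_sub_le {p d : ℕ} (hp : p.Prime) (hpd : ¬ p ∣ d)
    (hd : d ≠ 0) {B B' : ℝ} (hB' : 1 ≤ B') (hBB' : B + B' ≤ B' * √p)
    (hB : ∀ X : ℝ, 0 ≤ X → |(squarefreeMultipleCount ⌊X⌋₊ d : ℝ) -
      6 / Real.pi ^ 2 * X / ∑ e ∈ d.divisors, (e : ℝ)| ≤ B * √X) {X : ℝ} (hX : 0 ≤ X) :
    |(squarefreeMultipleCount ⌊X⌋₊ (p * d) : ℝ) -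
      6 / Real.pi ^ 2 * X / ∑ e ∈ (p * d).divisors, (e : ℝ)| ≤ B' * √X := by
  have hp0 : (0 : ℝ) < p := by exact_mod_cast hp.pos
  have hp2 : (2 : ℝ) ≤ p := by exact_mod_cast hp.two_le
  have hpd0 : p * d ≠ 0 := mul_ne_zero hp.ne_zero hd
  have hσ := one_le_sum_divisors hd
  have key : ∀ (n : ℕ) (X : ℝ), 0 ≤ X → X < 2 ^ n →
      |(squarefreeMultipleCount ⌊X⌋₊ (p * d) : ℝ) -
        6 / Real.pi ^ 2 * X / ∑ e ∈ (p * d).divisors, (e : ℝ)| ≤ B' * √X := by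
    intro n
    induction n with
    | zero =>
      intro X hX hX1
      rw [pow_zero] at hX1
      have hfl : ⌊X⌋₊ = 0 := Nat.floor_eq_zero.2 hX1
      have hcount : squarefreeMultipleCount 0 (p * d) = 0 := by
        simp [squarefreeMultipleCount, filter_singleton]
      have hσ' := one_le_sum_divisors hpd0
      have hc : 6 / Real.pi ^ 2 ≤ 1 := by
        rw [div_le_one (by positivity)]
        nlinarith [Real.pi_gt_three]
      have hXs : X ≤ √X := Real.le_sqrt_of_sq_le (by nlinarith)
      rw [hfl, hcount, Nat.cast_zero, zero_sub, abs_neg, abs_of_nonneg (by positivity)]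
      calc _ ≤ 6 / Real.pi ^ 2 * X := div_le_self (by positivity) hσ'
        _ ≤ 1 * X := by gcongr
        _ ≤ B' * √X := by gcongr
    | succ n ih =>
      intro X hX hXn
      have hXp : X / p < 2 ^ n := by
        rw [div_lt_iff₀ hp0]
        rw [pow_succ] at hXn
        have : (0 : ℝ) < 2 ^ n := by positivity
        nlinarith
      have hXp0 : 0 ≤ X / p := by positivity
      have h1 := ih (X / p) hXp0 hXp
      have h2 := hB (X / p) hXp0
      have hrec : (squarefreeMultipleCount ⌊X⌋₊ (p * d) : ℝ) =
          squarefreeMultipleCount ⌊X / p⌋₊ d - squarefreeMultipleCount ⌊X / p⌋₊ (p * d) := by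
        rw [Nat.floor_div_natCast, ← squarefreeMultipleCount_prime_mul ⌊X⌋₊ hp hpd]
        push_cast
        ring
      have hmain : 6 / Real.pi ^ 2 * X / ∑ e ∈ (p * d).divisors, (e : ℝ) =
          6 / Real.pi ^ 2 * (X / p) / ∑ e ∈ d.divisors, (e : ℝ) -
            6 / Real.pi ^ 2 * (X / p) / ∑ e ∈ (p * d).divisors, (e : ℝ) := by
        rw [sum_divisors_prime_mul hp hpd]
        have : (∑ e ∈ d.divisors, (e : ℝ)) ≠ 0 := by positivity
        have := Real.pi_ne_zero
        field_simp
        ring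
      rw [hrec, hmain, sub_sub_sub_comm]
      refine (abs_sub _ _).trans ((add_le_add h2 h1).trans ?_)
      rw [← add_mul, Real.sqrt_div hX, mul_div_assoc', div_le_iff₀ (Real.sqrt_pos.2 hp0)]
      have := mul_le_mul_of_nonneg_right hBB' (Real.sqrt_nonneg X)
      linarith
  obtain ⟨n, hn⟩ := pow_unbounded_of_one_lt X (one_lt_two : (1 : ℝ) < 2)
  exact key n X hX hn

theorem abs_squarefreeMultipleCount_sub_le {d : ℕ} (hd : Squarefree d) :
    ∀ X : ℝ, 0 ≤ X → |(squarefreeMultipleCount ⌊X⌋₊ d : ℝ) -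
      6 / Real.pi ^ 2 * X / ∑ e ∈ d.divisors, (e : ℝ)| ≤
        (3 * d * if 2 ∣ d then 2 else 1) * √X := by
  induction d using induction_on_primes with
  | zero => exact absurd hd not_squarefree_zero
  | one =>
    intro X hX
    simpa using abs_squarefreeMultipleCount_one_sub_le hX
  | prime_mul p a hp ih =>
    obtain ⟨hcop, -, ha⟩ := Nat.squarefree_mul_iff.1 hd
    have hpa : ¬ p ∣ a := (Nat.Prime.coprime_iff_not_dvd hp).1 hcop
    have ha1 : (1 : ℝ) ≤ a := by exact_mod_cast Nat.one_le_iff_ne_zero.2 ha.ne_zero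
    have hp2 : (2 : ℝ) ≤ p := by exact_mod_cast hp.two_le
    intro X hX
    refine abs_squarefreeMultipleCount_prime_mul_sub_le hp hpa ha.ne_zero ?_ ?_ (ih ha) hX
    · push_cast
      split_ifs <;> nlinarith
    · push_cast
      rcases hp.eq_two_or_odd' with rfl | hodd
      · rw [if_neg hpa, if_pos (Dvd.intro a rfl)]
        have h : (1.4 : ℝ) ≤ √(2 : ℕ) := Real.le_sqrt_of_sq_le (by norm_num)
        push_cast at h ⊢
        nlinarith
      · have hiff : 2 ∣ p * a ↔ 2 ∣ a := by
          rw [Nat.prime_two.dvd_mul]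
          exact or_iff_right (fun h => (Nat.not_even_iff_odd.2 hodd) (even_iff_two_dvd.2 h))
        have hp3 : (3 : ℝ) ≤ p := by
          have := hp.two_le
          obtain ⟨m, hm⟩ := hodd
          exact_mod_cast (by omega : 3 ≤ p)
        have h : (1.5 : ℝ) ≤ √p := Real.le_sqrt_of_sq_le (by linarith)
        simp only [hiff]
        set w : ℝ := 3 * a * if 2 ∣ a then 2 else 1 with hw
        have hw0 : 0 ≤ w := by positivity
        have hps : 1 + (p : ℝ) ≤ p * √p := by nlinarith
        have := mul_le_mul_of_nonneg_left hps hw0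
        rw [hw] at this
        linarith

/-- asymptotic count of squarefree numbers up to X divisible by squarefree d. -/
theorem squarefree_divisible_count_asymptotic :
    ∃ C : ℝ, ∀ X : ℝ, 1 ≤ X → ∀ d : ℕ, Squarefree d →
      |(((Finset.range (⌊X⌋₊ + 1)).filter (fun n => Squarefree n ∧ d ∣ n)).card : ℝ) -
        (6 / Real.pi ^ 2) * X / (∑ e ∈ d.divisors, (e : ℝ))|
        ≤ C * d * Real.sqrt X := by
  refine ⟨6, fun X hX d hd => (abs_squarefreeMultipleCount_sub_le hd X (by linarith)).trans ?_⟩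
  refine mul_le_mul_of_nonneg_right ?_ (Real.sqrt_nonneg X)
  have : (0 : ℝ) ≤ d := Nat.cast_nonneg d
  split_ifs <;> linarith
end

section
/- Let Δ and Δ′ be integers, neither of which is a perfect square. For each prime p define w(p) = ((Δ′/p) − (Δ/p))/2 if p is odd and p ∤ Δ, and w(p) = 0 otherwise, where (·/p) is the Legendre symbol. Then there exists a constant C such that for all x ≥ 2, |∑_{p ≤ x} w(p)/p| ≤ C, the sum being over primes p ≤ x. -/
open Finset

/-- Abel summation bound: if the partial sums of `a` are bounded by `K` and `g` is nonnegative and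
antitone beyond `m`, then the sums of `a i * g i` over `(m, n]` are at most `2 * K * g (m + 1)`. -/
theorem norm_sum_Ioc_mul_le_of_antitone {a : ℕ → ℂ} {g : ℕ → ℝ} {K : ℝ} {m : ℕ}
    (ha : ∀ n, ‖∑ i ∈ Ioc 0 n, a i‖ ≤ K) (hg : ∀ n, m < n → g (n + 1) ≤ g n)
    (hg0 : ∀ n, m < n → 0 ≤ g n) (n : ℕ) :
    ‖∑ i ∈ Ioc m n, a i * g i‖ ≤ 2 * K * g (m + 1) := by
  have hK : 0 ≤ K := (norm_nonneg _).trans (ha 0)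
  have hT (n : ℕ) : ‖∑ i ∈ Ioc m n, a i‖ ≤ 2 * K := by
    rcases le_total m n with h | h
    · rw [← add_sub_cancel_left (∑ i ∈ Ioc 0 m, a i) (∑ i ∈ Ioc m n, a i),
        sum_Ioc_consecutive _ (Nat.zero_le m) h]
      linarith [norm_sub_le (∑ i ∈ Ioc 0 n, a i) (∑ i ∈ Ioc 0 m, a i), ha n, ha m]
    · simp [Ioc_eq_empty_of_le h, hK]
  rcases le_total n m with h | h
  · simp only [Ioc_eq_empty_of_le h, sum_empty, norm_zero]
    have := hg0 (m + 1) (by lia)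
    positivity
  have key : ‖∑ i ∈ Ioc m n, a i * g i - g (n + 1) * ∑ i ∈ Ioc m n, a i‖
      ≤ 2 * K * (g (m + 1) - g (n + 1)) := by
    induction n, h using Nat.le_induction with
    | base => simp
    | succ n h ih =>
      have hstep : ∑ i ∈ Ioc m (n + 1), a i * g i - g (n + 1 + 1) * ∑ i ∈ Ioc m (n + 1), a i =
          (∑ i ∈ Ioc m n, a i * g i - g (n + 1) * ∑ i ∈ Ioc m n, a i) +
            ((g (n + 1) - g (n + 1 + 1) : ℝ) : ℂ) * ∑ i ∈ Ioc m (n + 1), a i := by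
        rw [sum_Ioc_succ_top h, sum_Ioc_succ_top h]
        push_cast
        ring
      have hd : 0 ≤ g (n + 1) - g (n + 1 + 1) := sub_nonneg.2 (hg _ (by lia))
      rw [hstep]
      refine (norm_add_le _ _).trans ?_
      rw [norm_mul, Complex.norm_of_nonneg hd]
      linarith [mul_le_mul_of_nonneg_left (hT (n + 1)) hd]
  have hgn := hg0 (n + 1) (by lia)
  have h1 : ‖(g (n + 1) : ℂ) * ∑ i ∈ Ioc m n, a i‖ ≤ g (n + 1) * (2 * K) := by
    rw [norm_mul, Complex.norm_of_nonneg hgn]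
    exact mul_le_mul_of_nonneg_left (hT n) hgn
  linarith [norm_le_norm_sub_add (∑ i ∈ Ioc m n, a i * (g i : ℂ))
    ((g (n + 1) : ℂ) * ∑ i ∈ Ioc m n, a i)]

theorem norm_sum_Ioc_zero_le {f : ℕ → ℂ} {C : ℝ} {m : ℕ}
    (hf : ∀ n, ‖∑ i ∈ Ioc m n, f i‖ ≤ C) (n : ℕ) :
    ‖∑ i ∈ Ioc 0 n, f i‖ ≤ ∑ i ∈ Ioc 0 m, ‖f i‖ + C := by
  rcases le_total m n with h | h
  · rw [← sum_Ioc_consecutive _ (Nat.zero_le m) h]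
    exact (norm_add_le _ _).trans (add_le_add (norm_sum_le _ _) (hf n))
  · have hC : 0 ≤ C := (norm_nonneg _).trans (hf n)
    have : ∑ i ∈ Ioc 0 n, ‖f i‖ ≤ ∑ i ∈ Ioc 0 m, ‖f i‖ :=
      sum_le_sum_of_subset_of_nonneg (Ioc_subset_Ioc_right h) fun _ _ _ ↦ norm_nonneg _
    linarith [norm_sum_le (Ioc 0 n) f]

theorem exists_norm_sum_Ioc_mul_le_of_antitone {a : ℕ → ℂ} {g : ℕ → ℝ} {K : ℝ} (m : ℕ)
    (ha : ∀ n, ‖∑ i ∈ Ioc 0 n, a i‖ ≤ K) (hg : ∀ n, m < n → g (n + 1) ≤ g n)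
    (hg0 : ∀ n, m < n → 0 ≤ g n) : ∃ C, ∀ n, ‖∑ i ∈ Ioc 0 n, a i * g i‖ ≤ C :=
  ⟨_, norm_sum_Ioc_zero_le (norm_sum_Ioc_mul_le_of_antitone ha hg hg0)⟩

namespace DirichletCharacter

variable {q : ℕ} [NeZero q] {χ : DirichletCharacter ℂ q}

theorem norm_sum_Ioc_le (hχ : χ ≠ 1) (n : ℕ) : ‖∑ i ∈ Ioc 0 n, χ i‖ ≤ q + 1 := by
  have hq : ∑ i ∈ range q, χ i = 0 := by
    rw [← MulChar.sum_eq_zero_of_ne_one hχ]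
    refine sum_bij (fun i _ ↦ (i : ZMod q)) (by simp) ?_ ?_ (by simp)
    · intro a ha b hb h
      rw [mem_range] at ha hb
      rwa [ZMod.natCast_eq_natCast_iff', Nat.mod_eq_of_lt ha, Nat.mod_eq_of_lt hb] at h
    · exact fun b _ ↦ ⟨b.val, mem_range.2 b.val_lt, by simp⟩
  have hmul (k : ℕ) : ∑ i ∈ range (q * k), χ i = 0 := by
    induction k with
    | zero => simp
    | succ k ih => simp [mul_add, sum_range_add, ih, hq]
  have hrange (n : ℕ) : ‖∑ i ∈ range n, χ i‖ ≤ q := by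
    rw [← Nat.div_add_mod n q, sum_range_add, hmul, zero_add]
    refine (norm_sum_le_of_le _ fun i _ ↦ χ.norm_le_one _).trans ?_
    simpa using (Nat.mod_lt n (NeZero.pos q)).le
  have h0 : ∑ i ∈ Ioc 0 n, χ i = ∑ i ∈ range (n + 1), χ i - χ (0 : ℕ) := by
    rw [range_eq_Ico, sum_eq_sum_Ico_succ_bot (by lia)]
    simp [← Finset.Ico_add_one_add_one_eq_Ioc]
  rw [h0]
  exact (norm_sub_le _ _).trans (add_le_add (hrange _) (χ.norm_le_one _))

/-- The partial sums of `χ n / n` converge to `L(χ, 1)` with error `O(1 / N)`. -/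
theorem norm_LFunction_one_sub_sum_le (hχ : χ ≠ 1) (N : ℕ) :
    ‖LFunction χ 1 - ∑ n ∈ Ioc 0 N, χ n / n‖ ≤ 2 * (q + 1) / (N + 1) := by
  have hgt : ∀ s : ℝ, 1 < s →
      ‖LFunction χ s - ∑ n ∈ Ioc 0 N, χ n * (n : ℂ) ^ (-(s : ℂ))‖ ≤ 2 * (q + 1) / (N + 1) := by
    intro s hs
    have hterm (n : ℕ) : LSeries.term (fun n : ℕ ↦ χ n) s n = χ n * (n : ℂ) ^ (-(s : ℂ)) := by
      rcases eq_or_ne n 0 with rfl | hn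
      · have : (s : ℂ) ≠ 0 := by exact_mod_cast (by linarith : s ≠ 0)
        simp [this]
      · rw [LSeries.term_of_ne_zero hn, Complex.cpow_neg, div_eq_mul_inv]
    have hsum : HasSum (fun n : ℕ ↦ χ n * (n : ℂ) ^ (-(s : ℂ))) (LFunction χ s) := by
      rw [LFunction_eq_LSeries χ (by simpa using hs)]
      simpa only [LSeriesHasSum, funext hterm] using
        (ZMod.LSeriesSummable_of_one_lt_re χ (s := s) (by simpa using hs)).LSeriesHasSum
    have hlim := ((hsum.tendsto_sum_nat.comp (Filter.tendsto_add_atTop_nat 1)).sub_const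
      (∑ n ∈ Ioc 0 N, χ n * (n : ℂ) ^ (-(s : ℂ)))).norm
    refine le_of_tendsto hlim ?_
    filter_upwards [Filter.eventually_ge_atTop N] with M hM
    have h0 : ∑ n ∈ range (M + 1), χ n * (n : ℂ) ^ (-(s : ℂ)) =
        ∑ n ∈ Ioc 0 M, χ n * (n : ℂ) ^ (-(s : ℂ)) := by
      rw [range_eq_Ico, sum_eq_sum_Ico_succ_bot (by lia), ← hterm 0]
      simp [← Finset.Ico_add_one_add_one_eq_Ioc]
    rw [Function.comp_apply, h0, ← sum_Ioc_consecutive _ (Nat.zero_le N) hM, add_sub_cancel_left]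
    have hle := norm_sum_Ioc_mul_le_of_antitone (g := fun n : ℕ ↦ (n : ℝ) ^ (-s)) (m := N)
      (norm_sum_Ioc_le hχ) (fun n hn ↦ Real.rpow_le_rpow_of_nonpos
        (by exact_mod_cast (by lia : 0 < n)) (by simp) (by linarith))
      (fun n _ ↦ by positivity) M
    have hcast (n : ℕ) : (((n : ℝ) ^ (-s) : ℝ) : ℂ) = (n : ℂ) ^ (-(s : ℂ)) := by
      rw [Complex.ofReal_cpow n.cast_nonneg]
      simp
    simp only [hcast] at hle
    refine hle.trans ?_
    rw [div_eq_mul_inv]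
    gcongr
    rw [← Real.rpow_neg_one]
    push_cast
    exact Real.rpow_le_rpow_of_exponent_le (by simp) (by linarith)
  have hcont : ContinuousAt (fun s : ℝ ↦
      ‖LFunction χ s - ∑ n ∈ Ioc 0 N, χ n * (n : ℂ) ^ (-(s : ℂ))‖) 1 := by
    refine ContinuousAt.norm (ContinuousAt.sub ?_ ?_)
    · exact ((differentiable_LFunction hχ).continuous.comp Complex.continuous_ofReal).continuousAt
    · refine tendsto_finsetSum _ fun n hn ↦ ?_
      have hn0 : (n : ℂ) ≠ 0 := by exact_mod_cast (mem_Ioc.1 hn).1.ne'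
      refine ContinuousAt.mul continuousAt_const
        (ContinuousAt.const_cpow (by fun_prop) (Or.inl hn0))
  have h1 := le_of_tendsto (hcont.tendsto.mono_left (nhdsWithin_le_nhds (s := Set.Ioi 1)))
    (Filter.eventually_of_mem self_mem_nhdsWithin hgt)
  simpa [Complex.cpow_neg, div_eq_mul_inv] using h1

theorem exists_norm_sum_mul_log_div_le (hχ : χ ≠ 1) :
    ∃ C : ℝ, ∀ N : ℕ, ‖∑ n ∈ Ioc 0 N, χ n * (Real.log n / n : ℝ)‖ ≤ C := by
  refine exists_norm_sum_Ioc_mul_le_of_antitone (a := fun n : ℕ ↦ χ n)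
    (g := fun n : ℕ ↦ Real.log n / n) 2 (norm_sum_Ioc_le hχ)
    (fun n hn ↦ ?_) fun n _ ↦ by positivity
  have h3 : Real.exp 1 ≤ n :=
    Real.exp_one_lt_d9.le.trans (by have : (3 : ℝ) ≤ n := by exact_mod_cast hn
                                    linarith)
  refine Real.log_div_self_antitoneOn h3 (h3.trans ?_) ?_ <;> push_cast <;> linarith

open ArithmeticFunction in
theorem sum_mul_log_div_eq {q : ℕ} (χ : DirichletCharacter ℂ q) (N : ℕ) :
    ∑ n ∈ Ioc 0 N, χ n * (Real.log n / n : ℝ) =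
      ∑ d ∈ Ioc 0 N, χ d * (vonMangoldt d / d : ℝ) * ∑ m ∈ Ioc 0 (N / d), χ m / m := by
  let F : ArithmeticFunction ℂ := ⟨fun d ↦ χ d * (vonMangoldt d / d : ℝ), by simp⟩
  let G : ArithmeticFunction ℂ := ⟨fun m ↦ χ m / m, by simp⟩
  have hmul (n : ℕ) : (F * G) n = χ n * (Real.log n / n : ℝ) := by
    rw [mul_apply, ← vonMangoldt_sum,
      ← Nat.sum_divisorsAntidiagonal (f := fun i _ ↦ vonMangoldt i)]
    push_cast
    rw [sum_div, mul_sum]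
    refine sum_congr rfl fun x hx ↦ ?_
    obtain ⟨hx, -⟩ := Nat.mem_divisorsAntidiagonal.1 hx
    simp only [F, G, coe_mk, ← hx]
    push_cast
    rw [map_mul]
    ring
  rw [← sum_congr rfl fun n _ ↦ hmul n]
  exact sum_Ioc_mul_eq_sum_sum F G N

open ArithmeticFunction in
theorem exists_norm_sum_mul_vonMangoldt_div_le (hχ : χ ≠ 1) :
    ∃ C : ℝ, ∀ N : ℕ, ‖∑ n ∈ Ioc 0 N, χ n * (vonMangoldt n / n : ℝ)‖ ≤ C := by
  obtain ⟨C, hC⟩ := exists_norm_sum_mul_log_div_le hχ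
  have hL : 0 < ‖LFunction χ 1‖ := norm_pos_iff.2 (LFunction_apply_one_ne_zero hχ)
  refine ⟨(C + 2 * (q + 1) * (Real.log 4 + 4)) / ‖LFunction χ 1‖, fun N ↦ ?_⟩
  rw [le_div_iff₀ hL, ← norm_mul]
  rcases N.eq_zero_or_pos with rfl | hN
  · have := (norm_nonneg _).trans (hC 0)
    simp only [Ioc_self, sum_empty, zero_mul, norm_zero]
    positivity
  have hN' : (0 : ℝ) < N := by exact_mod_cast hN
  have hdiff : ‖∑ d ∈ Ioc 0 N, χ d * (vonMangoldt d / d : ℝ) *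
      (LFunction χ 1 - ∑ m ∈ Ioc 0 (N / d), χ m / m)‖ ≤
      2 * (q + 1) * (Real.log 4 + 4) := by
    have hle : ∀ d ∈ Ioc 0 N, ‖χ d * (vonMangoldt d / d : ℝ) *
        (LFunction χ 1 - ∑ m ∈ Ioc 0 (N / d), χ m / m)‖ ≤
        2 * (q + 1) / N * vonMangoldt d := by
      intro d hd
      have hd0 : (0 : ℝ) < d := by exact_mod_cast (mem_Ioc.1 hd).1
      have hΛ : 0 ≤ vonMangoldt d / (d : ℝ) := div_nonneg vonMangoldt_nonneg hd0.le
      have hlt : (N : ℝ) / d ≤ (N / d : ℕ) + 1 := by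
        rw [← Nat.floor_div_eq_div (K := ℝ)]
        exact (Nat.lt_floor_add_one _).le
      rw [norm_mul, norm_mul, Complex.norm_of_nonneg hΛ]
      calc _ ≤ 1 * (vonMangoldt d / d) * (2 * (q + 1) / (N / d)) := by
            gcongr
            · exact χ.norm_le_one _
            · refine (norm_LFunction_one_sub_sum_le hχ (N / d)).trans ?_
              gcongr
        _ = _ := by field_simp
    refine (norm_sum_le_of_le _ hle).trans ?_
    have hψ := Chebyshev.psi_le_const_mul_self hN'.le
    rw [Chebyshev.psi, Nat.floor_natCast] at hψ
    rw [← mul_sum, div_mul_eq_mul_div, div_le_iff₀ hN', mul_assoc _ _ (N : ℝ)]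
    gcongr
  have heq : (∑ n ∈ Ioc 0 N, χ n * (vonMangoldt n / n : ℝ)) * LFunction χ 1 =
      ∑ n ∈ Ioc 0 N, χ n * (Real.log n / n : ℝ) + ∑ d ∈ Ioc 0 N, χ d * (vonMangoldt d / d : ℝ) *
        (LFunction χ 1 - ∑ m ∈ Ioc 0 (N / d), χ m / m) := by
    rw [sum_mul_log_div_eq, ← sum_add_distrib, sum_mul]
    exact sum_congr rfl fun d _ ↦ by ring
  rw [heq]
  exact (norm_add_le _ _).trans (add_le_add (hC N) hdiff)

open ArithmeticFunction in
theorem exists_norm_sum_prime_mul_log_div_le (hχ : χ ≠ 1) :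
    ∃ C : ℝ, ∀ N : ℕ, ‖∑ p ∈ Ioc 0 N, (if p.Prime then χ p * (Real.log p / p : ℝ) else 0)‖ ≤ C := by
  obtain ⟨C, hC⟩ := exists_norm_sum_mul_vonMangoldt_div_le hχ
  have hs : Summable fun n : ℕ ↦ (if n.Prime then 0 else vonMangoldt n) / (n : ℝ) := by
    convert vonMangoldt.summable_residueClass_non_primes_div (0 : ZMod 1) using 4
    simp [vonMangoldt.residueClass, Subsingleton.elim _ (0 : ZMod 1)]
  have hnonneg (n : ℕ) : 0 ≤ (if n.Prime then 0 else vonMangoldt n) / (n : ℝ) := by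
    split_ifs
    · simp
    · exact div_nonneg vonMangoldt_nonneg n.cast_nonneg
  refine ⟨C + ∑' n : ℕ, (if n.Prime then 0 else vonMangoldt n) / (n : ℝ), fun N ↦ ?_⟩
  have heq : ∑ p ∈ Ioc 0 N, (if p.Prime then χ p * (Real.log p / p : ℝ) else 0) =
      ∑ n ∈ Ioc 0 N, χ n * (vonMangoldt n / n : ℝ) -
      ∑ n ∈ Ioc 0 N, χ n * ((if n.Prime then 0 else vonMangoldt n) / (n : ℝ) : ℝ) := by
    rw [← sum_sub_distrib]
    refine sum_congr rfl fun n _ ↦ ?_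
    split_ifs with hn
    · simp [vonMangoldt_apply_prime hn]
    · simp
  rw [heq]
  refine (norm_sub_le _ _).trans (add_le_add (hC N) ?_)
  refine (norm_sum_le_of_le _ fun n _ ↦ ?_).trans (hs.sum_le_tsum _ fun n _ ↦ hnonneg n)
  rw [norm_mul, Complex.norm_of_nonneg (hnonneg n)]
  exact mul_le_of_le_one_left (hnonneg n) (χ.norm_le_one _)

/-- **Mertens theorem for nontrivial characters**: the partial sums of `χ p / p` over primes are
bounded. -/
theorem exists_norm_sum_prime_div_le (hχ : χ ≠ 1) :
    ∃ C : ℝ, ∀ N : ℕ, ‖∑ p ∈ Ioc 0 N with p.Prime, χ p / p‖ ≤ C := by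
  obtain ⟨K, hK⟩ := exists_norm_sum_prime_mul_log_div_le hχ
  obtain ⟨C, hC⟩ := exists_norm_sum_Ioc_mul_le_of_antitone (g := fun n : ℕ ↦ (Real.log n)⁻¹) 1 hK
    (fun n hn ↦ by
      have : 0 < Real.log n := Real.log_pos (by exact_mod_cast hn)
      gcongr
      simp)
    fun n _ ↦ by positivity
  refine ⟨C, fun N ↦ (le_of_eq ?_).trans (hC N)⟩
  rw [sum_filter]
  congr 1
  refine sum_congr rfl fun p _ ↦ ?_
  split_ifs with hp
  · have : (Real.log p : ℂ) ≠ 0 := by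
      exact_mod_cast (Real.log_pos (by exact_mod_cast hp.one_lt)).ne'
    simp only [Complex.ofReal_div, Complex.ofReal_inv, Complex.ofReal_natCast]
    field_simp
  · simp

end DirichletCharacter

namespace jacobiSym

open scoped NumberTheorySymbols

/-- The map `n ↦ J(a | n)` on odd numbers, extended by zero to even numbers, is a Dirichlet
character modulo `4 * |a|`. -/
theorem exists_dirichletCharacter {a : ℤ} (ha : a ≠ 0) :
    ∃ χ : DirichletCharacter ℂ (4 * a.natAbs),
      ∀ n : ℕ, χ n = if Odd n then (J(a | n) : ℂ) else 0 := by
  have hpos : 0 < a.natAbs := Int.natAbs_pos.2 ha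
  have : NeZero (4 * a.natAbs) := ⟨by lia⟩
  let f : ℕ → ℂ := fun n ↦ if Odd n then (J(a | n) : ℂ) else 0
  have hper (n : ℕ) : f (n % (4 * a.natAbs)) = f n := by
    have hodd : Odd (n % (4 * a.natAbs)) ↔ Odd n := by
      rw [Nat.odd_iff, Nat.odd_iff, Nat.mod_mod_of_dvd _ ⟨2 * a.natAbs, by ring⟩]
    by_cases hn : Odd n
    · simp only [f, hodd, hn, if_true, ← mod_right a hn]
    · simp only [f, hodd, hn, if_false]
  have hmul (m n : ℕ) : f (m * n) = f m * f n := by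
    by_cases hm : Odd m
    · by_cases hn : Odd n
      · simp only [f, Nat.odd_mul, hm, hn, and_self, if_true, mul_right' a hm.pos.ne' hn.pos.ne',
          Int.cast_mul]
      · simp [f, Nat.odd_mul, hn]
    · simp [f, Nat.odd_mul, hm]
  have hone : f 1 = 1 := by simp [f]
  refine ⟨⟨⟨⟨fun x ↦ f x.val, ?_⟩, fun x y ↦ ?_⟩, fun x hx ↦ ?_⟩, fun n ↦ ?_⟩
  · rw [← Nat.cast_one, ZMod.val_natCast, hper, hone]
  · change f _ = f _ * f _
    rw [ZMod.val_mul, hper, hmul]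
  · change f x.val = 0
    by_cases hodd : Odd x.val
    · rw [← ZMod.natCast_zmod_val x, ZMod.isUnit_iff_coprime] at hx
      have h4 : Nat.Coprime x.val 4 :=
        Nat.Coprime.pow_right 2 (Nat.coprime_two_right.2 hodd)
      have hcop : ¬ Nat.Coprime x.val a.natAbs := fun h ↦ hx (h4.mul_right h)
      have h0 : J(a | x.val) = 0 := by
        rw [eq_zero_iff]
        exact ⟨hodd.pos.ne', fun h ↦ hcop (by rwa [Nat.coprime_comm])⟩
      simp [f, h0]
    · simp [f, hodd]
  · change f _ = f n
    rw [ZMod.val_natCast, hper]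

/-- If `q` is an odd prime not dividing `r`, then `q * r` is a quadratic nonresidue modulo
arbitrarily large primes. -/
theorem exists_prime_gt_eq_neg_one_of_dvd {q : ℕ} {r : ℤ} (hq : q.Prime) (hq2 : q ≠ 2)
    (hqr : ¬ (q : ℤ) ∣ r) (B : ℕ) : ∃ p > B, p.Prime ∧ J(q * r | p) = -1 := by
  have : Fact q.Prime := ⟨hq⟩
  have hr0 : r ≠ 0 := by rintro rfl; simp at hqr
  have hr : 0 < r.natAbs := Int.natAbs_pos.2 hr0
  have hqodd : Odd q := hq.odd_of_ne_two hq2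
  obtain ⟨u, hu⟩ := FiniteField.exists_nonsquare (F := ZMod q) (by rwa [ZMod.ringChar_zmod_n])
  have hcop : Nat.Coprime q (4 * r.natAbs) := by
    refine Nat.Coprime.mul_right (Nat.Coprime.pow_right 2 (Nat.coprime_two_right.2 hqodd)) ?_
    rw [hq.coprime_iff_not_dvd]
    rwa [Int.natCast_dvd] at hqr
  obtain ⟨k, hk1, hk2⟩ := Nat.chineseRemainder hcop u.val 1
  have hu0 : ¬ q ∣ u.val := by
    intro h
    refine hu ⟨0, ?_⟩
    rw [← ZMod.natCast_zmod_val u, (ZMod.natCast_eq_zero_iff _ _).2 h, mul_zero]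
  have hkcop : k.Coprime (q * (4 * r.natAbs)) := by
    refine Nat.Coprime.mul_right ?_ ?_
    · rw [Nat.coprime_comm, hq.coprime_iff_not_dvd, hk1.dvd_iff dvd_rfl]
      exact hu0
    · rw [Nat.Coprime, hk2.gcd_eq, Nat.gcd_one_left]
  obtain ⟨p, hpB, hp, hpk⟩ := Nat.forall_exists_prime_gt_and_modEq (max B 2)
    (mul_ne_zero hq.ne_zero (by lia)) hkcop
  have hp1 : p ≡ 1 [MOD 4 * r.natAbs] := (hpk.of_dvd (Dvd.intro_left _ rfl)).trans hk2
  have hpu : p ≡ u.val [MOD q] := (hpk.of_dvd (Dvd.intro _ rfl)).trans hk1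
  have hpodd : Odd p := hp.odd_of_ne_two (by grind)
  have hp4 : p % 4 = 1 := hp1.of_dvd (Dvd.intro _ rfl)
  refine ⟨p, by grind, hp, ?_⟩
  rw [mul_left, mod_right r hpodd, hp1, Nat.mod_eq_of_lt (by lia), one_right, mul_one,
    quadratic_reciprocity_one_mod_four' hqodd hp4, ZMod.nonsquare_iff_jacobiSym_eq_neg_one]
  rwa [Int.cast_natCast, (ZMod.natCast_eq_natCast_iff _ _ _).2 hpu, ZMod.natCast_zmod_val]

/-- An integer which is not a square is a quadratic nonresidue modulo some odd prime. -/
theorem exists_odd_prime_eq_neg_one {a : ℤ} (ha : ¬ IsSquare a) :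
    ∃ p : ℕ, p.Prime ∧ Odd p ∧ J(a | p) = -1 := by
  have ha0 : a ≠ 0 := by rintro rfl; simp at ha
  obtain ⟨n, b, hbn, hn⟩ := Nat.sq_mul_squarefree a.natAbs
  obtain ⟨s, hs, hsn⟩ : ∃ s : ℤ, a = b ^ 2 * s ∧ s.natAbs = n := by
    rcases Int.natAbs_eq a with h | h
    · exact ⟨n, by rw [h, ← hbn]; push_cast; ring, by simp⟩
    · exact ⟨-n, by rw [h, ← hbn]; push_cast; ring, by simp⟩
  have hs1 : s ≠ 1 := by
    rintro rfl
    exact ha ⟨b, by rw [hs]; ring⟩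
  have hb0 : b ≠ 0 := by rintro rfl; simp [hs] at ha0
  suffices h : ∃ p > max b 2, p.Prime ∧ J(s | p) = -1 by
    obtain ⟨p, hpb, hp, hps⟩ := h
    refine ⟨p, hp, hp.odd_of_ne_two (by grind), ?_⟩
    have hcop : (b : ℤ).gcd p = 1 := by
      rw [Int.gcd_natCast_natCast]
      exact (Nat.coprime_of_lt_prime hb0 (by grind) hp).symm
    rw [hs, mul_left, sq_one' hcop, one_mul, hps]
  by_cases hodd : ∃ q : ℕ, q.Prime ∧ q ≠ 2 ∧ q ∣ n
  · obtain ⟨q, hq, hq2, hqn⟩ := hodd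
    obtain ⟨r, rfl⟩ : (q : ℤ) ∣ s := by rwa [Int.natCast_dvd, hsn]
    refine exists_prime_gt_eq_neg_one_of_dvd hq hq2 (fun hqr ↦ ?_) _
    rw [← hsn, Int.natAbs_mul, Int.natAbs_natCast] at hn
    exact hq.one_lt.ne' (Nat.isUnit_iff.1 (hn q (Nat.mul_dvd_mul_left q (Int.natCast_dvd.1 hqr))))
  · push Not at hodd
    have hn2 : n = 1 ∨ n = 2 := by
      rw [← Nat.dvd_prime Nat.prime_two, ← Nat.prod_primeFactors_of_squarefree hn]
      refine (prod_dvd_prod_of_subset _ {2} _ fun q hq ↦ ?_).trans (by simp)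
      by_contra hq2
      exact hodd q (Nat.prime_of_mem_primeFactors hq) (by simpa using hq2)
        (Nat.dvd_of_mem_primeFactors hq)
    have h8 : ∀ c : ℕ, c.Coprime 8 → ∃ p > max b 2, p.Prime ∧ Odd p ∧ p ≡ c [MOD 8] := by
      intro c hc
      obtain ⟨p, hpb, hp, hpc⟩ := Nat.forall_exists_prime_gt_and_modEq (max b 2) (by simp) hc
      exact ⟨p, hpb, hp, hp.odd_of_ne_two (by grind), hpc⟩
    have hcases : s = -1 ∨ s = 2 ∨ s = -2 := by lia
    rcases hcases with rfl | rfl | rfl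
    · obtain ⟨p, hpb, hp, hodd, hpc⟩ := h8 3 (by norm_num)
      refine ⟨p, hpb, hp, ?_⟩
      rw [at_neg_one hodd, ZMod.χ₄_nat_three_mod_four (hpc.of_dvd (by norm_num))]
    · obtain ⟨p, hpb, hp, hodd, hpc⟩ := h8 3 (by norm_num)
      refine ⟨p, hpb, hp, ?_⟩
      rw [at_two hodd, (ZMod.natCast_eq_natCast_iff _ _ _).2 hpc]
      decide
    · obtain ⟨p, hpb, hp, hodd, hpc⟩ := h8 5 (by norm_num)
      refine ⟨p, hpb, hp, ?_⟩
      rw [at_neg_two hodd, (ZMod.natCast_eq_natCast_iff _ _ _).2 hpc]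
      decide

/-- For a nonsquare integer `a`, the partial sums of `J(a | p) / p` over odd primes are bounded. -/
theorem exists_abs_sum_prime_div_le {a : ℤ} (ha : ¬ IsSquare a) :
    ∃ C : ℝ, ∀ N : ℕ,
      |∑ p ∈ Nat.primesBelow (N + 1), (if Odd p then (J(a | p) : ℝ) else 0) / p| ≤ C := by
  have ha0 : a ≠ 0 := by rintro rfl; simp at ha
  have : NeZero (4 * a.natAbs) := ⟨by simpa using ha0⟩
  obtain ⟨χ, hχ⟩ := exists_dirichletCharacter ha0
  have hχ1 : χ ≠ 1 := by
    rintro rfl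
    obtain ⟨p, -, hodd, hp⟩ := exists_odd_prime_eq_neg_one ha
    have h := hχ p
    rw [if_pos hodd, hp] at h
    by_cases hu : IsUnit (p : ZMod (4 * a.natAbs))
    · rw [MulChar.one_apply hu] at h
      norm_num at h
    · rw [MulChar.map_nonunit _ hu] at h
      norm_num at h
  obtain ⟨C, hC⟩ := DirichletCharacter.exists_norm_sum_prime_div_le hχ1
  refine ⟨C, fun N ↦ (le_of_eq ?_).trans (hC N)⟩
  have hset : Nat.primesBelow (N + 1) = {p ∈ Ioc 0 N | p.Prime} := by
    ext p
    simp only [Nat.mem_primesBelow, mem_filter, mem_Ioc]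
    exact ⟨fun h ↦ ⟨⟨h.2.pos, by lia⟩, h.2⟩, fun h ↦ ⟨by lia, h.2⟩⟩
  rw [hset, ← Real.norm_eq_abs, ← Complex.norm_real]
  push_cast
  congr 1
  refine sum_congr rfl fun p _ ↦ ?_
  rw [hχ]
  split_ifs <;> simp
end jacobiSym

/-- the mean of the Legendre-symbol weight w(p)/p is bounded. -/
theorem legendre_weight_mean_bounded (Δ Δ' : ℤ)
    (h1 : ¬ IsSquare Δ) (h2 : ¬ IsSquare Δ')
    (w : ℕ → ℝ)
    (hw : ∀ p : ℕ, p.Prime →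
      w p = if Odd p ∧ ¬ ((p : ℤ) ∣ Δ)
        then ((jacobiSym Δ' p : ℝ) - (jacobiSym Δ p : ℝ)) / 2 else 0) :
    ∃ C : ℝ, ∀ x : ℝ, 2 ≤ x →
      |∑ p ∈ Nat.primesBelow (⌊x⌋₊ + 1), w p / p| ≤ C := by
  obtain ⟨C, hC⟩ := jacobiSym.exists_abs_sum_prime_div_le h1
  obtain ⟨C', hC'⟩ := jacobiSym.exists_abs_sum_prime_div_le h2
  have hΔ : Δ.natAbs ≠ 0 := by
    rw [Int.natAbs_ne_zero]
    rintro rfl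
    simp at h1
  let j (a : ℤ) (p : ℕ) : ℝ := (if Odd p then (jacobiSym a p : ℝ) else 0) / p
  have hle (a : ℤ) (p : ℕ) (hp : p.Prime) : |j a p| ≤ 1 := by
    have hp1 : (1 : ℝ) ≤ p := by exact_mod_cast hp.one_le
    rw [abs_div, Nat.abs_cast, div_le_one (by linarith)]
    refine le_trans ?_ hp1
    split_ifs
    · rcases jacobiSym.trichotomy a p with h | h | h <;> simp [h]
    · simp
  have hdiff (p : ℕ) (hp : p.Prime) :
      w p / p - (j Δ' p - j Δ p) / 2 = if p ∣ Δ.natAbs then -((j Δ' p - j Δ p) / 2) else 0 := by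
    simp only [hw p hp, j, Int.natCast_dvd]
    by_cases hodd : Odd p <;> by_cases hdvd : p ∣ Δ.natAbs <;> simp [hodd, hdvd]
    ring
  refine ⟨(C' + C) / 2 + #Δ.natAbs.divisors, fun x _ ↦ ?_⟩
  have hmain : |∑ p ∈ Nat.primesBelow (⌊x⌋₊ + 1), (j Δ' p - j Δ p) / 2| ≤ (C' + C) / 2 := by
    rw [← sum_div, sum_sub_distrib, abs_div, abs_two]
    have := abs_sub (∑ p ∈ Nat.primesBelow (⌊x⌋₊ + 1), j Δ' p)
      (∑ p ∈ Nat.primesBelow (⌊x⌋₊ + 1), j Δ p)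
    linarith [hC ⌊x⌋₊, hC' ⌊x⌋₊]
  have herr : |∑ p ∈ Nat.primesBelow (⌊x⌋₊ + 1), (w p / p - (j Δ' p - j Δ p) / 2)| ≤
      #Δ.natAbs.divisors := by
    rw [sum_congr rfl fun p hp ↦ hdiff p (Nat.prime_of_mem_primesBelow hp), ← sum_filter]
    refine (abs_sum_le_sum_abs _ _).trans ((sum_le_card_nsmul _ _ 1 fun p hp ↦ ?_).trans ?_)
    · have hp := Nat.prime_of_mem_primesBelow (mem_filter.1 hp).1
      have h := abs_le.1 (hle Δ p hp)
      have h' := abs_le.1 (hle Δ' p hp)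
      rw [abs_le]
      constructor <;> linarith
    · rw [nsmul_one, Nat.cast_le]
      exact card_le_card fun p hp ↦ Nat.mem_divisors.2 ⟨(mem_filter.1 hp).2, hΔ⟩
  rw [sum_sub_distrib] at herr
  rw [abs_le] at hmain herr ⊢
  constructor <;> linarith
end
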